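/- arXiv:2012.08346 — 3 statements merged into one kernel-verified Lean document; each statement's English description precedes it below -/
import Mathlib

section
/- Let m, n ≥ 1, let A ∈ ℝ^{m×n} and c ∈ ℝ^n have i.i.d. standard Gaussian N(0,1) entries, and let b ∈ ℝ^m. Set δ := (√(2π)/n)·‖b⁻‖₂ and assume δ ∈ [0, 1/2); let ε ∈ (0, 1/5), α := (1/√(2π))·√( ((1−3ε)/(1−ε))² − δ² ), and choose β ∈ [1/2, 1] with H(β) = α²/4, where H(x) = −x·log x − (1−x)·log(1−x). Then with probability at least 1 − 2·(1 + 2/ε)^{m+1}·e^{−ε²n/(8π)} − e^{−α²n/4}, all of the following hold: (1) val_LP(A,b,c) := sup{c·x : Ax ≤ b, x ∈ [0,1]^n} ≥ αn; (2) every u ≥ 0 minimizing the dual objective val*(u) := b·u + Σ_{i=1}^n (c − Aᵀu)_i⁺ over u ∈ ℝ^m, u ≥ 0, satisfies ‖u‖₂ ≤ (1+ε)/(1 − 3ε − (1−ε)δ); (3) every optimal solution x* of the LP sup{c·x : Ax ≤ b, x ∈ [0,1]^n} having at most m coordinates in the open interval (0,1) satisfies |{i ∈ [n] : x*_i = 0}|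 ≥ (1−β)n − m. -/
open MeasureTheory ProbabilityTheory

/-- The value of the LP relaxation `max cᵀx, Ax ≤ b, x ∈ [0,1]ⁿ`. -/
noncomputable def valLP {m n : ℕ} (A : Matrix (Fin m) (Fin n) ℝ) (b : Fin m → ℝ)
    (c : Fin n → ℝ) : ℝ :=
  sSup {v | ∃ x : Fin n → ℝ, (∀ i, x i ∈ Set.Icc (0 : ℝ) 1) ∧ (∀ j, A.mulVec x j ≤ b j) ∧
    v = ∑ i, c i * x i}

/-- The dual objective `val*(u) = bᵀu + Σᵢ (c − Aᵀu)ᵢ⁺`. -/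
noncomputable def dualObj {m n : ℕ} (A : Matrix (Fin m) (Fin n) ℝ) (b : Fin m → ℝ)
    (c : Fin n → ℝ) (u : Fin m → ℝ) : ℝ :=
  (∑ j, b j * u j) + ∑ i, max (c i - ∑ j, A j i * u j) 0


lemma aux_mean : ∫ x, max x 0 ∂(gaussianReal 0 1) = 1 / Real.sqrt (2 * Real.pi) := by
  rw [integral_gaussianReal_eq_integral_smul (by norm_num)]
  have h1 : ∀ x : ℝ, gaussianPDFReal 0 1 x • max x 0 =
      (Set.Ioi (0:ℝ)).indicator (fun x => (Real.sqrt (2 * Real.pi))⁻¹ *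
        (x ^ (1:ℝ) * Real.exp (-(1/2) * x ^ (2:ℝ)))) x := by
    intro x
    by_cases hx : 0 < x
    · rw [Set.indicator_of_mem (by exact hx), max_eq_left hx.le, gaussianPDFReal]
      simp
      have : -x^2/2 = -(2⁻¹ * x^2) := by ring
      rw [this]; ring
    · rw [Set.indicator_of_notMem (by exact hx), max_eq_right (not_lt.1 hx)]; simp
  simp_rw [h1]
  rw [integral_indicator measurableSet_Ioi, integral_const_mul,
    integral_rpow_mul_exp_neg_mul_rpow (by norm_num) (by norm_num) (by norm_num)]
  norm_num

lemma aux_int (t : ℝ) : Integrable (fun x : ℝ => Real.exp (t * max x 0)) (gaussianReal 0 1) := by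
  refine Integrable.mono' ((integrable_exp_mul_gaussianReal t).add (integrable_const 1))
    (by fun_prop) (ae_of_all _ fun x => ?_)
  rw [Real.norm_of_nonneg (Real.exp_pos _).le]
  simp only [Pi.add_apply]
  rcases le_total x 0 with h | h
  · rw [max_eq_right h]; simp [(Real.exp_pos _).le]
  · rw [max_eq_left h]; linarith

lemma aux_int0 : Integrable (fun x : ℝ => max x 0) (gaussianReal 0 1) := by
  refine Integrable.mono' (aux_int 1) (by fun_prop) (ae_of_all _ fun x => ?_)
  rw [Real.norm_of_nonneg (le_max_right _ _), one_mul]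
  linarith [Real.add_one_le_exp (max x 0)]

lemma aux_cosh (t x y : ℝ) : Real.exp (t * max x 0) * Real.exp (-t * max y 0) +
    Real.exp (-t * max x 0) * Real.exp (t * max y 0) ≤
    Real.exp (t * x) * Real.exp (-t * y) + Real.exp (-t * x) * Real.exp (t * y) := by
  have key : Real.cosh (t * (max x 0 - max y 0)) ≤ Real.cosh (t * (x - y)) := by
    rw [Real.cosh_le_cosh, abs_mul, abs_mul]
    refine mul_le_mul_of_nonneg_left ?_ (abs_nonneg _)
    exact abs_max_sub_max_le_abs x y 0
  rw [Real.cosh_eq, Real.cosh_eq] at key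
  simp only [← Real.exp_add]
  have e1 : t * max x 0 + -t * max y 0 = t * (max x 0 - max y 0) := by ring
  have e2 : -t * max x 0 + t * max y 0 = -(t * (max x 0 - max y 0)) := by ring
  have e3 : t * x + -t * y = t * (x - y) := by ring
  have e4 : -t * x + t * y = -(t * (x - y)) := by ring
  rw [e1, e2, e3, e4]
  linarith

lemma aux_prod (t : ℝ) : (∫ x, Real.exp (t * max x 0) ∂(gaussianReal 0 1)) *
    (∫ x, Real.exp (-t * max x 0) ∂(gaussianReal 0 1)) ≤ Real.exp (t ^ 2) := by
  set μ := gaussianReal 0 1 with hμ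
  have hI : ∀ (f g : ℝ → ℝ), Integrable f μ → Integrable g μ →
      Integrable (fun z : ℝ × ℝ => f z.1 * g z.2) (μ.prod μ) := fun f g hf hg => hf.mul_prod hg
  have h := integral_mono (μ := μ.prod μ)
    ((hI _ _ (aux_int t) (aux_int (-t))).add (hI _ _ (aux_int (-t)) (aux_int t)))
    ((hI _ _ (integrable_exp_mul_gaussianReal t) (integrable_exp_mul_gaussianReal (-t))).add
      (hI _ _ (integrable_exp_mul_gaussianReal (-t)) (integrable_exp_mul_gaussianReal t)))
    (fun z => aux_cosh t z.1 z.2)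
  simp only [Pi.add_apply] at h
  rw [integral_add (hI _ _ (aux_int t) (aux_int (-t))) (hI _ _ (aux_int (-t)) (aux_int t)),
    integral_add (hI _ _ (integrable_exp_mul_gaussianReal t) (integrable_exp_mul_gaussianReal (-t)))
      (hI _ _ (integrable_exp_mul_gaussianReal (-t)) (integrable_exp_mul_gaussianReal t))] at h
  rw [integral_prod_mul (fun x => Real.exp (t * max x 0)) (fun x => Real.exp (-t * max x 0)),
    integral_prod_mul (fun x => Real.exp (-t * max x 0)) (fun x => Real.exp (t * max x 0)),
    integral_prod_mul (fun x => Real.exp (t * x)) (fun x => Real.exp (-t * x)),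
    integral_prod_mul (fun x => Real.exp (-t * x)) (fun x => Real.exp (t * x))] at h
  have hm : ∀ s : ℝ, ∫ x, Real.exp (s * x) ∂μ = Real.exp (s ^ 2 / 2) := by
    intro s
    have := congrFun (mgf_id_gaussianReal (μ := 0) (v := 1)) s
    simpa [mgf] using this
  rw [hm, hm] at h
  have : Real.exp (t^2) = Real.exp (t^2/2) * Real.exp ((-t)^2/2) := by
    rw [← Real.exp_add]; ring_nf
  rw [this]
  linarith

lemma aux_subG : HasSubgaussianMGF (fun x : ℝ => max x 0 - 1 / Real.sqrt (2 * Real.pi)) 2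
    (gaussianReal 0 1) := by
  set M := 1 / Real.sqrt (2 * Real.pi) with hM
  have he : ∀ t x : ℝ, Real.exp (t * (max x 0 - M)) = Real.exp (t * max x 0) * Real.exp (-t * M) := by
    intro t x; rw [← Real.exp_add]; ring_nf
  constructor
  · intro t
    simp_rw [he]
    exact (aux_int t).mul_const _
  · intro t
    rw [mgf]
    simp_rw [he]
    rw [integral_mul_const]
    have hJ : Real.exp (-t * M) ≤ ∫ x, Real.exp (-t * max x 0) ∂(gaussianReal 0 1) := by
      have := convexOn_exp.map_integral_le (μ := gaussianReal 0 1) (f := fun x => -t * max x 0)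
        Real.continuous_exp.continuousOn isClosed_univ (by simp) (aux_int0.const_mul _)
        (aux_int (-t))
      rwa [integral_const_mul, aux_mean] at this
    calc _ ≤ _ := mul_le_mul_of_nonneg_left hJ (integral_nonneg fun x => (Real.exp_pos _).le)
      _ ≤ _ := aux_prod t
      _ = _ := by simp

lemma aux_char {κ : Type*} [Fintype κ] (w : κ → ℝ) :
    ∫ x : κ → ℝ, Complex.exp ((∑ k, w k * x k : ℝ) * Complex.I)
      ∂(Measure.pi fun _ : κ => gaussianReal 0 1) = Complex.exp (-(∑ k, w k ^ 2 : ℝ) / 2) := by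
  have : ∀ x : κ → ℝ, Complex.exp ((∑ k, w k * x k : ℝ) * Complex.I) =
      ∏ k, Complex.exp ((w k : ℂ) * x k * Complex.I) := by
    intro x; rw [← Complex.exp_sum]; push_cast; rw [Finset.sum_mul]
  simp_rw [this]
  rw [integral_fintype_prod_eq_prod (𝕜 := ℂ) (f := fun k (y : ℝ) => Complex.exp ((w k : ℂ) * y * Complex.I))]
  have h2 : ∀ s : ℝ, ∫ y : ℝ, Complex.exp ((s:ℂ) * y * Complex.I) ∂(gaussianReal 0 1) =
      Complex.exp (-(s:ℂ)^2/2) := by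
    intro s
    have := charFun_gaussianReal (μ := 0) (v := 1) s
    rw [charFun_apply_real] at this
    rw [this]; simp [neg_div]
  simp_rw [h2]
  rw [← Complex.exp_sum]
  push_cast
  rw [← Finset.sum_neg_distrib, Finset.sum_div]

lemma aux_law {m n : ℕ} (a : ℝ) (u : Fin m → ℝ) (h : a ^ 2 + ∑ j, u j ^ 2 = 1) :
    ((Measure.pi fun _ : Fin m × Fin n => gaussianReal 0 1).prod
        (Measure.pi fun _ : Fin n => gaussianReal 0 1)).map
      (fun ω i => a * ω.2 i - ∑ j, ω.1 (j, i) * u j) = Measure.pi fun _ : Fin n => gaussianReal 0 1 := by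
  have hmeas : Measurable (fun (ω : (Fin m × Fin n → ℝ) × (Fin n → ℝ)) (i : Fin n) =>
      a * ω.2 i - ∑ j, ω.1 (j, i) * u j) := by fun_prop
  have : IsProbabilityMeasure (((Measure.pi fun _ : Fin m × Fin n => gaussianReal 0 1).prod
        (Measure.pi fun _ : Fin n => gaussianReal 0 1)).map
      (fun ω i => a * ω.2 i - ∑ j, ω.1 (j, i) * u j)) :=
    Measure.isProbabilityMeasure_map hmeas.aemeasurable
  apply Measure.ext_of_charFunDual
  ext L
  rw [charFunDual_apply, charFunDual_apply, integral_map hmeas.aemeasurable (by fun_prop)]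
  set l : Fin n → ℝ := fun i => L (Pi.single i 1) with hl
  have hL : ∀ x, L x = ∑ i, l i * x i := by
    intro x
    conv_lhs => rw [← Finset.univ_sum_single x]
    rw [map_sum]
    refine Finset.sum_congr rfl fun i _ => ?_
    have : Pi.single i (x i) = x i • (Pi.single i (1:ℝ) : Fin n → ℝ) := by
      rw [← Pi.single_smul]; simp
    rw [this, map_smul, smul_eq_mul, mul_comm]
  simp_rw [hL]
  rw [aux_char]
  have h3 : ∀ ω : (Fin m × Fin n → ℝ) × (Fin n → ℝ),
      Complex.exp ((∑ i, l i * (a * ω.2 i - ∑ j, ω.1 (j, i) * u j) : ℝ) * Complex.I) =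
      Complex.exp ((∑ k : Fin m × Fin n, (-(l k.2 * u k.1)) * ω.1 k : ℝ) * Complex.I) *
      Complex.exp ((∑ i, (l i * a) * ω.2 i : ℝ) * Complex.I) := by
    intro ω
    rw [← Complex.exp_add, ← add_mul, ← Complex.ofReal_add]
    congr 3
    rw [Fintype.sum_prod_type_right, ← Finset.sum_add_distrib]
    refine Finset.sum_congr rfl fun i _ => ?_
    rw [mul_sub, Finset.mul_sum, sub_eq_neg_add, ← Finset.sum_neg_distrib]
    congr 1
    · refine Finset.sum_congr rfl fun j _ => ?_
      ring
    · ring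
  simp_rw [h3]
  rw [integral_prod_mul
    (fun x : Fin m × Fin n → ℝ => Complex.exp ((∑ k : Fin m × Fin n, (-(l k.2 * u k.1)) * x k : ℝ) * Complex.I))
    (fun y : Fin n → ℝ => Complex.exp ((∑ i, (l i * a) * y i : ℝ) * Complex.I)), aux_char, aux_char,
    ← Complex.exp_add]
  congr 1
  rw [← add_div, ← neg_add, ← Complex.ofReal_add]
  congr 3
  rw [Fintype.sum_prod_type_right, ← Finset.sum_add_distrib]
  refine Finset.sum_congr rfl fun i _ => ?_
  have : ∑ j, (-(l i * u j))^2 = l i ^ 2 * ∑ j, u j ^ 2 := by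
    rw [Finset.mul_sum]; refine Finset.sum_congr rfl fun j _ => ?_
    ring
  simp only [this]
  linear_combination (l i ^ 2) * h

lemma aux_tail {n : ℕ} (hn : 1 ≤ n) (ε : ℝ) (hε : 0 < ε) :
    (Measure.pi fun _ : Fin n => gaussianReal 0 1).real
      {x | ¬ ((1 - ε) * (n / Real.sqrt (2 * Real.pi)) ≤ ∑ i, max (x i) 0 ∧
        ∑ i, max (x i) 0 ≤ (1 + ε) * (n / Real.sqrt (2 * Real.pi)))} ≤
      2 * Real.exp (-ε ^ 2 * n / (8 * Real.pi)) := by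
  set P := Measure.pi fun _ : Fin n => gaussianReal 0 1 with hP
  set M := 1 / Real.sqrt (2 * Real.pi) with hM
  have hn' : (0:ℝ) < n := by exact_mod_cast hn
  have hM0 : 0 < M := by positivity
  have hind : iIndepFun (fun (i : Fin n) (x : Fin n → ℝ) => max (x i) 0 - M) P :=
    iIndepFun_pi (X := fun _ (x : ℝ) => max x 0 - M) (fun _ => by fun_prop)
  have hs : ∀ i ∈ Finset.univ, HasSubgaussianMGF (fun (x : Fin n → ℝ) => max (x i) 0 - M) 2 P := by
    intro i _
    refine HasSubgaussianMGF.of_map (X := fun x : ℝ => max x 0 - M) (Y := fun x : Fin n → ℝ => x i)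
      (measurable_pi_apply i).aemeasurable ?_
    have : P.map (fun x : Fin n → ℝ => x i) = gaussianReal 0 1 :=
      (measurePreserving_eval (fun _ : Fin n => gaussianReal 0 1) i).map_eq
    rw [this]
    exact aux_subG
  have hsum := HasSubgaussianMGF.sum_of_iIndepFun hind hs
  have t1 := hsum.measure_ge_le (ε := ε * n * M) (by positivity)
  have t2 := hsum.neg.measure_ge_le (ε := ε * n * M) (by positivity)
  have hexp : -(ε * n * M)^2 / (2 * ((∑ i : Fin n, (2 : NNReal) : NNReal) : ℝ)) = -ε ^ 2 * n / (8 * Real.pi) := by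
    have : M ^ 2 = 1 / (2 * Real.pi) := by
      rw [hM, div_pow, Real.sq_sqrt (by positivity)]; simp
    rw [mul_pow, mul_pow, this]
    simp
    field_simp
    ring
  rw [hexp] at t1 t2
  have hS : ∀ x : Fin n → ℝ, ∑ i, (max (x i) 0 - M) = ∑ i, max (x i) 0 - n * M := by
    intro x; simp
  calc _ ≤ P.real ({x | ε * n * M ≤ ∑ i, (max (x i) 0 - M)} ∪
        {x | ε * n * M ≤ (-fun x : Fin n → ℝ => ∑ i, (max (x i) 0 - M)) x}) := by
        refine measureReal_mono ?_
        intro x hx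
        by_contra hcon
        apply hx
        simp only [Set.mem_union, Set.mem_ofPred_eq, not_or, not_le, Pi.neg_apply, hS] at hcon
        have : (n:ℝ) / Real.sqrt (2 * Real.pi) = n * M := by rw [hM]; ring
        rw [this]
        constructor <;> nlinarith
    _ ≤ _ := measureReal_union_le _ _
    _ ≤ _ := by linarith

lemma aux_tail2 {m n : ℕ} (hn : 1 ≤ n) (ε : ℝ) (hε : 0 < ε)
    (a : ℝ) (u : Fin m → ℝ) (h : a ^ 2 + ∑ j, u j ^ 2 = 1) :
    ((Measure.pi fun _ : Fin m × Fin n => gaussianReal 0 1).prod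
        (Measure.pi fun _ : Fin n => gaussianReal 0 1)).real
      {ω | ¬ ((1 - ε) * (n / Real.sqrt (2 * Real.pi)) ≤
          ∑ i, max (a * ω.2 i - ∑ j, ω.1 (j, i) * u j) 0 ∧
        ∑ i, max (a * ω.2 i - ∑ j, ω.1 (j, i) * u j) 0 ≤ (1 + ε) * (n / Real.sqrt (2 * Real.pi)))} ≤
      2 * Real.exp (-ε ^ 2 * n / (8 * Real.pi)) := by
  refine le_trans (le_of_eq ?_) (aux_tail hn ε hε)
  have hset : MeasurableSet {x : Fin n → ℝ | ¬ ((1 - ε) * (n / Real.sqrt (2 * Real.pi)) ≤ ∑ i, max (x i) 0 ∧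
        ∑ i, max (x i) 0 ≤ (1 + ε) * (n / Real.sqrt (2 * Real.pi)))} := by
    have hm : Measurable (fun x : Fin n → ℝ => ∑ i, max (x i) 0) := by fun_prop
    exact ((measurableSet_le measurable_const hm).inter (measurableSet_le hm measurable_const)).compl
  have key := map_measureReal_apply (μ := (Measure.pi fun _ : Fin m × Fin n => gaussianReal 0 1).prod
        (Measure.pi fun _ : Fin n => gaussianReal 0 1)) (f := fun ω i => a * ω.2 i - ∑ j, ω.1 (j, i) * u j)
    (by fun_prop) hset
  rw [aux_law a u h] at key
  rw [key]
  rfl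

lemma aux_dual {m n : ℕ} (A : Matrix (Fin m) (Fin n) ℝ) (b : Fin m → ℝ) (c : Fin n → ℝ) (T : ℝ)
    (h : ∀ (a : ℝ) (u : Fin m → ℝ), 0 ≤ a → (∀ j, 0 ≤ u j) →
      a * T ≤ ∑ j, b j * u j + ∑ i, max (a * c i - ∑ j, A j i * u j) 0) : T ≤ valLP A b c := by
  by_contra hlt
  push Not at hlt
  have hbdd : BddAbove {v | ∃ x : Fin n → ℝ, (∀ i, x i ∈ Set.Icc (0 : ℝ) 1) ∧
      (∀ j, A.mulVec x j ≤ b j) ∧ v = ∑ i, c i * x i} := by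
    refine ⟨∑ i, |c i|, ?_⟩
    rintro v ⟨x, hx, -, rfl⟩
    refine Finset.sum_le_sum fun i _ => ?_
    have h1 := (hx i).1
    have h2 := (hx i).2
    calc c i * x i ≤ |c i| * x i := mul_le_mul_of_nonneg_right (le_abs_self _) h1
      _ ≤ |c i| * 1 := mul_le_mul_of_nonneg_left h2 (abs_nonneg _)
      _ = |c i| := mul_one _
  let Lm : (Fin n → ℝ) →ₗ[ℝ] (Fin m → ℝ) × ℝ :=
    (Matrix.mulVecLin A).prod (∑ i, c i • LinearMap.proj i)
  have hLm : ∀ x, Lm x = (A.mulVec x, ∑ i, c i * x i) := by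
    intro x; simp [Lm]
  let C : Set (Fin n → ℝ) := Set.pi Set.univ fun _ => Set.Icc (0:ℝ) 1
  have hC1 : IsCompact C := isCompact_univ_pi fun _ => isCompact_Icc
  have hC2 : Convex ℝ C := convex_pi fun _ _ => convex_Icc 0 1
  have hLc : Continuous Lm := LinearMap.continuous_of_finiteDimensional Lm
  have hdis : Disjoint (Lm '' C) (Set.Iic b ×ˢ Set.Ici T) := by
    rw [Set.disjoint_left]
    rintro _ ⟨x, hx, rfl⟩ hy
    rw [hLm] at hy
    have : ∑ i, c i * x i ≤ valLP A b c :=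
      le_csSup hbdd ⟨x, fun i => hx i (Set.mem_univ i), fun j => hy.1 j, rfl⟩
    have h2 : T ≤ ∑ i, c i * x i := hy.2
    linarith
  obtain ⟨f, p, q, hp, hpq, hq⟩ := geometric_hahn_banach_compact_closed
    (hC2.linear_image Lm) (hC1.image hLc) ((convex_Iic b).prod (convex_Ici T))
    (isClosed_Iic.prod isClosed_Ici) hdis
  set a : ℝ := f (0, 1) with ha
  set u : Fin m → ℝ := fun j => - f (Pi.single j 1, 0) with hu
  have hf : ∀ (y : Fin m → ℝ) (t : ℝ), f (y, t) = a * t - ∑ j, y j * u j := by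
    intro y t
    have e : (y, t) = (∑ j, y j • ((Pi.single j 1 : Fin m → ℝ), (0:ℝ))) + t • ((0 : Fin m → ℝ), (1:ℝ)) := by
      ext k
      · simp [Prod.fst_sum, Finset.sum_apply, Pi.single_apply]
      · simp [Prod.snd_sum]
    rw [e, map_add, map_sum, map_smul]
    simp only [map_smul, smul_eq_mul, hu, mul_neg, Finset.sum_neg_distrib]
    rw [← ha]; ring
  have ha0 : 0 ≤ a := by
    by_contra hneg
    push Not at hneg
    obtain ⟨k, hk⟩ : ∃ k : ℝ, k = max 0 ((q - f (b, T)) / a) := ⟨_, rfl⟩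
    have h0 : 0 ≤ k := hk ▸ le_max_left _ _
    have h1 : (q - f (b, T)) / a ≤ k := hk ▸ le_max_right _ _
    have h2 := hq (b, T + k) ⟨le_refl b, by simp [h0]⟩
    rw [div_le_iff_of_neg hneg] at h1
    rw [hf] at h1 h2
    nlinarith
  have hu0 : ∀ j, 0 ≤ u j := by
    intro j
    by_contra hneg
    push Not at hneg
    obtain ⟨k, hk⟩ : ∃ k : ℝ, k = max 0 ((q - f (b, T)) / u j) := ⟨_, rfl⟩
    have h0 : 0 ≤ k := hk ▸ le_max_left _ _
    have h1 : (q - f (b, T)) / u j ≤ k := hk ▸ le_max_right _ _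
    have h2 := hq (b - k • Pi.single j 1, T) ⟨by
      intro i
      simp only [Pi.sub_apply, Pi.smul_apply, smul_eq_mul, Pi.single_apply]
      split_ifs <;> simp [h0], le_refl T⟩
    rw [div_le_iff_of_neg hneg] at h1
    have h3 : ∑ i, (b - k • Pi.single j 1 : Fin m → ℝ) i * u i = ∑ i, b i * u i - k * u j := by
      simp [sub_mul, Finset.sum_sub_distrib, Pi.single_apply]
    rw [hf, h3] at h2
    rw [hf] at h1
    linarith
  have hfin := h a u ha0 hu0
  let x : Fin n → ℝ := fun i => if 0 < a * c i - ∑ j, A j i * u j then 1 else 0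
  have hx : x ∈ C := by
    intro i _
    simp only [x]
    split_ifs <;> simp
  have h1 := hp _ ⟨x, hx, rfl⟩
  have h2 := hq (b, T) ⟨le_refl b, le_refl T⟩
  rw [hLm, hf] at h1
  rw [hf] at h2
  have h3 : a * ∑ i, c i * x i - ∑ j, A.mulVec x j * u j =
      ∑ i, max (a * c i - ∑ j, A j i * u j) 0 := by
    have : ∑ j, A.mulVec x j * u j = ∑ i, x i * ∑ j, A j i * u j := by
      simp only [Matrix.mulVec, dotProduct, Finset.sum_mul, Finset.mul_sum]
      rw [Finset.sum_comm]
      refine Finset.sum_congr rfl fun i _ => Finset.sum_congr rfl fun j _ => ?_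
      ring
    rw [this, Finset.mul_sum, ← Finset.sum_sub_distrib]
    refine Finset.sum_congr rfl fun i _ => ?_
    simp only [x]
    split_ifs with hc
    · rw [max_eq_left hc.le]; ring
    · rw [max_eq_right (not_lt.1 hc)]; ring
  linarith

lemma aux_net {E : Type*} [NormedAddCommGroup E] [NormedSpace ℝ E] [FiniteDimensional ℝ E]
    (ε : ℝ) (hε : 0 < ε) :
    ∃ N : Finset E, (N.card : ℝ) ≤ (1 + 2 / ε) ^ Module.finrank ℝ E ∧
      (∀ v ∈ N, ‖v‖ = 1) ∧ ∀ v : E, ‖v‖ = 1 → ∃ w ∈ N, ‖v - w‖ ≤ ε := by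
  classical
  have hcard : ∀ s : Finset E, (∀ v ∈ s, ‖v‖ = 1) → (∀ v ∈ s, ∀ w ∈ s, v ≠ w → ε ≤ ‖v - w‖) →
      (s.card : ℝ) ≤ (1 + 2 / ε) ^ Module.finrank ℝ E := by
    intro s hs h
    borelize E
    let μ : Measure E := Measure.addHaar
    let δ : ℝ := ε / 2
    let ρ : ℝ := 1 + ε / 2
    have δpos : 0 < δ := by positivity
    have ρpos : 0 < ρ := by positivity
    set A := ⋃ c ∈ s, Metric.ball (c : E) δ with hA
    have D : Set.Pairwise (s : Set E) (Function.onFun Disjoint fun c => Metric.ball (c : E) δ) := by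
      rintro c hc d hd hcd
      apply Metric.ball_disjoint_ball
      rw [dist_eq_norm]
      have := h c hc d hd hcd
      simp only [δ]; linarith
    have A_subset : A ⊆ Metric.ball (0 : E) ρ := by
      refine Set.iUnion₂_subset fun x hx => ?_
      apply Metric.ball_subset_ball'
      rw [dist_zero_right, hs x hx]
      simp only [δ, ρ]; linarith
    have I : (s.card : ENNReal) * ENNReal.ofReal (δ ^ Module.finrank ℝ E) * μ (Metric.ball 0 1) ≤
        ENNReal.ofReal (ρ ^ Module.finrank ℝ E) * μ (Metric.ball 0 1) :=
      calc
        (s.card : ENNReal) * ENNReal.ofReal (δ ^ Module.finrank ℝ E) * μ (Metric.ball 0 1) = μ A := by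
          rw [hA, measure_biUnion_finset D fun c _ => measurableSet_ball]
          simp only [μ.addHaar_ball_of_pos _ δpos]
          simp only [Finset.sum_const, nsmul_eq_mul, mul_assoc]
        _ ≤ μ (Metric.ball (0 : E) ρ) := measure_mono A_subset
        _ = ENNReal.ofReal (ρ ^ Module.finrank ℝ E) * μ (Metric.ball 0 1) := by
          simp only [μ.addHaar_ball_of_pos _ ρpos]
    have J : (s.card : ENNReal) * ENNReal.ofReal (δ ^ Module.finrank ℝ E) ≤
        ENNReal.ofReal (ρ ^ Module.finrank ℝ E) :=
      (ENNReal.mul_le_mul_iff_left (Metric.measure_ball_pos _ _ zero_lt_one).ne' measure_ball_lt_top.ne).1 I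
    have K := ENNReal.toReal_le_of_le_ofReal (pow_nonneg ρpos.le _) J
    rw [ENNReal.toReal_mul, ENNReal.toReal_ofReal (by positivity), ENNReal.toReal_natCast,
      ← le_div_iff₀ (by positivity), ← div_pow] at K
    have e : ρ / δ = 1 + 2 / ε := by
      simp only [ρ, δ]; field_simp; ring
    rwa [e] at K
  obtain ⟨K, hK⟩ := exists_nat_ge ((1 + 2 / ε) ^ Module.finrank ℝ E)
  let p : ℕ → Prop := fun k => ∃ s : Finset E, s.card = k ∧ (∀ v ∈ s, ‖v‖ = 1) ∧
    (∀ v ∈ s, ∀ w ∈ s, v ≠ w → ε ≤ ‖v - w‖)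
  have hp0 : p 0 := ⟨∅, by simp⟩
  have hspec := Nat.findGreatest_spec (P := p) (Nat.zero_le K) hp0
  obtain ⟨s, hsc, hs1, hs2⟩ := hspec
  refine ⟨s, hcard s hs1 hs2, hs1, ?_⟩
  intro v hv
  by_contra hcon
  push Not at hcon
  have hvs : v ∉ s := by
    intro hmem
    have := hcon v hmem
    simp at this; linarith
  have h1 : ∀ w ∈ insert v s, ‖w‖ = 1 := by
    intro w hw
    rcases Finset.mem_insert.1 hw with rfl | hw
    · exact hv
    · exact hs1 w hw
  have h2 : ∀ a ∈ insert v s, ∀ w ∈ insert v s, a ≠ w → ε ≤ ‖a - w‖ := by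
    intro a ha w hw haw
    rcases Finset.mem_insert.1 ha with ha' | ha' <;> rcases Finset.mem_insert.1 hw with hw' | hw'
    · exact absurd (ha'.trans hw'.symm) haw
    · rw [ha']; exact (hcon w hw').le
    · rw [hw', norm_sub_rev]; exact (hcon a ha').le
    · exact hs2 a ha' w hw' haw
  have h3 : (insert v s).card = s.card + 1 := Finset.card_insert_of_notMem hvs
  have h4 : (insert v s).card ≤ K := by
    exact_mod_cast (hcard _ h1 h2).trans hK
  have h5 := Nat.le_findGreatest (P := p) h4 ⟨insert v s, rfl, h1, h2⟩
  omega

lemma aux_extend {E : Type*} [NormedAddCommGroup E] [NormedSpace ℝ E] [FiniteDimensional ℝ E]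
    (f : E → ℝ) (hadd : ∀ v w, f (v + w) ≤ f v + f w) (hsm : ∀ (r : ℝ) v, 0 ≤ r → f (r • v) = r * f v)
    (hc : Continuous f) (ε K : ℝ) (hε : 0 < ε) (hε1 : ε < 1) (hK : 0 ≤ K) (N : Finset E)
    (hN1 : ∀ v ∈ N, ‖v‖ = 1) (hN : ∀ v : E, ‖v‖ = 1 → ∃ w ∈ N, ‖v - w‖ ≤ ε)
    (hf : ∀ v ∈ N, (1 - ε) * K ≤ f v ∧ f v ≤ (1 + ε) * K) (v : E) :
    (1 - 3 * ε) / (1 - ε) * K * ‖v‖ ≤ f v ∧ f v ≤ (1 + ε) / (1 - ε) * K * ‖v‖ := by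
  have hf0 : f 0 = 0 := by simpa using hsm 0 0 le_rfl
  have hnorm : ∀ v : E, v ≠ 0 → f v = ‖v‖ * f (‖v‖⁻¹ • v) := by
    intro v hv
    have : ‖v‖ ≠ 0 := norm_ne_zero_iff.2 hv
    rw [hsm _ _ (by positivity)]; field_simp
  have hunit : ∀ v : E, v ≠ 0 → ‖‖v‖⁻¹ • v‖ = 1 := by
    intro v hv
    have : ‖v‖ ≠ 0 := norm_ne_zero_iff.2 hv
    rw [norm_smul, norm_inv, norm_norm]; field_simp
  by_cases hv : v = 0
  · simp [hv, hf0]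
  have h1e : 0 < 1 - ε := by linarith
  have hup : ∀ w : E, ‖w‖ = 1 → f w ≤ (1 + ε) / (1 - ε) * K := by
    have hcomp : IsCompact (Metric.sphere (0:E) 1) := isCompact_sphere _ _
    obtain ⟨x, hx, hmax⟩ := hcomp.exists_isMaxOn ⟨_, mem_sphere_zero_iff_norm.2 (hunit v hv)⟩ hc.continuousOn
    have hmax' : ∀ w : E, ‖w‖ = 1 → f w ≤ f x := fun w hw => hmax (mem_sphere_zero_iff_norm.2 hw)
    have hx1 : ‖x‖ = 1 := mem_sphere_zero_iff_norm.1 hx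
    obtain ⟨y, hy, hxy⟩ := hN x hx1
    have hM0 : 0 ≤ f x := (mul_nonneg h1e.le hK).trans ((hf y hy).1.trans (hmax' y (hN1 y hy)))
    have h2 : f (x - y) ≤ ε * f x := by
      by_cases h0 : x - y = 0
      · rw [h0, hf0]; positivity
      · rw [hnorm _ h0]
        calc _ ≤ ‖x - y‖ * f x := mul_le_mul_of_nonneg_left (hmax' _ (hunit _ h0)) (norm_nonneg _)
          _ ≤ _ := mul_le_mul_of_nonneg_right hxy hM0
    have h3 := hadd y (x - y)
    rw [add_sub_cancel] at h3
    have h4 := (hf y hy).2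
    intro w hw
    refine (hmax' w hw).trans ?_
    rw [div_mul_eq_mul_div, le_div_iff₀ h1e]
    linarith
  have hlo : ∀ w : E, ‖w‖ = 1 → (1 - 3 * ε) / (1 - ε) * K ≤ f w := by
    intro w hw
    obtain ⟨y, hy, hwy⟩ := hN w hw
    have h2 : f (y - w) ≤ ε * ((1 + ε) / (1 - ε) * K) := by
      by_cases h0 : y - w = 0
      · rw [h0, hf0]; positivity
      · rw [hnorm _ h0]
        rw [norm_sub_rev] at hwy
        calc _ ≤ ‖y - w‖ * ((1 + ε) / (1 - ε) * K) :=
              mul_le_mul_of_nonneg_left (hup _ (hunit _ h0)) (norm_nonneg _)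
          _ ≤ _ := mul_le_mul_of_nonneg_right hwy (by positivity)
    have h3 := hadd w (y - w)
    rw [add_sub_cancel] at h3
    have h4 := (hf y hy).1
    have e : (1 - 3 * ε) / (1 - ε) * K = (1 - ε) * K - ε * ((1 + ε) / (1 - ε) * K) := by
      field_simp; ring
    linarith
  rw [hnorm v hv]
  constructor
  · rw [mul_comm ‖v‖]; exact mul_le_mul_of_nonneg_right (hlo _ (hunit v hv)) (norm_nonneg _)
  · rw [mul_comm ‖v‖]; exact mul_le_mul_of_nonneg_right (hup _ (hunit v hv)) (norm_nonneg _)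

lemma aux_count (n : ℕ) (β : ℝ) (h1 : 1 / 2 ≤ β) (h2 : β < 1) :
    ((Finset.univ.filter fun S : Finset (Fin n) => β * n ≤ S.card).card : ℝ) ≤
      Real.exp (n * (-β * Real.log β - (1 - β) * Real.log (1 - β))) := by
  have hb : 0 < β := by linarith
  have hb' : 0 < 1 - β := by linarith
  have hsum : ∑ S : Finset (Fin n), β ^ S.card * (1 - β) ^ (n - S.card) = 1 := by
    have := Fintype.sum_pow_mul_eq_add_pow (Fin n) β (1 - β)
    simpa using this
  have hterm : ∀ S ∈ Finset.univ.filter fun S : Finset (Fin n) => β * n ≤ S.card,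
      Real.exp (-(n * (-β * Real.log β - (1 - β) * Real.log (1 - β)))) ≤
        β ^ S.card * (1 - β) ^ (n - S.card) := by
    intro S hS
    have hS' : β * n ≤ S.card := (Finset.mem_filter.1 hS).2
    have hSn : S.card ≤ n := by simpa using Finset.card_le_univ S
    rw [← Real.exp_log (pow_pos hb S.card), ← Real.exp_log (pow_pos hb' (n - S.card)), ← Real.exp_add,
      Real.log_pow, Real.log_pow, Nat.cast_sub hSn]
    apply Real.exp_le_exp.2
    have hl : Real.log (1 - β) ≤ Real.log β := Real.log_le_log hb' (by linarith)
    nlinarith [mul_nonneg (sub_nonneg.2 hS') (sub_nonneg.2 hl)]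
  have h3 := Finset.card_nsmul_le_sum _ _ _ hterm
  have h4 : ∑ S ∈ Finset.univ.filter (fun S : Finset (Fin n) => β * n ≤ S.card),
      β ^ S.card * (1 - β) ^ (n - S.card) ≤ 1 := by
    refine le_trans ?_ hsum.le
    exact Finset.sum_le_sum_of_subset_of_nonneg (Finset.filter_subset _ _)
      fun S _ _ => mul_nonneg (pow_nonneg hb.le _) (pow_nonneg hb'.le _)
  rw [nsmul_eq_mul, Real.exp_neg] at h3
  have h5 := h3.trans h4
  rwa [← div_eq_mul_inv, div_le_one (Real.exp_pos _)] at h5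

lemma aux_tailS {n : ℕ} (S : Finset (Fin n)) (hS : S.Nonempty) (α : ℝ) (hα : 0 ≤ α) :
    (Measure.pi fun _ : Fin n => gaussianReal 0 1).real {x | α * n ≤ ∑ i ∈ S, x i} ≤
      Real.exp (-α ^ 2 * n / 2) := by
  set P := Measure.pi fun _ : Fin n => gaussianReal 0 1 with hP
  have hind : iIndepFun (fun (i : Fin n) (x : Fin n → ℝ) => x i) P :=
    iIndepFun_pi (X := fun _ (x : ℝ) => x) (fun _ => by fun_prop)
  have hg : HasSubgaussianMGF (fun x : ℝ => x) 1 (gaussianReal 0 1) := by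
    refine ⟨fun t => integrable_exp_mul_gaussianReal t, fun t => ?_⟩
    rw [mgf_fun_id_gaussianReal]; simp
  have hs : ∀ i ∈ S, HasSubgaussianMGF (fun (x : Fin n → ℝ) => x i) 1 P := by
    intro i _
    refine HasSubgaussianMGF.of_map (X := fun x : ℝ => x) (Y := fun x : Fin n → ℝ => x i)
      (measurable_pi_apply i).aemeasurable ?_
    have : P.map (fun x : Fin n → ℝ => x i) = gaussianReal 0 1 :=
      (measurePreserving_eval (fun _ : Fin n => gaussianReal 0 1) i).map_eq
    rw [this]
    exact hg
  refine ((HasSubgaussianMGF.sum_of_iIndepFun hind hs).measure_ge_le (ε := α * n) (by positivity)).trans ?_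
  apply Real.exp_le_exp.2
  have h1 : (0:ℝ) < S.card := by exact_mod_cast hS.card_pos
  have h2 : (S.card : ℝ) ≤ n := by
    have : S.card ≤ n := by simpa using Finset.card_le_univ S
    exact_mod_cast this
  simp only [Finset.sum_const, nsmul_eq_mul, mul_one, NNReal.coe_natCast]
  rw [neg_div, neg_mul, neg_div, neg_le_neg_iff, div_le_div_iff₀ (by norm_num) (by positivity)]
  have : α^2 * n * S.card ≤ α^2 * n * n := by gcongr
  nlinarith

lemma aux_det {m n : ℕ} (hn : 1 ≤ n) (A : Matrix (Fin m) (Fin n) ℝ) (b : Fin m → ℝ) (c : Fin n → ℝ)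
    (δ ε α β : ℝ)
    (hδ : δ = Real.sqrt (2 * Real.pi) / n * Real.sqrt (∑ j, min (b j) 0 ^ 2))
    (hδ2 : δ < 1 / 2) (hε : ε ∈ Set.Ioo (0 : ℝ) (1 / 5))
    (hα : α = 1 / Real.sqrt (2 * Real.pi) *
      Real.sqrt (((1 - 3 * ε) / (1 - ε)) ^ 2 - δ ^ 2))
    (hb : ∀ (a : ℝ) (u : Fin m → ℝ),
      (1 - 3 * ε) / (1 - ε) * (n / Real.sqrt (2 * Real.pi)) * Real.sqrt (a ^ 2 + ∑ j, u j ^ 2) ≤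
        ∑ i, max (a * c i - ∑ j, A j i * u j) 0 ∧
      ∑ i, max (a * c i - ∑ j, A j i * u j) 0 ≤
        (1 + ε) / (1 - ε) * (n / Real.sqrt (2 * Real.pi)) * Real.sqrt (a ^ 2 + ∑ j, u j ^ 2))
    (hS : ∀ S : Finset (Fin n), β * n ≤ S.card → ∑ i ∈ S, c i < α * n) :
    (α * n ≤ valLP A b c) ∧
        (∀ u : Fin m → ℝ, (∀ j, 0 ≤ u j) →
          (∀ u' : Fin m → ℝ, (∀ j, 0 ≤ u' j) → dualObj A b c u ≤ dualObj A b c u') →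
          Real.sqrt (∑ j, u j ^ 2) ≤ (1 + ε) / (1 - 3 * ε - (1 - ε) * δ)) ∧
        (∀ x : Fin n → ℝ, (∀ i, x i ∈ Set.Icc (0 : ℝ) 1) →
          (∀ j, A.mulVec x j ≤ b j) →
          (∑ i, c i * x i) = valLP A b c →
          {i : Fin n | 0 < x i ∧ x i < 1}.ncard ≤ m →
          (1 - β) * n - m ≤ ({i : Fin n | x i = 0}.ncard : ℝ)) := by
  obtain ⟨hε0, hε1⟩ := hε
  have hn' : (0:ℝ) < n := by exact_mod_cast hn
  have hs : 0 < Real.sqrt (2 * Real.pi) := by positivity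
  set K : ℝ := n / Real.sqrt (2 * Real.pi) with hK
  have hK0 : 0 < K := by positivity
  set r : ℝ := (1 - 3 * ε) / (1 - ε) with hr
  have h1e : 0 < 1 - ε := by linarith
  have hr2 : 1 / 2 < r := by rw [hr, lt_div_iff₀ h1e]; linarith
  have hδ0 : 0 ≤ δ := by rw [hδ]; positivity
  have hbm : Real.sqrt (∑ j, min (b j) 0 ^ 2) = δ * K := by
    rw [hδ, hK]; field_simp
  have hbu : ∀ u : Fin m → ℝ, (∀ j, 0 ≤ u j) →
      -(δ * K * Real.sqrt (∑ j, u j ^ 2)) ≤ ∑ j, b j * u j := by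
    intro u hu
    have h1 : ∑ j, (-min (b j) 0) * u j ≤
        Real.sqrt (∑ j, (-min (b j) 0) ^ 2) * Real.sqrt (∑ j, u j ^ 2) :=
      Real.sum_mul_le_sqrt_mul_sqrt _ _ _
    simp only [neg_sq] at h1
    rw [hbm] at h1
    have h2 : ∑ j, (-min (b j) 0) * u j ≥ - ∑ j, b j * u j := by
      rw [← Finset.sum_neg_distrib]
      refine Finset.sum_le_sum fun j _ => ?_
      nlinarith [min_le_left (b j) 0, hu j]
    linarith
  have hαn : α * n = Real.sqrt (r ^ 2 - δ ^ 2) * K := by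
    rw [hα, hK]; ring
  have hrd : 0 ≤ r ^ 2 - δ ^ 2 := by nlinarith
  have hval : α * n ≤ valLP A b c := by
    apply aux_dual
    intro a u ha hu
    have h1 := (hb a u).1
    have h2 := hbu u hu
    have hU : 0 ≤ ∑ j, u j ^ 2 := Finset.sum_nonneg fun j _ => sq_nonneg _
    set s := Real.sqrt (∑ j, u j ^ 2) with hsdef
    have hs2 : ∑ j, u j ^ 2 = s ^ 2 := (Real.sq_sqrt hU).symm
    rw [hs2] at h1
    set q := Real.sqrt (r ^ 2 - δ ^ 2) with hq
    have hq2 : q ^ 2 = r ^ 2 - δ ^ 2 := Real.sq_sqrt hrd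
    have h3 : a * q + δ * s ≤ r * Real.sqrt (a ^ 2 + s ^ 2) := by
      have : r * Real.sqrt (a ^ 2 + s ^ 2) = Real.sqrt (r ^ 2 * (a ^ 2 + s ^ 2)) := by
        rw [Real.sqrt_mul (sq_nonneg r), Real.sqrt_sq (by linarith)]
      rw [this]
      apply Real.le_sqrt_of_sq_le
      have : r ^ 2 = q ^ 2 + δ ^ 2 := by linarith
      rw [this]
      nlinarith [sq_nonneg (a * δ - q * s)]
    rw [hαn]
    have h4 := mul_le_mul_of_nonneg_right h3 hK0.le
    linarith
  refine ⟨hval, ?_, ?_⟩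
  · intro u hu hmin
    have h0 := hmin 0 (fun j => le_rfl)
    have e0 : dualObj A b c 0 ≤ (1 + ε) / (1 - ε) * K := by
      have := (hb 1 0).2
      simpa [dualObj] using this
    have e1 := (hb 1 u).1
    have h2 := hbu u hu
    simp only [one_mul] at e1
    set s := Real.sqrt (∑ j, u j ^ 2) with hsdef
    have hs1 : s ≤ Real.sqrt (1 ^ 2 + ∑ j, u j ^ 2) := Real.sqrt_le_sqrt (by linarith)
    have e2 : r * K * s ≤ r * K * Real.sqrt (1 ^ 2 + ∑ j, u j ^ 2) :=
      mul_le_mul_of_nonneg_left hs1 (by positivity)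
    have e3 : r * K * s - δ * K * s ≤ dualObj A b c u := by
      rw [dualObj]; linarith
    have e4 : K * ((r - δ) * s) ≤ K * ((1 + ε) / (1 - ε)) := by linarith
    have e5 := le_of_mul_le_mul_left e4 hK0
    have hrr : r * (1 - ε) = 1 - 3 * ε := by rw [hr]; field_simp
    have hpos : 0 < 1 - 3 * ε - (1 - ε) * δ := by nlinarith
    rw [le_div_iff₀ hpos]
    rw [le_div_iff₀ h1e] at e5
    have : s * (1 - 3 * ε - (1 - ε) * δ) = (r - δ) * s * (1 - ε) := by
      rw [← hrr]; ring
    linarith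
  · intro x hx hAx hopt hfrac
    by_contra hcon
    push Not at hcon
    classical
    let Z := Finset.univ.filter fun i : Fin n => x i = 0
    let F := Finset.univ.filter fun i : Fin n => 0 < x i ∧ x i < 1
    let O := Finset.univ.filter fun i : Fin n => x i = 1
    have eZ : {i : Fin n | x i = 0}.ncard = Z.card := by
      rw [← Set.ncard_coe_finset]; congr 1; ext i; simp [Z]
    have eF : {i : Fin n | 0 < x i ∧ x i < 1}.ncard = F.card := by
      rw [← Set.ncard_coe_finset]; congr 1; ext i; simp [F]
    rw [eZ] at hcon
    rw [eF] at hfrac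
    have hcov : n ≤ Z.card + F.card + O.card := by
      have : (Finset.univ : Finset (Fin n)) ⊆ Z ∪ F ∪ O := by
        intro i _
        simp only [Z, F, O, Finset.mem_union, Finset.mem_filter, Finset.mem_univ, true_and]
        rcases (hx i).1.eq_or_lt with h | h
        · exact Or.inl (Or.inl h.symm)
        · rcases (hx i).2.eq_or_lt with h' | h'
          · exact Or.inr h'
          · exact Or.inl (Or.inr ⟨h, h'⟩)
      have h1 := Finset.card_le_card this
      have h2 := Finset.card_union_le (Z ∪ F) O
      have h3 := Finset.card_union_le Z F
      simp only [Finset.card_univ, Fintype.card_fin] at h1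
      omega
    let S := Finset.univ.filter fun i : Fin n => x i = 1 ∨ (0 < x i ∧ 0 < c i)
    have hOS : O ⊆ S := by
      intro i hi
      simp only [O, S, Finset.mem_filter, Finset.mem_univ, true_and] at hi ⊢
      exact Or.inl hi
    have hc2 := Finset.card_le_card hOS
    have hSn : β * n ≤ S.card := by
      have h1 : (n:ℝ) ≤ Z.card + F.card + O.card := by exact_mod_cast hcov
      have h2 : (F.card : ℝ) ≤ m := by exact_mod_cast hfrac
      have h3 : (O.card : ℝ) ≤ S.card := by exact_mod_cast hc2
      linarith
    have h1 := hS S hSn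
    have h2 : ∑ i, c i * x i ≤ ∑ i ∈ S, c i := by
      rw [Finset.sum_filter]
      refine Finset.sum_le_sum fun i _ => ?_
      obtain ⟨hx0, hx1⟩ := hx i
      split_ifs with h
      · rcases h with h | h
        · rw [h, mul_one]
        · nlinarith [h.2]
      · push Not at h
        rcases hx0.eq_or_lt with h' | h'
        · rw [← h', mul_zero]
        · nlinarith [h.2 h']
    linarith

lemma aux_F {m n : ℕ} (A : Matrix (Fin m) (Fin n) ℝ) (c : Fin n → ℝ) (ε K : ℝ)
    (hε : 0 < ε) (hε1 : ε < 1) (hK : 0 ≤ K) (N : Finset (EuclideanSpace ℝ (Fin (m + 1))))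
    (hN1 : ∀ v ∈ N, ‖v‖ = 1) (hN : ∀ v, ‖v‖ = 1 → ∃ w ∈ N, ‖v - w‖ ≤ ε)
    (hf : ∀ v ∈ N, (1 - ε) * K ≤ ∑ i, max (v 0 * c i - ∑ j, A j i * v (Fin.succ j)) 0 ∧
      ∑ i, max (v 0 * c i - ∑ j, A j i * v (Fin.succ j)) 0 ≤ (1 + ε) * K) (a : ℝ) (u : Fin m → ℝ) :
    (1 - 3 * ε) / (1 - ε) * K * Real.sqrt (a ^ 2 + ∑ j, u j ^ 2) ≤
        ∑ i, max (a * c i - ∑ j, A j i * u j) 0 ∧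
      ∑ i, max (a * c i - ∑ j, A j i * u j) 0 ≤
        (1 + ε) / (1 - ε) * K * Real.sqrt (a ^ 2 + ∑ j, u j ^ 2) := by
  have key := aux_extend (E := EuclideanSpace ℝ (Fin (m + 1)))
    (fun v => ∑ i, max (v 0 * c i - ∑ j, A j i * v (Fin.succ j)) 0) ?_ ?_ (by fun_prop)
    ε K hε hε1 hK N hN1 hN hf (WithLp.toLp 2 (Fin.cons a u))
  · simpa [EuclideanSpace.norm_eq, Fin.sum_univ_succ] using key
  · intro v w
    rw [← Finset.sum_add_distrib]
    refine Finset.sum_le_sum fun i _ => ?_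
    have : (v + w) 0 * c i - ∑ j, A j i * (v + w) (Fin.succ j) =
        (v 0 * c i - ∑ j, A j i * v (Fin.succ j)) + (w 0 * c i - ∑ j, A j i * w (Fin.succ j)) := by
      simp only [PiLp.add_apply, mul_add, Finset.sum_add_distrib]; ring
    rw [this]
    refine max_le ?_ ?_
    · exact add_le_add (le_max_left _ _) (le_max_left _ _)
    · exact add_nonneg (le_max_right _ _) (le_max_right _ _)
  · intro s v hs
    simp only
    rw [Finset.mul_sum]
    refine Finset.sum_congr rfl fun i _ => ?_
    have : (s • v) 0 * c i - ∑ j, A j i * (s • v) (Fin.succ j) =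
        s * (v 0 * c i - ∑ j, A j i * v (Fin.succ j)) := by
      simp only [PiLp.smul_apply, smul_eq_mul, mul_sub, Finset.mul_sum]
      congr 1
      · ring
      · refine Finset.sum_congr rfl fun j _ => ?_
        ring
    rw [this, mul_max_of_nonneg _ _ hs, mul_zero]

/-- properties of the optimal primal and dual solutions for a Gaussian LP:
with probability at least `1 − 2(1 + 2/ε)^{m+1} e^{−ε²n/(8π)} − e^{−α²n/4}`,
(1) the LP value is at least `αn`; (2) every nonnegative minimizer `u` of the dual objective
satisfies `‖u‖₂ ≤ (1+ε)/(1 − 3ε − (1−ε)δ)`; and (3) every optimal LP solution with at most `m`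
fractional coordinates has at least `(1−β)n − m` zero coordinates. -/
theorem stmt_11 (m n : ℕ) (hm : 1 ≤ m) (hn : 1 ≤ n) (b : Fin m → ℝ) (δ ε α β : ℝ)
    (hδ : δ = Real.sqrt (2 * Real.pi) / n * Real.sqrt (∑ j, min (b j) 0 ^ 2))
    (hδ2 : δ < 1 / 2) (hε : ε ∈ Set.Ioo (0 : ℝ) (1 / 5))
    (hα : α = 1 / Real.sqrt (2 * Real.pi) *
      Real.sqrt (((1 - 3 * ε) / (1 - ε)) ^ 2 - δ ^ 2))
    (hβ : β ∈ Set.Icc (1 / 2 : ℝ) 1)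
    (hH : -β * Real.log β - (1 - β) * Real.log (1 - β) = α ^ 2 / 4) :
    ((Measure.pi fun _ : Fin m × Fin n => gaussianReal 0 1).prod
        (Measure.pi fun _ : Fin n => gaussianReal 0 1))
      {ω | (α * n ≤ valLP (Matrix.of fun i j => ω.1 (i, j)) b ω.2) ∧
        (∀ u : Fin m → ℝ, (∀ j, 0 ≤ u j) →
          (∀ u' : Fin m → ℝ, (∀ j, 0 ≤ u' j) →
            dualObj (Matrix.of fun i j => ω.1 (i, j)) b ω.2 u ≤
              dualObj (Matrix.of fun i j => ω.1 (i, j)) b ω.2 u') →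
          Real.sqrt (∑ j, u j ^ 2) ≤ (1 + ε) / (1 - 3 * ε - (1 - ε) * δ)) ∧
        (∀ x : Fin n → ℝ, (∀ i, x i ∈ Set.Icc (0 : ℝ) 1) →
          (∀ j, (Matrix.of fun i j => ω.1 (i, j)).mulVec x j ≤ b j) →
          (∑ i, ω.2 i * x i) = valLP (Matrix.of fun i j => ω.1 (i, j)) b ω.2 →
          {i : Fin n | 0 < x i ∧ x i < 1}.ncard ≤ m →
          (1 - β) * n - m ≤ ({i : Fin n | x i = 0}.ncard : ℝ))}
      ≥ ENNReal.ofReal (1 - 2 * (1 + 2 / ε) ^ (m + 1) * Real.exp (-ε ^ 2 * n / (8 * Real.pi))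
          - Real.exp (-α ^ 2 * n / 4)) := by
  classical
  obtain ⟨hε0, hε1⟩ := hε
  have hn' : (0:ℝ) < n := by exact_mod_cast hn
  have h1e : 0 < 1 - ε := by linarith
  have hr2 : 1 / 2 < (1 - 3 * ε) / (1 - ε) := by rw [lt_div_iff₀ h1e]; linarith
  have hδ0 : 0 ≤ δ := by rw [hδ]; positivity
  have hα0 : 0 < α := by
    rw [hα]
    have : 0 < ((1 - 3 * ε) / (1 - ε)) ^ 2 - δ ^ 2 := by nlinarith
    positivity
  have hβ1 : β < 1 := by
    rcases hβ.2.lt_or_eq with h | h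
    · exact h
    · exfalso
      rw [h] at hH
      simp at hH
      have : 0 < α ^ 2 := by positivity
      linarith
  have hβ0 : 0 < β := by linarith [hβ.1]
  obtain ⟨N, hNc, hN1, hN⟩ := aux_net (E := EuclideanSpace ℝ (Fin (m + 1))) ε hε0
  rw [finrank_euclideanSpace_fin] at hNc
  set K : ℝ := n / Real.sqrt (2 * Real.pi) with hK
  have hK0 : 0 ≤ K := by positivity
  set P := (Measure.pi fun _ : Fin m × Fin n => gaussianReal 0 1).prod
        (Measure.pi fun _ : Fin n => gaussianReal 0 1) with hP
  let B1 : EuclideanSpace ℝ (Fin (m + 1)) → Set ((Fin m × Fin n → ℝ) × (Fin n → ℝ)) := fun v =>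
    {ω | ¬ ((1 - ε) * K ≤ ∑ i, max (v 0 * ω.2 i - ∑ j, ω.1 (j, i) * v (Fin.succ j)) 0 ∧
      ∑ i, max (v 0 * ω.2 i - ∑ j, ω.1 (j, i) * v (Fin.succ j)) 0 ≤ (1 + ε) * K)}
  let B2 : Finset (Fin n) → Set ((Fin m × Fin n → ℝ) × (Fin n → ℝ)) := fun S =>
    {ω | α * n ≤ ∑ i ∈ S, ω.2 i}
  let FS := Finset.univ.filter fun S : Finset (Fin n) => β * n ≤ S.card
  let Bad : Set ((Fin m × Fin n → ℝ) × (Fin n → ℝ)) := (⋃ v ∈ N, B1 v) ∪ ⋃ S ∈ FS, B2 S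
  have hB1 : ∀ v ∈ N, P.real (B1 v) ≤ 2 * Real.exp (-ε ^ 2 * n / (8 * Real.pi)) := by
    intro v hv
    refine aux_tail2 hn ε hε0 (v 0) (fun j => v (Fin.succ j)) ?_
    have h := hN1 v hv
    rw [EuclideanSpace.norm_eq, Real.sqrt_eq_one, Fin.sum_univ_succ] at h
    simpa using h
  have hB2 : ∀ S ∈ FS, P.real (B2 S) ≤ Real.exp (-α ^ 2 * n / 2) := by
    intro S hS
    have hS' : β * n ≤ S.card := (Finset.mem_filter.1 hS).2
    have hne : S.Nonempty := by
      rw [← Finset.card_pos]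
      have : (0:ℝ) < S.card := lt_of_lt_of_le (by positivity) hS'
      exact_mod_cast this
    refine le_trans (le_of_eq ?_) (aux_tailS S hne α hα0.le)
    have hset : MeasurableSet {x : Fin n → ℝ | α * n ≤ ∑ i ∈ S, x i} :=
      measurableSet_le measurable_const (by fun_prop)
    have h := (measurePreserving_snd (μ := Measure.pi fun _ : Fin m × Fin n => gaussianReal 0 1)
      (ν := Measure.pi fun _ : Fin n => gaussianReal 0 1)).measure_preimage hset.nullMeasurableSet
    rw [measureReal_def, measureReal_def, ← h]
    rfl
  have hU1 : P.real (⋃ v ∈ N, B1 v) ≤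
      2 * (1 + 2 / ε) ^ (m + 1) * Real.exp (-ε ^ 2 * n / (8 * Real.pi)) := by
    refine (measureReal_biUnion_finset_le N B1).trans ((Finset.sum_le_card_nsmul N _ _ hB1).trans ?_)
    rw [nsmul_eq_mul]
    have := mul_le_mul_of_nonneg_right hNc
      (show 0 ≤ 2 * Real.exp (-ε ^ 2 * n / (8 * Real.pi)) by positivity)
    linarith
  have hU2 : P.real (⋃ S ∈ FS, B2 S) ≤ Real.exp (-α ^ 2 * n / 4) := by
    refine (measureReal_biUnion_finset_le FS B2).trans ((Finset.sum_le_card_nsmul FS _ _ hB2).trans ?_)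
    rw [nsmul_eq_mul]
    have := mul_le_mul_of_nonneg_right (aux_count n β hβ.1 hβ1) (Real.exp_pos (-α ^ 2 * n / 2)).le
    refine this.trans (le_of_eq ?_)
    rw [hH, ← Real.exp_add]
    congr 1
    ring
  have hBad : P.real Bad ≤ 2 * (1 + 2 / ε) ^ (m + 1) * Real.exp (-ε ^ 2 * n / (8 * Real.pi)) +
      Real.exp (-α ^ 2 * n / 4) := (measureReal_union_le _ _).trans (add_le_add hU1 hU2)
  have hgood : ∀ G : Set ((Fin m × Fin n → ℝ) × (Fin n → ℝ)), (∀ ω, ω ∉ Bad → ω ∈ G) →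
      P G ≥ ENNReal.ofReal (1 - 2 * (1 + 2 / ε) ^ (m + 1) * Real.exp (-ε ^ 2 * n / (8 * Real.pi))
          - Real.exp (-α ^ 2 * n / 4)) := by
    intro G hG
    have h1 : P.real Set.univ ≤ P.real (G ∪ Bad) := by
      refine measureReal_mono ?_
      intro ω _
      by_cases h : ω ∈ Bad
      · exact Or.inr h
      · exact Or.inl (hG ω h)
    have h2 := measureReal_union_le (μ := P) G Bad
    rw [probReal_univ] at h1
    have h3 : ENNReal.ofReal (P.real G) = P G := ofReal_measureReal
    rw [ge_iff_le, ← h3]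
    apply ENNReal.ofReal_le_ofReal
    linarith
  apply hgood
  intro ω hω
  simp only [Bad, Set.mem_union, Set.mem_iUnion, not_or, not_exists] at hω
  obtain ⟨hω1, hω2⟩ := hω
  refine aux_det hn (Matrix.of fun i j => ω.1 (i, j)) b ω.2 δ ε α β hδ hδ2 ⟨hε0, hε1⟩ hα ?_ ?_
  · intro a u
    refine aux_F (Matrix.of fun i j => ω.1 (i, j)) ω.2 ε K hε0 (by linarith) hK0 N hN1 hN ?_ a u
    intro v hv
    exact not_not.1 (hω1 v hv)
  · intro S hS
    exact not_le.1 (hω2 S (Finset.mem_filter.2 ⟨Finset.mem_univ _, hS⟩))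
end

section
/- Let ω ≥ 0 and ν > 0, let X, Y ∼ N(0,1) be independent, and set Z = ωY − X. Let μ be the law of (Y, Z) conditioned on Z ≥ 0, and let μ'' be the probability measure obtained from μ by rejection sampling with acceptance probability p(z) = φ(ν/√(1+ω²))·1_{z ∈ [0,ν]} / φ(z/√(1+ω²)) as a function of the Z-coordinate, where φ(x) = (1/√(2π))e^{−x²/2}; that is, μ'' is μ reweighted by the density p(z) and normalized. Then: (1) the overall acceptance probability ∫ p dμ equals 2ν·φ(ν/√(1+ω²))/√(1+ω²); and (2) under μ'', the first coordinate Y'' is distributed as W + V, where W ∼ N(0, 1/(1+ω²)) and V is uniform on [0, νω/(1+ω²)], with W and V independent. -/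
open MeasureTheory ProbabilityTheory

/-- The standard Gaussian density `φ(x) = e^{−x²/2}/√(2π)`. -/
noncomputable def gaussPdf (x : ℝ) : ℝ := Real.exp (-x ^ 2 / 2) / Real.sqrt (2 * Real.pi)

/-- The uniform probability measure on the interval `[a, b]` (the Dirac mass at `a` in the
degenerate case `a = b`). -/
noncomputable def uniformIcc (a b : ℝ) : Measure ℝ :=
  if a = b then Measure.dirac a
  else ProbabilityTheory.cond MeasureTheory.volume (Set.Icc a b)

/-- The law of `(Y, Z)` where `X, Y ∼ N(0,1)` are independent and `Z = ωY − X`. -/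
noncomputable def lawYZ (ω : ℝ) : Measure (ℝ × ℝ) :=
  Measure.map (fun p : ℝ × ℝ => (p.2, ω * p.2 - p.1))
    ((gaussianReal 0 1).prod (gaussianReal 0 1))

/-- The acceptance probability of the rejection sampling step, as a function of `z`:
`p(z) = φ(ν/√(1+ω²))·1_{z ∈ [0,ν]} / φ(z/√(1+ω²))`. -/
noncomputable def accProb (ω ν : ℝ) (z : ℝ) : ℝ :=
  gaussPdf (ν / Real.sqrt (1 + ω ^ 2)) * (if z ∈ Set.Icc 0 ν then 1 else 0) /
    gaussPdf (z / Real.sqrt (1 + ω ^ 2))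

lemma lintegral_gauss {v : NNReal} (hv : v ≠ 0) {f : ℝ → ENNReal} (hf : Measurable f) :
    ∫⁻ x, f x ∂(gaussianReal 0 v) = ∫⁻ x, gaussianPDF 0 v x * f x := by
  rw [gaussianReal_of_var_ne_zero 0 hv,
    lintegral_withDensity_eq_lintegral_mul _ (measurable_gaussianPDF 0 v) hf]
  rfl

lemma gauss_half {v : NNReal} (hv : v ≠ 0) : gaussianReal 0 v (Set.Ici 0) = 2⁻¹ := by
  have := nullSingletonClass_gaussianReal (μ := 0) hv
  have h1 : gaussianReal 0 v (Set.Iic 0) = gaussianReal 0 v (Set.Ici 0) := by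
    have h := gaussianReal_map_neg (μ := 0) (v := v)
    rw [neg_zero] at h
    conv_lhs => rw [← h]
    rw [Measure.map_apply measurable_neg measurableSet_Iic]
    congr 1
    ext x
    simp
  have h2 : gaussianReal 0 v (Set.Ici 0) + gaussianReal 0 v (Set.Iio 0) = 1 := by
    have := measure_add_measure_compl (μ := gaussianReal 0 v) (measurableSet_Ici (a := (0:ℝ)))
    rwa [Set.compl_Ici, measure_univ] at this
  rw [measure_congr (Iio_ae_eq_Iic (μ := gaussianReal 0 v) (a := (0:ℝ))), h1, ← two_mul] at h2
  rw [mul_comm] at h2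
  exact ENNReal.eq_inv_of_mul_eq_one_left h2

lemma pdf_id (ω y z : ℝ) :
    gaussianPDF 0 1 y * gaussianPDF 0 1 (ω * y - z) =
      gaussianPDF 0 (Real.toNNReal (1 + ω ^ 2)) z *
        gaussianPDF 0 (Real.toNNReal (1 / (1 + ω ^ 2))) (y - ω / (1 + ω ^ 2) * z) := by
  have hs : 0 < 1 + ω ^ 2 := by positivity
  unfold gaussianPDF
  rw [← ENNReal.ofReal_mul (gaussianPDFReal_nonneg _ _ _),
    ← ENNReal.ofReal_mul (gaussianPDFReal_nonneg _ _ _)]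
  congr 1
  unfold gaussianPDFReal
  rw [Real.coe_toNNReal _ hs.le, Real.coe_toNNReal _ (by positivity)]
  have e1 : ∀ a b c d : ℝ, a * Real.exp b * (c * Real.exp d) = a * c * Real.exp (b + d) := by
    intro a b c d
    rw [Real.exp_add]; ring
  rw [e1, e1, ← mul_inv, ← mul_inv, ← Real.sqrt_mul (by positivity),
    ← Real.sqrt_mul (by positivity)]
  congr 1
  · congr 2
    push_cast
    field_simp
  · congr 1
    push_cast
    field_simp
    ring

lemma lintegral_lawYZ (ω : ℝ) {f : ℝ × ℝ → ENNReal} (hf : Measurable f) :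
    ∫⁻ p, f p ∂(lawYZ ω) =
      ∫⁻ z, gaussianPDF 0 (Real.toNNReal (1 + ω ^ 2)) z *
        ∫⁻ w, f (w + ω / (1 + ω ^ 2) * z, z) ∂(gaussianReal 0 (Real.toNNReal (1 / (1 + ω ^ 2)))) := by
  have hs : 0 < 1 + ω ^ 2 := by positivity
  have hv : Real.toNNReal (1 / (1 + ω ^ 2)) ≠ 0 := by
    have : 0 < 1 / (1 + ω ^ 2) := by positivity
    simpa using this
  have hg := measurable_gaussianPDF 0 1
  unfold lawYZ
  rw [lintegral_map hf (by fun_prop), lintegral_prod_symm' _ (by fun_prop)]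
  dsimp only
  calc _ = ∫⁻ y, ∫⁻ z, gaussianPDF 0 1 y * gaussianPDF 0 1 (ω * y - z) * f (y, z) := by
        rw [lintegral_gauss one_ne_zero]
        · refine lintegral_congr fun y => ?_
          rw [lintegral_gauss one_ne_zero (by fun_prop),
            ← lintegral_sub_left_eq_self _ (ω * y), ← lintegral_const_mul _ (by fun_prop)]
          refine lintegral_congr fun z => ?_
          rw [sub_sub_cancel, mul_assoc]
        · exact Measurable.lintegral_prod_left' (f := fun p : ℝ × ℝ => f (p.2, ω * p.2 - p.1))
            (by fun_prop)
    _ = ∫⁻ z, ∫⁻ y, gaussianPDF 0 1 y * gaussianPDF 0 1 (ω * y - z) * f (y, z) := by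
        apply lintegral_lintegral_swap
        apply Measurable.aemeasurable
        unfold Function.uncurry
        fun_prop
    _ = _ := by
        refine lintegral_congr fun z => ?_
        have hg' := measurable_gaussianPDF 0 (Real.toNNReal (1 / (1 + ω ^ 2)))
        rw [lintegral_gauss hv (by fun_prop), ← lintegral_const_mul _ (by fun_prop),
          ← lintegral_add_right_eq_self _ (ω / (1 + ω ^ 2) * z)]
        refine lintegral_congr fun y => ?_
        rw [pdf_id, add_sub_cancel_right, mul_assoc]

lemma lawYZ_half (ω : ℝ) : lawYZ ω {p : ℝ × ℝ | 0 ≤ p.2} = 2⁻¹ := by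
  have hs : 0 < 1 + ω ^ 2 := by positivity
  have hv : Real.toNNReal (1 + ω ^ 2) ≠ 0 := by simpa using hs
  have hm : MeasurableSet {p : ℝ × ℝ | 0 ≤ p.2} := measurableSet_le measurable_const measurable_snd
  rw [← lintegral_indicator_one hm, lintegral_lawYZ ω (measurable_one.indicator hm),
    ← gauss_half hv, ← lintegral_indicator_one measurableSet_Ici,
    lintegral_gauss hv (measurable_one.indicator measurableSet_Ici)]
  refine lintegral_congr fun z => ?_
  congr 1
  have : ∀ w : ℝ, Set.indicator {p : ℝ × ℝ | 0 ≤ p.2} (1 : ℝ × ℝ → ENNReal)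
      (w + ω / (1 + ω ^ 2) * z, z) = Set.indicator (Set.Ici 0) (1 : ℝ → ENNReal) z := by
    intro w
    simp [Set.indicator_apply]
  simp_rw [this]
  simp

lemma measurable_accProb (ω ν : ℝ) : Measurable (accProb ω ν) := by
  unfold accProb
  have h : Measurable fun z : ℝ => if z ∈ Set.Icc 0 ν then (1:ℝ) else 0 :=
    Measurable.ite measurableSet_Icc measurable_const measurable_const
  have h2 : Measurable gaussPdf := by unfold gaussPdf; fun_prop
  fun_prop

lemma gaussPdf_pos (x : ℝ) : 0 < gaussPdf x := by
  unfold gaussPdf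
  positivity

lemma accProb_nonneg (ω ν z : ℝ) : 0 ≤ accProb ω ν z := by
  unfold accProb
  have := gaussPdf_pos (ν / Real.sqrt (1 + ω ^ 2))
  have := gaussPdf_pos (z / Real.sqrt (1 + ω ^ 2))
  split_ifs <;> positivity

lemma gaussianPDFReal_scale (ω z : ℝ) :
    gaussianPDFReal 0 (Real.toNNReal (1 + ω ^ 2)) z =
      gaussPdf (z / Real.sqrt (1 + ω ^ 2)) / Real.sqrt (1 + ω ^ 2) := by
  have hs : 0 < 1 + ω ^ 2 := by positivity
  unfold gaussianPDFReal gaussPdf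
  rw [Real.coe_toNNReal _ hs.le, div_pow, Real.sq_sqrt hs.le, Real.sqrt_mul (by positivity)]
  have : -(z - 0) ^ 2 / (2 * (1 + ω ^ 2)) = -(z ^ 2 / (1 + ω ^ 2)) / 2 := by
    field_simp
    ring
  rw [this]
  field_simp

lemma acc_pdf (ω ν z : ℝ) :
    gaussianPDF 0 (Real.toNNReal (1 + ω ^ 2)) z *
      ({z : ℝ | 0 ≤ z}.indicator (fun z => ENNReal.ofReal (accProb ω ν z)) z) =
    (Set.Icc 0 ν).indicator (fun _ => ENNReal.ofReal
      (gaussPdf (ν / Real.sqrt (1 + ω ^ 2)) / Real.sqrt (1 + ω ^ 2))) z := by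
  have hz := gaussPdf_pos (z / Real.sqrt (1 + ω ^ 2))
  by_cases h : z ∈ Set.Icc 0 ν
  · rw [Set.indicator_of_mem h, Set.indicator_of_mem (show z ∈ {z : ℝ | 0 ≤ z} from h.1),
      gaussianPDF, ← ENNReal.ofReal_mul (gaussianPDFReal_nonneg _ _ _), gaussianPDFReal_scale]
    congr 1
    unfold accProb
    rw [if_pos h]
    field_simp
  · rw [Set.indicator_of_notMem h]
    have : accProb ω ν z = 0 := by rw [accProb, if_neg h, mul_zero, zero_div]
    simp [Set.indicator_apply, this]

lemma key (ω ν : ℝ) {f : ℝ → ENNReal} (hf : Measurable f) :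
    ∫⁻ p, ENNReal.ofReal (accProb ω ν p.2) * f p.1
        ∂(ProbabilityTheory.cond (lawYZ ω) {p : ℝ × ℝ | 0 ≤ p.2}) =
      2 * (ENNReal.ofReal (gaussPdf (ν / Real.sqrt (1 + ω ^ 2)) / Real.sqrt (1 + ω ^ 2)) *
        ∫⁻ z in Set.Icc 0 ν, ∫⁻ w, f (w + ω / (1 + ω ^ 2) * z)
          ∂(gaussianReal 0 (Real.toNNReal (1 / (1 + ω ^ 2))))) := by
  have ha := measurable_accProb ω ν
  have hm : MeasurableSet {p : ℝ × ℝ | 0 ≤ p.2} := measurableSet_le measurable_const measurable_snd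
  have hF : Measurable fun z => ∫⁻ w, f (w + ω / (1 + ω ^ 2) * z)
          ∂(gaussianReal 0 (Real.toNNReal (1 / (1 + ω ^ 2)))) :=
    Measurable.lintegral_prod_left' (f := fun p : ℝ × ℝ => f (p.1 + ω / (1 + ω ^ 2) * p.2))
      (by fun_prop)
  rw [ProbabilityTheory.cond, lawYZ_half, inv_inv, lintegral_smul_measure, smul_eq_mul,
    ← lintegral_indicator hm, lintegral_lawYZ ω (Measurable.indicator (by fun_prop) hm),
    ← lintegral_const_mul _ hF, ← lintegral_indicator measurableSet_Icc]
  congr 1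
  refine lintegral_congr fun z => ?_
  have e : ∀ w : ℝ, Set.indicator {p : ℝ × ℝ | 0 ≤ p.2}
      (fun p => ENNReal.ofReal (accProb ω ν p.2) * f p.1) (w + ω / (1 + ω ^ 2) * z, z) =
      ({z : ℝ | 0 ≤ z}.indicator (fun z => ENNReal.ofReal (accProb ω ν z)) z) *
        f (w + ω / (1 + ω ^ 2) * z) := by
    intro w
    simp [Set.indicator_apply]
  simp_rw [e]
  rw [lintegral_const_mul _ (by fun_prop), ← mul_assoc, acc_pdf]
  simp only [Set.indicator_apply]
  split_ifs <;> simp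

lemma key_one (ω ν : ℝ) :
    ∫⁻ p, ENNReal.ofReal (accProb ω ν p.2)
        ∂(ProbabilityTheory.cond (lawYZ ω) {p : ℝ × ℝ | 0 ≤ p.2}) =
      2 * (ENNReal.ofReal (gaussPdf (ν / Real.sqrt (1 + ω ^ 2)) / Real.sqrt (1 + ω ^ 2)) *
        ENNReal.ofReal ν) := by
  have := key ω ν (f := fun _ => 1) measurable_const
  simpa using this

lemma uniform_scale (c ν : ℝ) (hc : 0 ≤ c) (hν : 0 < ν) :
    uniformIcc 0 (c * ν) =
      Measure.map (c * ·) (ProbabilityTheory.cond volume (Set.Icc 0 ν)) := by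
  have hvol : volume (Set.Icc 0 ν) ≠ 0 := by simpa using hν
  have hvol' : volume (Set.Icc 0 ν) ≠ ⊤ := by simp
  have : IsProbabilityMeasure (ProbabilityTheory.cond volume (Set.Icc 0 ν)) :=
    cond_isProbabilityMeasure_of_finite hvol hvol'
  unfold uniformIcc
  rcases hc.eq_or_lt with rfl | hc
  · simp [Measure.map_const]
  · rw [if_neg (by positivity)]
    have hp : (c * ·) ⁻¹' (Set.Icc 0 (c * ν)) = Set.Icc 0 ν := by
      ext x
      simp only [Set.mem_preimage, Set.mem_Icc, mul_nonneg_iff_of_pos_left hc,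
        mul_le_mul_iff_right₀ hc]
    unfold ProbabilityTheory.cond
    rw [Measure.map_smul, ← hp, ← Measure.restrict_map (by fun_prop) measurableSet_Icc, hp,
      Real.map_volume_mul_left hc.ne', Measure.restrict_smul, smul_smul]
    congr 1
    simp only [Real.volume_Icc, sub_zero]
    rw [abs_of_pos (by positivity), ← ENNReal.ofReal_inv_of_pos (by positivity),
      ← ENNReal.ofReal_inv_of_pos hν, ← ENNReal.ofReal_mul (by positivity)]
    congr 1
    field_simp

/-- for `ω ≥ 0`, `ν > 0`, with `μ` the law of `(Y, Z)` conditioned on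
`Z ≥ 0` and `μ''` the rejection-sampled measure (`μ` reweighted by `accProb` along the
`Z`-coordinate and normalized), (1) the overall acceptance probability equals
`2ν·φ(ν/√(1+ω²))/√(1+ω²)`; and (2) under `μ''` the first coordinate is distributed as
`W + V` for independent `W ∼ N(0, 1/(1+ω²))` and `V` uniform on `[0, νω/(1+ω²)]`. -/
theorem stmt_13 (ω ν : ℝ) (hω : 0 ≤ ω) (hν : 0 < ν) :
    (∫ p, accProb ω ν p.2
        ∂(ProbabilityTheory.cond (lawYZ ω) {p : ℝ × ℝ | 0 ≤ p.2})
      = 2 * ν * gaussPdf (ν / Real.sqrt (1 + ω ^ 2)) / Real.sqrt (1 + ω ^ 2)) ∧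
    Measure.map Prod.fst
        ((∫⁻ p, ENNReal.ofReal (accProb ω ν p.2)
            ∂(ProbabilityTheory.cond (lawYZ ω) {p : ℝ × ℝ | 0 ≤ p.2}))⁻¹ •
          (ProbabilityTheory.cond (lawYZ ω) {p : ℝ × ℝ | 0 ≤ p.2}).withDensity
            (fun p => ENNReal.ofReal (accProb ω ν p.2)))
      = Measure.map (fun q : ℝ × ℝ => q.1 + q.2)
          ((gaussianReal 0 (Real.toNNReal (1 / (1 + ω ^ 2)))).prod
            (uniformIcc 0 (ν * ω / (1 + ω ^ 2)))) := by
  have hs : 0 < 1 + ω ^ 2 := by positivity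
  have ha := measurable_accProb ω ν
  have hC : 0 < gaussPdf (ν / Real.sqrt (1 + ω ^ 2)) / Real.sqrt (1 + ω ^ 2) :=
    div_pos (gaussPdf_pos _) (Real.sqrt_pos.2 hs)
  constructor
  · rw [integral_eq_lintegral_of_nonneg_ae (Filter.Eventually.of_forall fun p => accProb_nonneg _ _ _)
      (Measurable.aestronglyMeasurable (by fun_prop)), key_one, ENNReal.toReal_mul,
      ENNReal.toReal_mul, ENNReal.toReal_ofReal hC.le, ENNReal.toReal_ofReal hν.le]
    simp only [ENNReal.toReal_ofNat]
    ring
  · have hvol : volume (Set.Icc 0 ν) ≠ 0 := by simpa using hν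
    have : IsProbabilityMeasure (ProbabilityTheory.cond volume (Set.Icc 0 ν)) :=
      cond_isProbabilityMeasure_of_finite hvol (by simp)
    refine Measure.ext_of_lintegral _ fun f hf => ?_
    rw [show ν * ω / (1 + ω ^ 2) = ω / (1 + ω ^ 2) * ν by ring,
      uniform_scale _ _ (by positivity) hν]
    have : IsProbabilityMeasure (Measure.map (ω / (1 + ω ^ 2) * ·)
        (ProbabilityTheory.cond volume (Set.Icc 0 ν))) :=
      Measure.isProbabilityMeasure_map (by fun_prop)
    have hF : Measurable fun v => ∫⁻ w, f (w + v)
          ∂(gaussianReal 0 (Real.toNNReal (1 / (1 + ω ^ 2)))) :=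
      Measurable.lintegral_prod_left' (f := fun p : ℝ × ℝ => f (p.1 + p.2)) (by fun_prop)
    rw [lintegral_map hf measurable_fst, lintegral_smul_measure,
      lintegral_withDensity_eq_lintegral_mul _ (by fun_prop) (by fun_prop)]
    simp only [Pi.mul_apply]
    rw [key ω ν hf, key_one, lintegral_map hf (by fun_prop), lintegral_prod_symm' _ (by fun_prop)]
    dsimp only
    rw [lintegral_map hF (by fun_prop), ProbabilityTheory.cond, lintegral_smul_measure,
      Real.volume_Icc, sub_zero, smul_eq_mul, smul_eq_mul, ← mul_assoc 2, ← mul_assoc 2,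
      ENNReal.mul_inv (Or.inr ENNReal.ofReal_ne_top) (Or.inr (by simpa using hν)), mul_comm (2 * _)⁻¹, mul_assoc, ← mul_assoc (2 * _)⁻¹,
      ENNReal.inv_mul_cancel, one_mul]
    · simpa using hC
    · exact ENNReal.mul_ne_top (by simp) (by simp)
end

section
/- Let d ∈ ℕ, n ≥ 100d, G ≥ 0, and let W = (W₁, …, W_n) ∈ ℝ^{d×n} be a random matrix whose columns W_i are independent logconcave random vectors in ℝ^d, each with identity covariance matrix. Then for every δ ∈ (0,1), with probability at least 1 − δ − e^{−n/5}: max over unit vectors u ∈ ℝ^d of |{x ∈ {0,1}^n : Σ_{i=1}^n x_i·|uᵀW_i| ≤ G}| is at most 60·(357·n⁶)^{d+1}·e^{2√(2nG)}/δ. -/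
open MeasureTheory ProbabilityTheory ENNReal

/-- A random vector in `ℝ^d` (with law `μ`) is logconcave if its law has a density `f ≥ 0`
w.r.t. Lebesgue measure such that `log f` is concave, i.e.
`f(x)^t · f(y)^{1−t} ≤ f(tx + (1−t)y)` for all `x, y` and `t ∈ [0,1]`. -/
def IsLogConcave {d : ℕ} (μ : Measure (Fin d → ℝ)) : Prop :=
  ∃ f : (Fin d → ℝ) → ℝ, (∀ x, 0 ≤ f x) ∧
    μ = MeasureTheory.volume.withDensity (fun x => ENNReal.ofReal (f x)) ∧
    ∀ x y : Fin d → ℝ, ∀ t : ℝ, 0 ≤ t → t ≤ 1 →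
      f x ^ t * f y ^ (1 - t) ≤ f (t • x + (1 - t) • y)

/-- A random vector in `ℝ^d` (with law `μ`) has identity covariance. -/
def HasIdCovariance {d : ℕ} (μ : Measure (Fin d → ℝ)) : Prop :=
  ∀ i j : Fin d,
    (∫ x, x i * x j ∂μ) - (∫ x, x i ∂μ) * (∫ x, x j ∂μ) = if i = j then 1 else 0

open scoped Pointwise in
lemma bm_compact (K L : Set ℝ) (hK : IsCompact K) (hL : IsCompact L) (hKn : K.Nonempty)
    (hLn : L.Nonempty) : volume K + volume L ≤ volume (K + L) := by
  obtain ⟨a, ha, hamax⟩ := hK.exists_isGreatest hKn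
  obtain ⟨b, hb, hbmin⟩ := hL.exists_isLeast hLn
  have h1 : (fun x => b + x) '' K ∪ (fun x => a + x) '' L ⊆ K + L := by
    rintro x (⟨y, hy, rfl⟩ | ⟨y, hy, rfl⟩)
    · exact ⟨y, hy, b, hb, add_comm _ _⟩
    · exact ⟨a, ha, y, hy, rfl⟩
  have hm : MeasurableSet ((fun x => a + x) '' L) :=
    (hL.image (by fun_prop)).measurableSet
  have hd : AEDisjoint volume ((fun x => b + x) '' K) ((fun x => a + x) '' L) := by
    have : ((fun x => b + x) '' K) ∩ ((fun x => a + x) '' L) ⊆ {a + b} := by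
      rintro x ⟨⟨y, hy, rfl⟩, ⟨z, hz, hzy⟩⟩
      have h1 := hamax hy
      have h2 := hbmin hz
      simp only [Set.mem_singleton_iff] at *
      linarith
    exact measure_mono_null this (by simp)
  calc volume K + volume L = volume ((fun x => b + x) '' K) + volume ((fun x => a + x) '' L) := by
        rw [Set.image_add_left, Set.image_add_left, measure_preimage_add, measure_preimage_add]
    _ = volume ((fun x => b + x) '' K ∪ (fun x => a + x) '' L) :=
        (measure_union₀ hm.nullMeasurableSet hd).symm
    _ ≤ _ := measure_mono h1

open scoped Pointwise in
lemma bm_meas (A B : Set ℝ) (hA : MeasurableSet A) (hB : MeasurableSet B) (hAn : A.Nonempty)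
    (hBn : B.Nonempty) : volume A + volume B ≤ volume (A + B) := by
  obtain ⟨a, ha⟩ := hAn
  obtain ⟨b, hb⟩ := hBn
  rcases eq_or_ne (volume A) 0 with h0 | h0
  · rw [h0, zero_add]
    calc volume B = volume ((fun x => a + x) '' B) := by
          rw [Set.image_add_left, measure_preimage_add]
      _ ≤ _ := measure_mono (by rintro x ⟨y, hy, rfl⟩; exact ⟨a, ha, y, hy, rfl⟩)
  rcases eq_or_ne (volume B) 0 with h0' | h0'
  · rw [h0', add_zero]
    calc volume A = volume ((fun x => b + x) '' A) := by
          rw [Set.image_add_left, measure_preimage_add]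
      _ ≤ _ := measure_mono (by rintro x ⟨y, hy, rfl⟩; exact ⟨y, hy, b, hb, add_comm _ _⟩)
  refine le_of_forall_lt fun c hc => ?_
  obtain ⟨x, hx, y, hy, hxy⟩ := ENNReal.exists_lt_add_of_lt_add hc h0 h0'
  obtain ⟨K, hKA, hK, hKx⟩ := hA.exists_lt_isCompact hx
  obtain ⟨L, hLB, hL, hLy⟩ := hB.exists_lt_isCompact hy
  calc c < x + y := hxy
    _ ≤ volume K + volume L := add_le_add hKx.le hLy.le
    _ ≤ volume (K + L) := bm_compact K L hK hL
        (nonempty_of_measure_ne_zero (ne_bot_of_gt hKx)) (nonempty_of_measure_ne_zero (ne_bot_of_gt hLy))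
    _ ≤ _ := measure_mono (Set.add_subset_add hKA hLB)

open scoped Pointwise in
lemma pl_core (t : ℝ) (ht0 : 0 < t) (ht1 : t < 1) (f g h : ℝ → ℝ) (hf : Measurable f)
    (hg : Measurable g) (hh : Measurable h) (f0 : ∀ x, 0 ≤ f x) (g0 : ∀ x, 0 ≤ g x)
    (h0 : ∀ x, 0 ≤ h x) (f1 : ∀ x, f x ≤ 1) (g1 : ∀ x, g x ≤ 1)
    (fs : ∀ r < 1, ∃ x, r < f x) (gs : ∀ r < 1, ∃ x, r < g x)
    (H : ∀ x y, f x ^ t * g y ^ (1 - t) ≤ h (t * x + (1 - t) * y)) :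
    ENNReal.ofReal t * (∫⁻ x, ENNReal.ofReal (f x)) + ENNReal.ofReal (1 - t) * (∫⁻ x, ENNReal.ofReal (g x))
      ≤ ∫⁻ x, ENNReal.ofReal (h x) := by
  have key : ∀ r ∈ Set.Ioi (0:ℝ), ENNReal.ofReal t * volume {x | r < f x} +
      ENNReal.ofReal (1 - t) * volume {x | r < g x} ≤ volume {x | r < h x} := by
    intro r hr
    simp only [Set.mem_Ioi] at hr
    rcases lt_or_ge r 1 with h1 | h1
    · have e1 : ENNReal.ofReal t * volume {x | r < f x} = volume (t • {x | r < f x}) := by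
        rw [Measure.addHaar_smul]; simp [abs_of_pos ht0]
      have e2 : ENNReal.ofReal (1 - t) * volume {x | r < g x} = volume ((1 - t) • {x | r < g x}) := by
        rw [Measure.addHaar_smul]; simp [abs_of_pos (sub_pos.2 ht1)]
      rw [e1, e2]
      refine (bm_meas _ _ ?_ ?_ ?_ ?_).trans (measure_mono ?_)
      · exact (measurableSet_lt measurable_const hf).const_smul₀ t
      · exact (measurableSet_lt measurable_const hg).const_smul₀ _
      · obtain ⟨x, hx⟩ := fs r h1
        exact ⟨t • x, Set.smul_mem_smul_set hx⟩
      · obtain ⟨x, hx⟩ := gs r h1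
        exact ⟨(1 - t) • x, Set.smul_mem_smul_set hx⟩
      · rintro _ ⟨_, ⟨x, hx, rfl⟩, _, ⟨y, hy, rfl⟩, rfl⟩
        simp only [Set.mem_ofPred_eq, smul_eq_mul] at *
        refine lt_of_lt_of_le ?_ (H x y)
        calc r = r ^ t * r ^ (1 - t) := by
              rw [← Real.rpow_add hr]; simp
          _ < f x ^ t * g y ^ (1 - t) := by
              apply mul_lt_mul'' (Real.rpow_lt_rpow hr.le hx ht0)
                (Real.rpow_lt_rpow hr.le hy (by linarith)) <;> positivity
    · have e1 : {x | r < f x} = ∅ := by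
        ext x; simp; exact (f1 x).trans h1
      have e2 : {x | r < g x} = ∅ := by
        ext x; simp; exact (g1 x).trans h1
      simp [e1, e2]
  have hmf : Measurable fun r : ℝ => volume {x | r < f x} :=
    Antitone.measurable fun a b hab => measure_mono fun x hx => lt_of_le_of_lt hab hx
  have hmg : Measurable fun r : ℝ => volume {x | r < g x} :=
    Antitone.measurable fun a b hab => measure_mono fun x hx => lt_of_le_of_lt hab hx
  rw [lintegral_eq_lintegral_meas_lt _ (ae_of_all _ f0) hf.aemeasurable,
    lintegral_eq_lintegral_meas_lt _ (ae_of_all _ g0) hg.aemeasurable,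
    lintegral_eq_lintegral_meas_lt _ (ae_of_all _ h0) hh.aemeasurable,
    ← lintegral_const_mul _ hmf, ← lintegral_const_mul _ hmg, ← lintegral_add_left (hmf.const_mul _)]
  exact setLIntegral_mono' measurableSet_Ioi key

lemma amgm_ennreal (t : ℝ) (ht0 : 0 < t) (ht1 : t < 1) (a b : ℝ≥0∞) :
    a ^ t * b ^ (1 - t) ≤ ENNReal.ofReal t * a + ENNReal.ofReal (1 - t) * b := by
  have h1 : 0 < 1 - t := sub_pos.2 ht1
  rcases eq_or_ne a ⊤ with rfl | ha
  · rw [ENNReal.mul_top (by simpa using ht0)]; simp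
  rcases eq_or_ne b ⊤ with rfl | hb
  · rw [ENNReal.mul_top (a := ENNReal.ofReal (1 - t)) (by simpa using ht1)]; simp
  lift a to NNReal using ha
  lift b to NNReal using hb
  have hs : t.toNNReal + (1 - t).toNNReal = 1 := by
    rw [← Real.toNNReal_add ht0.le h1.le]; simp
  have := NNReal.geom_mean_le_arith_mean2_weighted t.toNNReal (1 - t).toNNReal a b hs
  rw [Real.coe_toNNReal _ ht0.le, Real.coe_toNNReal _ h1.le] at this
  rw [← ENNReal.coe_rpow_of_nonneg _ ht0.le, ← ENNReal.coe_rpow_of_nonneg _ h1.le,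
    ENNReal.ofReal, ENNReal.ofReal]
  exact_mod_cast this

lemma pl_bdd (t : ℝ) (ht0 : 0 < t) (ht1 : t < 1) (f g h : ℝ → ℝ≥0∞) (hf : Measurable f)
    (hg : Measurable g) (hh : Measurable h) (hfb : ⨆ x, f x ≠ ⊤) (hgb : ⨆ x, g x ≠ ⊤)
    (H : ∀ x y, f x ^ t * g y ^ (1 - t) ≤ h (t * x + (1 - t) * y)) :
    (∫⁻ x, f x) ^ t * (∫⁻ x, g x) ^ (1 - t) ≤ ∫⁻ x, h x := by
  have h1 : 0 < 1 - t := sub_pos.2 ht1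
  set A := ⨆ x, f x with hA
  set B := ⨆ x, g x with hB
  have fA : ∀ x, f x ≤ A := le_iSup f
  have gB : ∀ x, g x ≤ B := le_iSup g
  rcases eq_or_ne A 0 with hA0 | hA0
  · have : ∀ x, f x = 0 := fun x => le_antisymm (hA0 ▸ fA x) bot_le
    simp [this, ht0]
  rcases eq_or_ne B 0 with hB0 | hB0
  · have : ∀ x, g x = 0 := fun x => le_antisymm (hB0 ▸ gB x) bot_le
    simp [this, ht1]
  set C := A ^ t * B ^ (1 - t) with hC
  have hAt : A ^ t ≠ ⊤ := ENNReal.rpow_ne_top_of_nonneg ht0.le hfb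
  have hBt : B ^ (1 - t) ≠ ⊤ := ENNReal.rpow_ne_top_of_nonneg h1.le hgb
  have hAt0 : A ^ t ≠ 0 := by simp [hA0, hfb, ht0.not_gt]
  have hBt0 : B ^ (1 - t) ≠ 0 := by simp [hB0, hgb]
  have hC0 : C ≠ 0 := mul_ne_zero hAt0 hBt0
  have hCt : C ≠ ⊤ := ENNReal.mul_ne_top hAt hBt
  have fA1 : ∀ x, f x / A ≤ 1 := fun x => ENNReal.div_le_of_le_mul (by simpa using fA x)
  have gB1 : ∀ x, g x / B ≤ 1 := fun x => ENNReal.div_le_of_le_mul (by simpa using gB x)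
  have hC1 : ∀ x, min (h x) C / C ≤ 1 := fun x => ENNReal.div_le_of_le_mul (by simp)
  have fT : ∀ x, f x / A ≠ ⊤ := fun x => ne_top_of_le_ne_top one_ne_top (fA1 x)
  have gT : ∀ x, g x / B ≠ ⊤ := fun x => ne_top_of_le_ne_top one_ne_top (gB1 x)
  have hT : ∀ x, min (h x) C / C ≠ ⊤ := fun x => ne_top_of_le_ne_top one_ne_top (hC1 x)
  have core := pl_core t ht0 ht1 (fun x => (f x / A).toReal) (fun x => (g x / B).toReal)
    (fun x => (min (h x) C / C).toReal) (hf.div_const A).ennreal_toReal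
    (hg.div_const B).ennreal_toReal ((hh.min measurable_const).div_const C).ennreal_toReal
    (fun x => toReal_nonneg) (fun x => toReal_nonneg) (fun x => toReal_nonneg)
    (fun x => by simpa using ENNReal.toReal_mono one_ne_top (fA1 x))
    (fun x => by simpa using ENNReal.toReal_mono one_ne_top (gB1 x)) ?_ ?_ ?_
  · simp only [ENNReal.ofReal_toReal (fT _), ENNReal.ofReal_toReal (gT _),
      ENNReal.ofReal_toReal (hT _)] at core
    simp only [div_eq_mul_inv] at core
    rw [lintegral_mul_const _ hf, lintegral_mul_const _ hg,
      lintegral_mul_const _ (hh.min measurable_const)] at core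
    have := (amgm_ennreal t ht0 ht1 _ _).trans core
    have h3 : ∫⁻ x, min (h x) C ≤ ∫⁻ x, h x := lintegral_mono fun x => min_le_left _ _
    calc (∫⁻ x, f x) ^ t * (∫⁻ x, g x) ^ (1 - t)
        = C * (((∫⁻ x, f x) * A⁻¹) ^ t * ((∫⁻ x, g x) * B⁻¹) ^ (1 - t)) := by
          rw [ENNReal.mul_rpow_of_nonneg _ _ ht0.le, ENNReal.mul_rpow_of_nonneg _ _ h1.le,
            ENNReal.inv_rpow, ENNReal.inv_rpow, hC]
          calc _ = (∫⁻ x, f x) ^ t * (∫⁻ x, g x) ^ (1 - t) * (A ^ t * (A ^ t)⁻¹) *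
              (B ^ (1 - t) * (B ^ (1 - t))⁻¹) := by
                rw [ENNReal.mul_inv_cancel hAt0 hAt, ENNReal.mul_inv_cancel hBt0 hBt]; simp
            _ = _ := by ring
      _ ≤ C * ((∫⁻ x, min (h x) C) * C⁻¹) := by gcongr
      _ = (∫⁻ x, min (h x) C) * (C * C⁻¹) := by ring
      _ = ∫⁻ x, min (h x) C := by rw [ENNReal.mul_inv_cancel hC0 hCt, mul_one]
      _ ≤ _ := h3
  · intro r hr
    rcases lt_or_ge r 0 with h | hr0
    · exact ⟨0, h.trans_le toReal_nonneg⟩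
    have : ENNReal.ofReal r * A < A := by
      calc ENNReal.ofReal r * A < 1 * A := by
            apply ENNReal.mul_lt_mul_left hA0 hfb; simpa using hr
        _ = A := one_mul _
    obtain ⟨x, hx⟩ := lt_iSup_iff.1 this
    refine ⟨x, ?_⟩
    rw [← ENNReal.ofReal_lt_iff_lt_toReal hr0 (fT x)]
    exact (ENNReal.lt_div_iff_mul_lt (Or.inl hA0) (Or.inl hfb)).2 hx
  · intro r hr
    rcases lt_or_ge r 0 with h | hr0
    · exact ⟨0, h.trans_le toReal_nonneg⟩
    have : ENNReal.ofReal r * B < B := by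
      calc ENNReal.ofReal r * B < 1 * B := by
            apply ENNReal.mul_lt_mul_left hB0 hgb; simpa using hr
        _ = B := one_mul _
    obtain ⟨x, hx⟩ := lt_iSup_iff.1 this
    refine ⟨x, ?_⟩
    rw [← ENNReal.ofReal_lt_iff_lt_toReal hr0 (gT x)]
    exact (ENNReal.lt_div_iff_mul_lt (Or.inl hB0) (Or.inl hgb)).2 hx
  · intro x y
    rw [ENNReal.toReal_rpow, ENNReal.toReal_rpow, ← ENNReal.toReal_mul]
    apply ENNReal.toReal_mono (hT _)
    rw [div_eq_mul_inv, div_eq_mul_inv, ENNReal.mul_rpow_of_nonneg _ _ ht0.le, ENNReal.mul_rpow_of_nonneg _ _ h1.le,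
            ENNReal.inv_rpow, ENNReal.inv_rpow]
    calc _ = (f x ^ t * g y ^ (1 - t)) * C⁻¹ := by
          rw [hC, ENNReal.mul_inv (Or.inl hAt0) (Or.inl hAt)]; ring
      _ ≤ min (h (t * x + (1 - t) * y)) C * C⁻¹ := by
          gcongr
          refine le_min (H x y) ?_
          rw [hC]
          gcongr
          · exact fA x
          · exact gB y

lemma pl_one (t : ℝ) (ht0 : 0 < t) (ht1 : t < 1) (f g h : ℝ → ℝ≥0∞) (hf : Measurable f)
    (hg : Measurable g) (hh : Measurable h)
    (H : ∀ x y, f x ^ t * g y ^ (1 - t) ≤ h (t * x + (1 - t) * y)) :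
    (∫⁻ x, f x) ^ t * (∫⁻ x, g x) ^ (1 - t) ≤ ∫⁻ x, h x := by
  have h1 : 0 < 1 - t := sub_pos.2 ht1
  have trunc : ∀ f : ℝ → ℝ≥0∞, Measurable f →
      Filter.Tendsto (fun N : ℕ => ∫⁻ x, min (f x) N) Filter.atTop (nhds (∫⁻ x, f x)) := by
    intro f hf
    apply lintegral_tendsto_of_tendsto_of_monotone
    · intro N; exact (hf.min measurable_const).aemeasurable
    · refine ae_of_all _ fun x a b hab => ?_
      dsimp only
      gcongr
    · refine ae_of_all _ fun x => ?_
      have : Filter.Tendsto (fun N : ℕ => min (f x) (N : ℝ≥0∞)) Filter.atTop (nhds (min (f x) ⊤)) :=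
        tendsto_const_nhds.min ENNReal.tendsto_nat_nhds_top
      simpa using this
  rcases eq_or_ne (∫⁻ x, f x) 0 with hf0 | hf0
  · simp [hf0, ht0]
  rcases eq_or_ne (∫⁻ x, g x) 0 with hg0 | hg0
  · simp [hg0, ht1]
  have hne1 : (∫⁻ x, f x) ^ t ≠ 0 := by simp [hf0, ht0.not_gt]
  have hne2 : (∫⁻ x, g x) ^ (1 - t) ≠ 0 := by simp [hg0, ht1.le]
  have lim := ENNReal.Tendsto.mul ((ENNReal.continuous_rpow_const (y := t)).tendsto _ |>.comp (trunc f hf))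
    (Or.inl hne1) ((ENNReal.continuous_rpow_const (y := 1 - t)).tendsto _ |>.comp (trunc g hg)) (Or.inl hne2)
  refine le_of_tendsto' lim fun N => ?_
  apply pl_bdd t ht0 ht1 (fun x => min (f x) N) (fun x => min (g x) N) h
    (hf.min measurable_const) (hg.min measurable_const) hh
  · exact ne_top_of_le_ne_top (ENNReal.natCast_ne_top N) (iSup_le fun x => min_le_right _ _)
  · exact ne_top_of_le_ne_top (ENNReal.natCast_ne_top N) (iSup_le fun x => min_le_right _ _)
  · intro x y
    refine le_trans ?_ (H x y)
    gcongr <;> exact min_le_left _ _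

/-- log-concavity for extended-nonnegative functions -/
def LCF {E : Type*} [AddCommGroup E] [Module ℝ E] (φ : E → ℝ≥0∞) : Prop :=
  ∀ (x y : E) (t : ℝ), 0 < t → t < 1 → φ x ^ t * φ y ^ (1 - t) ≤ φ (t • x + (1 - t) • y)

lemma LCF.marg1 {E : Type*} [AddCommGroup E] [Module ℝ E] [MeasurableSpace E]
    {φ : E × ℝ → ℝ≥0∞} (hm : Measurable φ) (h : LCF φ) : LCF (fun x => ∫⁻ s, φ (x, s)) := by
  intro x y t ht0 ht1
  apply pl_one t ht0 ht1 _ _ _ (hm.comp measurable_prodMk_left) (hm.comp measurable_prodMk_left)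
    (hm.comp measurable_prodMk_left)
  intro a b
  exact h (x, a) (y, b) t ht0 ht1

lemma LCF.margk (k : ℕ) : ∀ {E : Type} [AddCommGroup E] [Module ℝ E] [MeasurableSpace E]
    {φ : E × (Fin k → ℝ) → ℝ≥0∞}, Measurable φ → LCF φ → LCF (fun x => ∫⁻ z, φ (x, z)) := by
  induction k with
  | zero =>
    intro E _ _ _ φ hm h x y t ht0 ht1
    have hv : (volume : Measure (Fin 0 → ℝ)) Set.univ = 1 := by
      rw [volume_pi, Measure.pi_of_empty]; simp
    simp only [lintegral_unique, hv, mul_one]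
    refine (h _ _ t ht0 ht1).trans (le_of_eq ?_)
    congr 1
    ext i
    · simp
    · exact i.elim0
  | succ k ih =>
    intro E _ _ _ φ hm h
    have e := (volume_preserving_piFinSuccAbove (fun _ : Fin (k + 1) => ℝ) 0).symm
    have hψm : Measurable (fun p : (E × ℝ) × (Fin k → ℝ) =>
        φ (p.1.1, (MeasurableEquiv.piFinSuccAbove (fun _ : Fin (k + 1) => ℝ) 0).symm (p.1.2, p.2))) := by
      fun_prop
    have h2 := ih (E := E × ℝ) hψm (by
      rintro ⟨⟨x, a⟩, z⟩ ⟨⟨y, b⟩, w⟩ t ht0 ht1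
      refine (h _ _ t ht0 ht1).trans (le_of_eq ?_)
      congr 1
      ext i
      · simp
      · refine Fin.cases ?_ (fun i => ?_) i <;> simp [MeasurableEquiv.piFinSuccAbove])
    have h3 := LCF.marg1 (hψm.lintegral_prod_right') h2
    have : (fun x => ∫⁻ z, φ (x, z)) = fun x => ∫⁻ s, ∫⁻ z, φ (x, (MeasurableEquiv.piFinSuccAbove (fun _ : Fin (k + 1) => ℝ) 0).symm (s, z)) := by
      funext x
      rw [← e.lintegral_comp (f := fun z => φ (x, z)) (hm.comp measurable_prodMk_left)]
      rw [Measure.volume_eq_prod, lintegral_prod]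
      fun_prop
    rw [this]
    exact h3

lemma lintegral_affine (a c : ℝ) (ha : a ≠ 0) (F : ℝ → ℝ≥0∞) (hF : Measurable F) :
    ∫⁻ x, F x = ENNReal.ofReal |a⁻¹| * ∫⁻ s, F ((s - c) * a⁻¹) := by
  have h1 : ∫⁻ s, F ((s - c) * a⁻¹) = ∫⁻ s, F (s * a⁻¹) := by
    exact lintegral_sub_right_eq_self (fun s => F (s * a⁻¹)) c
  have h2 : ∫⁻ s, F (s * a⁻¹) = ENNReal.ofReal |a| * ∫⁻ s, F s := by
    have : ∫⁻ s, F (s * a⁻¹) = ∫⁻ s, F s ∂(Measure.map (fun x => x * a⁻¹) volume) := by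
      rw [lintegral_map hF (by fun_prop)]
    rw [this, Real.map_volume_mul_right (inv_ne_zero ha)]
    simp
  rw [h1, h2, ← mul_assoc, ← ENNReal.ofReal_mul (abs_nonneg _), ← abs_mul, inv_mul_cancel₀ ha]
  simp

lemma es_same {k : ℕ} (j : Fin (k + 1)) (a : ℝ) (z : Fin k → ℝ) :
    (MeasurableEquiv.piFinSuccAbove (fun _ : Fin (k + 1) => ℝ) j).symm (a, z) j = a := by
  change (Fin.insertNth j a z : Fin (k + 1) → ℝ) j = a
  simp

lemma es_succ {k : ℕ} (j : Fin (k + 1)) (a : ℝ) (z : Fin k → ℝ) (i : Fin k) :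
    (MeasurableEquiv.piFinSuccAbove (fun _ : Fin (k + 1) => ℝ) j).symm (a, z) (j.succAbove i) = z i := by
  change (Fin.insertNth j a z : Fin (k + 1) → ℝ) (j.succAbove i) = z i
  simp

lemma proj_density {k : ℕ} (φ : (Fin (k + 1) → ℝ) → ℝ≥0∞) (hm : Measurable φ) (h : LCF φ)
    (v : Fin (k + 1) → ℝ) (j : Fin (k + 1)) (hj : v j ≠ 0) :
    ∃ g : ℝ → ℝ≥0∞, Measurable g ∧ LCF g ∧
      Measure.map (fun x => ∑ i, v i * x i) (volume.withDensity φ) = volume.withDensity g := by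
  set e := MeasurableEquiv.piFinSuccAbove (fun _ : Fin (k + 1) => ℝ) j with he
  have hp := (volume_preserving_piFinSuccAbove (fun _ : Fin (k + 1) => ℝ) j).symm
  rw [← he] at hp
  set ψ : ℝ × (Fin k → ℝ) → ℝ≥0∞ := fun p =>
    φ (e.symm ((p.1 - ∑ i, v (j.succAbove i) * p.2 i) * (v j)⁻¹, p.2)) with hψ
  have hψm : Measurable ψ := by fun_prop
  have hψl : LCF ψ := by
    rintro ⟨a, z⟩ ⟨b, w⟩ t ht0 ht1
    refine (h _ _ t ht0 ht1).trans (le_of_eq ?_)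
    rw [hψ]
    dsimp only
    congr 1
    ext i
    refine Fin.succAboveCases j ?_ (fun i => ?_) i
    · simp [he, es_same, mul_add, Finset.sum_add_distrib]
      have : ∀ (s : ℝ) (z : Fin k → ℝ), ∑ x, v (j.succAbove x) * (s * z x) = s * ∑ x, v (j.succAbove x) * z x := by
        intro s z
        rw [Finset.mul_sum]
        exact Finset.sum_congr rfl fun _ _ => by ring
      rw [this, this]
      ring
    · simp [he, es_same, es_succ]
  have hL : LCF (fun s => ∫⁻ z, ψ (s, z)) := LCF.margk k hψm hψl
  have hLm : Measurable (fun s => ∫⁻ z, ψ (s, z)) := hψm.lintegral_prod_right'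
  refine ⟨fun s => ENNReal.ofReal |(v j)⁻¹| * ∫⁻ z, ψ (s, z), hLm.const_mul _, ?_, ?_⟩
  · intro x y t ht0 ht1
    set c := ENNReal.ofReal |(v j)⁻¹|
    have hc0 : c ≠ 0 := by simpa [c] using hj
    have hct : c ≠ ⊤ := by simp [c]
    rw [ENNReal.mul_rpow_of_nonneg _ _ ht0.le, ENNReal.mul_rpow_of_nonneg _ _ (by linarith)]
    calc _ = (c ^ t * c ^ (1 - t)) * ((∫⁻ z, ψ (x, z)) ^ t * (∫⁻ z, ψ (y, z)) ^ (1 - t)) := by ring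
      _ = c * ((∫⁻ z, ψ (x, z)) ^ t * (∫⁻ z, ψ (y, z)) ^ (1 - t)) := by
        rw [← ENNReal.rpow_add _ _ hc0 hct]; simp
      _ ≤ _ := mul_le_mul_right (hL x y t ht0 ht1) c
  · have hvm : Measurable (fun x : Fin (k + 1) → ℝ => ∑ i, v i * x i) := by fun_prop
    ext A hA
    rw [Measure.map_apply hvm hA, withDensity_apply _ (hvm hA), withDensity_apply _ hA,
      ← lintegral_indicator (hvm hA), ← lintegral_indicator hA,
      ← hp.lintegral_comp (hm.indicator (hvm hA)), Measure.volume_eq_prod,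
      lintegral_prod_symm]
    swap
    · exact ((hm.indicator (hvm hA)).comp e.symm.measurable).aemeasurable
    have : ∀ z : Fin k → ℝ, ∫⁻ x, ((fun x : Fin (k + 1) → ℝ => ∑ i, v i * x i) ⁻¹' A).indicator φ (e.symm (x, z))
        = ENNReal.ofReal |(v j)⁻¹| * ∫⁻ s, A.indicator (fun s => ψ (s, z)) s := by
      intro z
      rw [lintegral_affine (v j) (∑ i, v (j.succAbove i) * z i) hj]
      · congr 1
        apply lintegral_congr fun s => ?_
        have : (∑ i, v i * (e.symm ((s - ∑ i, v (j.succAbove i) * z i) * (v j)⁻¹, z)) i) = s := by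
          rw [Fin.sum_univ_succAbove _ j]
          simp [he, es_same, es_succ]
          field_simp
          ring
        by_cases hs : s ∈ A
        · rw [Set.indicator_of_mem hs, Set.indicator_of_mem]
          rw [Set.mem_preimage, this]; exact hs
        · rw [Set.indicator_of_notMem hs, Set.indicator_of_notMem]
          rw [Set.mem_preimage, this]; exact hs
      · exact (hm.indicator (hvm hA)).comp (e.symm.measurable.comp measurable_prodMk_right)
    simp_rw [this]
    have hi : Measurable (fun p : (Fin k → ℝ) × ℝ => A.indicator (fun s => ψ (s, p.1)) p.2) := by
      have : (fun p : (Fin k → ℝ) × ℝ => A.indicator (fun s => ψ (s, p.1)) p.2) =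
        (Prod.snd ⁻¹' A).indicator (fun p => ψ (p.2, p.1)) := by
          
          funext p
          by_cases hs : p.2 ∈ A
          · rw [Set.indicator_of_mem hs, Set.indicator_of_mem]
            exact hs
          · rw [Set.indicator_of_notMem hs, Set.indicator_of_notMem]
            exact hs
      rw [this]
      exact (hψm.comp measurable_swap).indicator (measurable_snd hA)
    rw [lintegral_const_mul _ hi.lintegral_prod_right', lintegral_lintegral_swap hi.aemeasurable,
      ← lintegral_const_mul _ hi.lintegral_prod_left']
    apply lintegral_congr fun s => ?_
    by_cases hs : s ∈ A <;> simp [hs]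

/-- regularization -/
lemma regularize {d : ℕ} (f : (Fin d → ℝ) → ℝ) (f0 : ∀ x, 0 ≤ f x)
    (h : ∀ x y : Fin d → ℝ, ∀ t : ℝ, 0 ≤ t → t ≤ 1 →
      f x ^ t * f y ^ (1 - t) ≤ f (t • x + (1 - t) • y)) :
    ∃ φ : (Fin d → ℝ) → ℝ≥0∞, Measurable φ ∧ LCF φ ∧
      (volume : Measure (Fin d → ℝ)).withDensity (fun x => ENNReal.ofReal (f x)) = volume.withDensity φ := by
  set P : Set (Fin d → ℝ) := {x | 0 < f x} with hP
  have key : ∀ x ∈ P, ∀ y ∈ P, ∀ t : ℝ, 0 ≤ t → t ≤ 1 → t • x + (1 - t) • y ∈ P := by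
    intro x hx y hy t ht0 ht1
    refine lt_of_lt_of_le ?_ (h x y t ht0 ht1)
    have : 0 < f x := hx
    have : 0 < f y := hy
    positivity
  have hc : Convex ℝ P := by
    intro x hx y hy a b ha hb hab
    have : b = 1 - a := by linarith
    subst this
    exact key x hx y hy a ha (by linarith)
  have hpos : ∀ x ∈ interior P, 0 < f x := fun x hx => by
    have : x ∈ P := interior_subset hx
    exact this
  have hcon : ConcaveOn ℝ (interior P) (fun x => Real.log (f x)) := by
    refine ⟨hc.interior, ?_⟩
    intro x hx y hy a b ha hb hab
    have : b = 1 - a := by linarith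
    subst this
    have hx' : 0 < f x := hpos x hx
    have hy' : 0 < f y := hpos y hy
    have := Real.log_le_log (by positivity) (h x y a ha (by linarith))
    rw [Real.log_mul (by positivity) (by positivity), Real.log_rpow hx', Real.log_rpow hy'] at this
    simpa using this
  have hcont := hcon.continuousOn isOpen_interior
  have hcf : ContinuousOn f (interior P) := by
    refine (Real.continuous_exp.comp_continuousOn hcont).congr fun x hx => ?_
    exact (Real.exp_log (hpos x hx)).symm
  refine ⟨(interior P).indicator (fun x => ENNReal.ofReal (f x)), ?_, ?_, ?_⟩
  · classical
    rw [← Set.piecewise_eq_indicator]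
    exact ContinuousOn.measurable_piecewise (ENNReal.continuous_ofReal.comp_continuousOn hcf)
      continuousOn_const isOpen_interior.measurableSet
  · intro x y t ht0 ht1
    by_cases hx : x ∈ interior P
    · by_cases hy : y ∈ interior P
      · have hxy : t • x + (1 - t) • y ∈ interior P :=
          hc.interior hx hy ht0.le (by linarith) (by ring)
        rw [Set.indicator_of_mem hx, Set.indicator_of_mem hy, Set.indicator_of_mem hxy,
          ENNReal.ofReal_rpow_of_nonneg (f0 _) ht0.le,
          ENNReal.ofReal_rpow_of_nonneg (f0 _) (by linarith), ← ENNReal.ofReal_mul (Real.rpow_nonneg (f0 _) _)]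
        exact ENNReal.ofReal_le_ofReal (h x y t ht0.le ht1.le)
      · rw [Set.indicator_of_notMem hy, ENNReal.zero_rpow_of_pos (by linarith)]; simp
    · rw [Set.indicator_of_notMem hx, ENNReal.zero_rpow_of_pos (by linarith)]; simp
  · apply withDensity_congr_ae
    have := hc.addHaar_frontier volume
    filter_upwards [compl_mem_ae_iff.2 this] with x hx
    by_cases hxi : x ∈ interior P
    · simp [hxi]
    · have : ¬ 0 < f x := fun hpos => hx ⟨subset_closure hpos, hxi⟩
      simp [hxi, not_lt.1 this]

lemma cmp1 (D : ℝ → ℝ) (i0 : IntegrableOn D (Set.Ioi 0))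
    (i1 : IntegrableOn (fun x => x * D x) (Set.Ioi 0))
    (h0 : ∫ x in Set.Ioi 0, D x = 0)
    (hs : ∀ x z, 0 < x → x < z → 0 ≤ D z → 0 ≤ D x) : ∫ x in Set.Ioi 0, x * D x ≤ 0 := by
  by_cases hb : ∃ s, ∀ z, 0 < z → 0 ≤ D z → z ≤ s
  · -- bounded
    set S : Set ℝ := {z | 0 < z ∧ 0 ≤ D z} with hS
    obtain ⟨s0, hs0⟩ := hb
    have hbdd : BddAbove S := ⟨s0, fun z hz => hs0 z hz.1 hz.2⟩
    by_cases hne : S.Nonempty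
    · set s := sSup S
      have key : ∀ x ∈ Set.Ioi (0:ℝ), x * D x - s * D x ≤ 0 := by
        intro x hx
        have hx0 : (0:ℝ) < x := hx
        rcases lt_trichotomy x s with h | h | h
        · obtain ⟨z, hz, hxz⟩ := exists_lt_of_lt_csSup hne h
          have := hs x z hx0 hxz hz.2
          nlinarith
        · rw [h]; simp
        · have : ¬ 0 ≤ D x := fun hD => not_lt.2 (le_csSup hbdd (⟨hx0, hD⟩ : x ∈ S)) h
          nlinarith
      have h1 := setIntegral_nonpos (μ := volume) measurableSet_Ioi key
      rw [integral_sub i1 (i0.const_mul s), integral_const_mul, h0] at h1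
      linarith
    · refine setIntegral_nonpos measurableSet_Ioi fun x hx => ?_
      have hx0 : (0:ℝ) < x := hx
      have : ¬ 0 ≤ D x := fun hD => hne ⟨x, hx0, hD⟩
      nlinarith
  · push Not at hb
    have hpos : ∀ x ∈ Set.Ioi (0:ℝ), 0 ≤ D x := by
      intro x hx
      obtain ⟨z, hz0, hz, hxz⟩ := hb x
      exact hs x z hx hxz hz
    have := (setIntegral_eq_zero_iff_of_nonneg_ae
      ((ae_restrict_iff' measurableSet_Ioi).2 (ae_of_all _ hpos)) i0).1 h0
    have h2 : ∫ x in Set.Ioi 0, x * D x = 0 := by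
      apply integral_eq_zero_of_ae
      filter_upwards [this] with x hx
      simp [hx]
    exact h2.le

lemma cmp2 (D : ℝ → ℝ) (i0 : IntegrableOn D (Set.Ioi 0))
    (i1 : IntegrableOn (fun x => x * D x) (Set.Ioi 0))
    (i2 : IntegrableOn (fun x => x ^ 2 * D x) (Set.Ioi 0))
    (h0 : ∫ x in Set.Ioi 0, D x = 0) (h1 : ∫ x in Set.Ioi 0, x * D x = 0)
    (hs : ∀ x y z, 0 < x → x < y → y < z → 0 ≤ D x → 0 ≤ D z → 0 ≤ D y) :
    ∫ x in Set.Ioi 0, x ^ 2 * D x ≤ 0 := by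
  set S : Set ℝ := {z | 0 < z ∧ 0 ≤ D z} with hS
  by_cases hne : S.Nonempty
  · have hbb : BddBelow S := ⟨0, fun z hz => hz.1.le⟩
    set r := sInf S
    by_cases hbdd : BddAbove S
    · set s := sSup S
      have hrs : r ≤ s := csInf_le_csSup hne hbb hbdd
      have key : ∀ x ∈ Set.Ioi (0:ℝ), x ^ 2 * D x - ((r + s) * (x * D x) - (r * s) * D x) ≤ 0 := by
        intro x hx
        have hx0 : (0:ℝ) < x := hx
        have e : x ^ 2 * D x - ((r + s) * (x * D x) - (r * s) * D x) = ((x - r) * (x - s)) * D x := by ring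
        rw [e]
        rcases lt_trichotomy x r with h | h | h
        · have : ¬ 0 ≤ D x := fun hD => not_lt.2 (csInf_le hbb (⟨hx0, hD⟩ : x ∈ S)) h
          have h5 : 0 ≤ (x - r) * (x - s) := by nlinarith
          nlinarith
        · simp [h]
        · rcases lt_trichotomy x s with h' | h' | h'
          · obtain ⟨z, hz, hxz⟩ := exists_lt_of_lt_csSup hne h'
            obtain ⟨w, hw, hwx⟩ := exists_lt_of_csInf_lt hne h
            have := hs w x z hw.1 hwx hxz hw.2 hz.2
            have h5 : (x - r) * (x - s) ≤ 0 := by nlinarith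
            nlinarith
          · simp [h']
          · have : ¬ 0 ≤ D x := fun hD => not_lt.2 (le_csSup hbdd (⟨hx0, hD⟩ : x ∈ S)) h'
            have h5 : 0 ≤ (x - r) * (x - s) := by nlinarith
            nlinarith
      have h3 := setIntegral_nonpos (μ := volume) measurableSet_Ioi key
      have hk : Integrable (fun x => (r + s) * (x * D x) - (r * s) * D x) (volume.restrict (Set.Ioi 0)) :=
        (i1.const_mul _).sub (i0.const_mul _)
      rw [integral_sub i2 hk,
        integral_sub (i1.const_mul _) (i0.const_mul _), integral_const_mul, integral_const_mul, h0, h1] at h3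
      linarith
    · have key : ∀ x ∈ Set.Ioi (0:ℝ), 0 ≤ x * D x - r * D x := by
        intro x hx
        have hx0 : (0:ℝ) < x := hx
        rcases lt_trichotomy x r with h | h | h
        · have : ¬ 0 ≤ D x := fun hD => not_lt.2 (csInf_le hbb (⟨hx0, hD⟩ : x ∈ S)) h
          nlinarith
        · simp [h]
        · obtain ⟨w, hw, hwx⟩ := exists_lt_of_csInf_lt hne h
          obtain ⟨z, hz, hxz⟩ := not_bddAbove_iff.1 hbdd x
          have := hs w x z hw.1 hwx hxz hw.2 hz.2
          nlinarith
      have hz : ∫ x in Set.Ioi 0, (x * D x - r * D x) = 0 := by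
        rw [integral_sub i1 (i0.const_mul r), integral_const_mul, h0, h1]; simp
      have := (setIntegral_eq_zero_iff_of_nonneg_ae
        ((ae_restrict_iff' measurableSet_Ioi).2 (ae_of_all _ key)) (i1.sub (i0.const_mul r))).1 hz
      have hr : ∀ᵐ x ∂(volume.restrict (Set.Ioi (0:ℝ))), x ≠ r :=
        ae_restrict_of_ae (Measure.ae_ne volume r)
      have h2 : ∫ x in Set.Ioi 0, x ^ 2 * D x = 0 := by
        apply integral_eq_zero_of_ae
        filter_upwards [this, hr] with x hx hxr
        have : (x - r) * D x = 0 := by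
          have : x * D x - r * D x = 0 := hx
          linarith
        rcases mul_eq_zero.1 this with h | h
        · exact absurd (sub_eq_zero.1 h) hxr
        · simp [h]
      exact h2.le
  · refine setIntegral_nonpos measurableSet_Ioi fun x hx => ?_
    have hx0 : (0:ℝ) < x := hx
    have : ¬ 0 ≤ D x := fun hD => hne ⟨x, hx0, hD⟩
    nlinarith [sq_nonneg x]

lemma exp_int (k : ℕ) (l : ℝ) (hl : 0 < l) :
    IntegrableOn (fun x : ℝ => x ^ k * Real.exp (-(l * x))) (Set.Ioi 0) ∧
    ∫ x in Set.Ioi (0:ℝ), x ^ k * Real.exp (-(l * x)) = k.factorial / l ^ (k + 1) := by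
  constructor
  · have := integrableOn_rpow_mul_exp_neg_mul_rpow (s := k) (p := 1) (b := l)
      (by have : (0:ℝ) ≤ k := Nat.cast_nonneg k
          linarith) (by norm_num) hl
    simpa using this
  · have := Real.integral_rpow_mul_exp_neg_mul_Ioi (a := k + 1) (r := l) (by positivity) hl
    rw [Real.Gamma_nat_eq_factorial] at this
    have h2 : (1 / l) ^ ((k:ℝ) + 1) = (1 / l) ^ (k + 1) := by
      rw [← Real.rpow_natCast]; simp
    rw [h2] at this
    simp only [add_sub_cancel_right, Real.rpow_natCast] at this
    rw [this, one_div, inv_pow, mul_comm, div_eq_mul_inv]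

/-- real log-concavity -/
def RLC (g : ℝ → ℝ) : Prop :=
  ∀ x y t : ℝ, 0 < t → t < 1 → g x ^ t * g y ^ (1 - t) ≤ g (t * x + (1 - t) * y)

lemma RLC.between {g : ℝ → ℝ} (h : RLC g) (M l : ℝ) (hM : 0 < M) (x y z : ℝ) (hxy : x < y)
    (hyz : y < z) (hx : M * Real.exp (-(l * x)) ≤ g x) (hz : M * Real.exp (-(l * z)) ≤ g z) :
    M * Real.exp (-(l * y)) ≤ g y := by
  set t := (z - y) / (z - x) with ht
  have hzx : 0 < z - x := by linarith
  have ht0 : 0 < t := div_pos (by linarith) hzx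
  have ht1 : t < 1 := by rw [ht, div_lt_one hzx]; linarith
  have hy : t * x + (1 - t) * z = y := by
    rw [ht]; field_simp; ring
  rw [← hy]
  refine le_trans ?_ (h x z t ht0 ht1)
  calc M * Real.exp (-(l * (t * x + (1 - t) * z)))
      = (M * Real.exp (-(l * x))) ^ t * (M * Real.exp (-(l * z))) ^ (1 - t) := by
        rw [Real.mul_rpow hM.le (Real.exp_pos _).le, Real.mul_rpow hM.le (Real.exp_pos _).le,
          ← Real.exp_mul, ← Real.exp_mul]
        have : M = M ^ t * M ^ (1 - t) := by rw [← Real.rpow_add hM]; simp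
        calc _ = (M ^ t * M ^ (1 - t)) * (Real.exp (-(l * x) * t) * Real.exp (-(l * z) * (1 - t))) := by
              rw [← this, ← Real.exp_add]; ring_nf
          _ = _ := by ring
    _ ≤ _ := by
      have : 0 ≤ 1 - t := by linarith
      have hgx : 0 ≤ g x := le_trans (by positivity) hx
      gcongr

lemma half1 (g : ℝ → ℝ) (g0 : ∀ x, 0 ≤ g x) (h : RLC g) (i0 : IntegrableOn g (Set.Ioi 0))
    (i1 : IntegrableOn (fun x => x * g x) (Set.Ioi 0)) :
    g 0 * ∫ x in Set.Ioi 0, x * g x ≤ (∫ x in Set.Ioi 0, g x) ^ 2 := by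
  rcases (g0 0).eq_or_lt with hM | hM
  · rw [← hM]; simp; positivity
  set p := ∫ x in Set.Ioi 0, g x with hp
  have hp0 : 0 ≤ p := setIntegral_nonneg measurableSet_Ioi fun x _ => g0 x
  rcases hp0.eq_or_lt with hp1 | hp1
  · have := (setIntegral_eq_zero_iff_of_nonneg_ae (ae_of_all _ g0) i0).1 hp1.symm
    have h2 : ∫ x in Set.Ioi 0, x * g x = 0 := by
      apply integral_eq_zero_of_ae
      filter_upwards [this] with x hx
      simp [hx]
    rw [h2]; simp; positivity
  set M := g 0
  have hl : 0 < M / p := by positivity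
  obtain ⟨e0, E0⟩ := exp_int 0 (M / p) hl
  obtain ⟨e1, E1⟩ := exp_int 1 (M / p) hl
  simp only [pow_zero, one_mul, pow_one, Nat.factorial, zero_add, Nat.cast_one, mul_one] at e0 E0 e1 E1
  have := cmp1 (fun x => g x - M * Real.exp (-(M / p * x))) (i0.sub (e0.const_mul M))
    (by
      refine (i1.sub (e1.const_mul M)).congr (ae_of_all _ fun x => ?_)
      simp only [Pi.sub_apply]; ring)
    (by rw [integral_sub i0 (e0.const_mul M), integral_const_mul, E0, ← hp]; field_simp; ring)
    (by
      intro x z hx hxz hz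
      have := h.between M (M / p) hM 0 x z hx hxz (by simp [M]) (by linarith)
      linarith)
  have e : ∀ x, x * (g x - M * Real.exp (-(M / p * x))) = x * g x - M * (x * Real.exp (-(M / p * x))) :=
    fun x => by ring
  simp_rw [e] at this
  rw [integral_sub i1 (e1.const_mul M), integral_const_mul, E1] at this
  have e3 : M * (1 / (M / p) ^ (1 + 1)) = p ^ 2 / M := by
    rw [show (1 + 1) = 2 from rfl]; field_simp
  have : ∫ x in Set.Ioi 0, x * g x ≤ p ^ 2 / M := by linarith
  rw [le_div_iff₀ hM] at this
  linarith

lemma half2 (g : ℝ → ℝ) (g0 : ∀ x, 0 ≤ g x) (h : RLC g) (i0 : IntegrableOn g (Set.Ioi 0))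
    (i1 : IntegrableOn (fun x => x * g x) (Set.Ioi 0))
    (i2 : IntegrableOn (fun x => x ^ 2 * g x) (Set.Ioi 0)) :
    (∫ x in Set.Ioi 0, g x) * ∫ x in Set.Ioi 0, x ^ 2 * g x ≤ 2 * (∫ x in Set.Ioi 0, x * g x) ^ 2 := by
  set p := ∫ x in Set.Ioi 0, g x with hp
  have hp0 : 0 ≤ p := setIntegral_nonneg measurableSet_Ioi fun x _ => g0 x
  rcases hp0.eq_or_lt with hp1 | hp1
  · rw [← hp1]; simp; positivity
  set m := ∫ x in Set.Ioi 0, x * g x with hm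
  have hxg : ∀ x ∈ Set.Ioi (0:ℝ), 0 ≤ x * g x := fun x hx => mul_nonneg (le_of_lt hx) (g0 x)
  have hm0 : 0 ≤ m := setIntegral_nonneg measurableSet_Ioi hxg
  have hm1 : 0 < m := by
    rcases hm0.eq_or_lt with hm1 | hm1
    · exfalso
      have := (setIntegral_eq_zero_iff_of_nonneg_ae
        ((ae_restrict_iff' measurableSet_Ioi).2 (ae_of_all _ hxg)) i1).1 hm1.symm
      have h2 : p = 0 := by
        apply integral_eq_zero_of_ae
        filter_upwards [this, ae_restrict_mem measurableSet_Ioi] with x hx hx0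
        have hx0 : (0:ℝ) < x := hx0
        have hx : x * g x = 0 := hx
        rcases mul_eq_zero.1 hx with h | h
        · linarith
        · exact h
      linarith
    · exact hm1
  set l := p / m with hl'
  have hl : 0 < l := by positivity
  set M := p * l with hM'
  have hM : 0 < M := by positivity
  obtain ⟨e0, E0⟩ := exp_int 0 l hl
  obtain ⟨e1, E1⟩ := exp_int 1 l hl
  obtain ⟨e2, E2⟩ := exp_int 2 l hl
  simp only [pow_zero, one_mul, pow_one, Nat.factorial, zero_add, Nat.cast_one, mul_one] at e0 E0 e1 E1
  have q1 : ∀ x, x * (g x - M * Real.exp (-(l * x))) = x * g x - M * (x * Real.exp (-(l * x))) :=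
    fun x => by ring
  have q2 : ∀ x, x ^ 2 * (g x - M * Real.exp (-(l * x))) = x ^ 2 * g x - M * (x ^ 2 * Real.exp (-(l * x))) :=
    fun x => by ring
  have := cmp2 (fun x => g x - M * Real.exp (-(l * x))) (i0.sub (e0.const_mul M))
    (by simp_rw [q1]; exact i1.sub (e1.const_mul M))
    (by simp_rw [q2]; exact i2.sub (e2.const_mul M))
    (by rw [integral_sub i0 (e0.const_mul M), integral_const_mul, E0, ← hp, hM']; field_simp; ring)
    (by
      simp_rw [q1]
      rw [integral_sub i1 (e1.const_mul M), integral_const_mul, E1, ← hm, hM', hl', show (1 + 1) = 2 from rfl]; field_simp; ring)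
    (by
      intro x y z hx hxy hyz hDx hDz
      have := h.between M l hM x y z hxy hyz (by linarith) (by linarith)
      linarith)
  simp_rw [q2] at this
  rw [integral_sub i2 (e2.const_mul M), integral_const_mul, E2] at this
  have e3 : M * (((2:ℕ).factorial : ℝ) / l ^ (2 + 1)) = 2 * m ^ 2 / p := by
    rw [hM', hl']; simp [Nat.factorial]; field_simp
  rw [e3] at this
  have : ∫ x in Set.Ioi 0, x ^ 2 * g x ≤ 2 * m ^ 2 / p := by linarith
  rw [le_div_iff₀ hp1] at this
  linarith

lemma alg_half (M p q m1 m2 n1 n2 : ℝ) (hM : 0 ≤ M) (hp : 0 ≤ p) (hq : 0 ≤ q) (hpq : p + q = 1)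
    (hm1 : 0 ≤ m1) (hn1 : 0 ≤ n1) (h1 : M * m1 ≤ p ^ 2) (h2 : M * n1 ≤ q ^ 2)
    (h3 : p * m2 ≤ 2 * m1 ^ 2) (h4 : q * n2 ≤ 2 * n1 ^ 2) (hm2 : p = 0 → m2 = 0)
    (hn2 : q = 0 → n2 = 0) :
    M ^ 2 * (m2 + n2 - (m1 - n1) ^ 2) ≤ 1 := by
  set A := M * m1
  set B := M * n1
  have hA : 0 ≤ A := by positivity
  have hB : 0 ≤ B := by positivity
  have k1 : M ^ 2 * m2 - A ^ 2 ≤ 2 * p ^ 3 - p ^ 4 := by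
    rcases hp.eq_or_lt with h | h
    · rw [hm2 h.symm, ← h]; nlinarith
    · have : p * (M ^ 2 * m2) ≤ 2 * A ^ 2 := by
        have := mul_le_mul_of_nonneg_left h3 (sq_nonneg M)
        simp only [A]; nlinarith
      have h5 : A ^ 2 ≤ p ^ 4 := by nlinarith
      have h6 : p * (M ^ 2 * m2 - A ^ 2) ≤ p * (2 * p ^ 3 - p ^ 4) := by nlinarith
      exact le_of_mul_le_mul_left h6 h
  have k2 : M ^ 2 * n2 - B ^ 2 ≤ 2 * q ^ 3 - q ^ 4 := by
    rcases hq.eq_or_lt with h | h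
    · rw [hn2 h.symm, ← h]; nlinarith
    · have : q * (M ^ 2 * n2) ≤ 2 * B ^ 2 := by
        have := mul_le_mul_of_nonneg_left h4 (sq_nonneg M)
        simp only [B]; nlinarith
      have h5 : B ^ 2 ≤ q ^ 4 := by nlinarith
      have h6 : q * (M ^ 2 * n2 - B ^ 2) ≤ q * (2 * q ^ 3 - q ^ 4) := by nlinarith
      exact le_of_mul_le_mul_left h6 h
  have k3 : A * B ≤ p ^ 2 * q ^ 2 := mul_le_mul h1 h2 hB (by positivity)
  have e : M ^ 2 * (m2 + n2 - (m1 - n1) ^ 2) = (M ^ 2 * m2 - A ^ 2) + (M ^ 2 * n2 - B ^ 2) + 2 * (A * B) := by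
    simp only [A, B]; ring
  rw [e]
  have : q = 1 - p := by linarith
  subst this
  nlinarith [mul_nonneg hp hq]

lemma dens_bound0 (g : ℝ → ℝ) (g0 : ∀ x, 0 ≤ g x) (h : RLC g) (i0 : Integrable g)
    (i1 : Integrable (fun x => x * g x)) (i2 : Integrable (fun x => x ^ 2 * g x))
    (hI : ∫ x, g x = 1) :
    g 0 ^ 2 * ((∫ x, x ^ 2 * g x) - (∫ x, x * g x) ^ 2) ≤ 1 := by
  have h' : RLC (fun x => g (-x)) := by
    intro x y t ht0 ht1
    refine (h (-x) (-y) t ht0 ht1).trans (le_of_eq ?_)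
    congr 1; ring
  have hsplit : ∀ F : ℝ → ℝ, Integrable F → ∫ x, F x = (∫ x in Set.Ioi 0, F x) + ∫ x in Set.Ioi 0, F (-x) := by
    intro F hF
    have := integral_comp_neg_Ioi 0 F
    rw [neg_zero] at this
    rw [this, add_comm, ← setIntegral_union _ measurableSet_Ioi hF.integrableOn hF.integrableOn]
    · simp
    · exact Set.Iic_disjoint_Ioi le_rfl
  have j0 : Integrable (fun x => g (-x)) := i0.comp_neg
  have j1 : Integrable (fun x => x * g (-x)) := by
    refine i1.comp_neg.neg.congr (ae_of_all _ fun x => ?_)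
    simp
  have j2 : Integrable (fun x => x ^ 2 * g (-x)) := by
    refine i2.comp_neg.congr (ae_of_all _ fun x => ?_)
    simp
  have s0 := hsplit _ i0
  have s1 := hsplit _ i1
  have s2 := hsplit _ i2
  simp only [neg_mul, integral_neg, even_two, Even.neg_pow] at s1 s2
  rw [s1, s2, ← sub_eq_add_neg]
  have hz : ∀ g : ℝ → ℝ, (∀ x, 0 ≤ g x) → Integrable g → (∫ x in Set.Ioi 0, g x) = 0 → (∫ x in Set.Ioi 0, x ^ 2 * g x) = 0 := by
    intro g g0 i0 hp
    have := (setIntegral_eq_zero_iff_of_nonneg_ae (ae_of_all _ g0) i0.integrableOn).1 hp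
    apply integral_eq_zero_of_ae
    filter_upwards [this] with x hx
    simp [hx]
  have a2 := half1 (fun x => g (-x)) (fun x => g0 _) h' j0.integrableOn j1.integrableOn
  simp only [neg_zero] at a2
  apply alg_half (g 0) (∫ x in Set.Ioi 0, g x) (∫ x in Set.Ioi 0, g (-x)) _ _ _ _ (g0 0)
    (setIntegral_nonneg measurableSet_Ioi fun x _ => g0 x)
    (setIntegral_nonneg measurableSet_Ioi fun x _ => g0 _) (by rw [← s0, hI])
    (setIntegral_nonneg measurableSet_Ioi fun x hx => mul_nonneg (le_of_lt hx) (g0 x))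
    (setIntegral_nonneg measurableSet_Ioi fun x hx => mul_nonneg (le_of_lt hx) (g0 _))
    (half1 g g0 h i0.integrableOn i1.integrableOn) a2
    (half2 g g0 h i0.integrableOn i1.integrableOn i2.integrableOn)
    (half2 (fun x => g (-x)) (fun x => g0 _) h' j0.integrableOn j1.integrableOn j2.integrableOn)
    (hz g g0 i0) (hz _ (fun x => g0 _) j0)

lemma dens_bound (g : ℝ → ℝ) (g0 : ∀ x, 0 ≤ g x) (h : RLC g) (i0 : Integrable g)
    (i1 : Integrable (fun x => x * g x)) (i2 : Integrable (fun x => x ^ 2 * g x))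
    (hI : ∫ x, g x = 1) (c : ℝ) :
    g c ^ 2 * ((∫ x, x ^ 2 * g x) - (∫ x, x * g x) ^ 2) ≤ 1 := by
  have h' : RLC (fun x => g (x + c)) := by
    intro x y t ht0 ht1
    refine (h (x + c) (y + c) t ht0 ht1).trans (le_of_eq ?_)
    congr 1; ring
  have e1 : ∀ x, x * g (x + c) = (x + c) * g (x + c) - c * g (x + c) := fun x => by ring
  have e2 : ∀ x, x ^ 2 * g (x + c) = (x + c) ^ 2 * g (x + c) - ((2 * c) * ((x + c) * g (x + c)) - c ^ 2 * g (x + c)) :=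
    fun x => by ring
  have k0 : Integrable (fun x => g (x + c)) := i0.comp_add_right c
  have k1 : Integrable (fun x => (x + c) * g (x + c)) := i1.comp_add_right c
  have k2 : Integrable (fun x => (x + c) ^ 2 * g (x + c)) := i2.comp_add_right c
  have t0 : ∫ x, g (x + c) = 1 := by rw [integral_add_right_eq_self g c, hI]
  have t1 : ∫ x, (x + c) * g (x + c) = ∫ x, x * g x := integral_add_right_eq_self (fun x => x * g x) c
  have t2 : ∫ x, (x + c) ^ 2 * g (x + c) = ∫ x, x ^ 2 * g x := integral_add_right_eq_self (fun x => x ^ 2 * g x) c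
  have := dens_bound0 (fun x => g (x + c)) (fun x => g0 _) h' k0
    (by simp_rw [e1]; exact k1.sub (k0.const_mul c))
    (by simp_rw [e2]; exact k2.sub ((k1.const_mul _).sub (k0.const_mul _))) t0
  simp_rw [e1, e2] at this
  have hk : Integrable (fun x => (2 * c) * ((x + c) * g (x + c)) - c ^ 2 * g (x + c)) :=
    (k1.const_mul _).sub (k0.const_mul _)
  rw [integral_sub k1 (k0.const_mul c), integral_sub k2 hk,
    integral_sub (k1.const_mul _) (k0.const_mul _), integral_const_mul, integral_const_mul,
    integral_const_mul, t0, t1, t2, zero_add] at this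
  refine le_trans (le_of_eq ?_) this
  ring

lemma lcf_fin (g : ℝ → ℝ≥0∞) (hm : Measurable g) (h : LCF g) (hI : ∫⁻ s, g s = 1) (t : ℝ) :
    g t ≠ ⊤ := by
  intro ht
  have hex : ∃ s, s ≠ t ∧ g s ≠ 0 := by
    by_contra hcon
    push Not at hcon
    have : g =ᵐ[volume] 0 := by
      have : ∀ᵐ s : ℝ, s ≠ t := by
        rw [ae_iff]; simp
      filter_upwards [this] with s hs
      exact hcon s hs
    rw [lintegral_congr_ae this] at hI
    simp at hI
  obtain ⟨s, hst, hs⟩ := hex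
  have hae := ae_lt_top hm (by rw [hI]; simp : ∫⁻ s, g s ≠ ⊤)
  have hsub : openSegment ℝ t s ⊆ {x | ¬ g x < ⊤} := by
    rintro x ⟨a, b, ha, hb, hab, rfl⟩
    have hb' : b = 1 - a := by linarith
    subst hb'
    have := h t s a ha (by linarith)
    rw [ht, ENNReal.top_rpow_of_pos ha, ENNReal.top_mul] at this
    · exact fun hlt => absurd this (not_le.mpr hlt)
    · intro h0
      rw [ENNReal.rpow_eq_zero_iff] at h0
      rcases h0 with h0 | h0
      · exact hs h0.1
      · linarith [h0.2]
  have h0 : volume (openSegment ℝ t s) = 0 := measure_mono_null hsub (ae_iff.mp hae)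
  rw [openSegment_eq_Ioo' hst.symm] at h0
  rw [Real.volume_Ioo] at h0
  have : 0 < max t s - min t s := by
    rcases lt_or_gt_of_ne hst with h | h
    · rw [max_eq_left h.le, min_eq_right h.le]; linarith
    · rw [max_eq_right h.le, min_eq_left h.le]; linarith
  simp only [ENNReal.ofReal_eq_zero] at h0
  linarith

lemma cov_sq {d : ℕ} (μ : Measure (Fin d → ℝ)) [IsProbabilityMeasure μ] (hc : HasIdCovariance μ)
    (v : Fin d → ℝ) : MemLp (fun x : Fin d → ℝ => ∑ i, v i * x i) 2 μ ∧
    (∫ x, (∑ i, v i * x i) ^ 2 ∂μ) - (∫ x, ∑ i, v i * x i ∂μ) ^ 2 = ∑ i, v i ^ 2 := by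
  have hL : ∀ i, MemLp (fun x : Fin d → ℝ => x i) 2 μ := by
    intro i
    rw [memLp_two_iff_integrable_sq (measurable_pi_apply i).aestronglyMeasurable]
    by_contra hn
    have h := hc i i
    have : (∫ x, x i * x i ∂μ) = 0 := by
      apply integral_undef
      simpa [sq] using hn
    rw [this] at h
    simp at h
    nlinarith [mul_self_nonneg (∫ x, x i ∂μ)]
  have h1 : ∀ i, Integrable (fun x : Fin d → ℝ => x i) μ := fun i => (hL i).integrable (by norm_num)
  have h2 : ∀ i j, Integrable (fun x : Fin d → ℝ => x i * x j) μ := fun i j => (hL i).integrable_mul (hL j)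
  refine ⟨memLp_finsetSum _ (fun i _ => (hL i).const_mul (v i)), ?_⟩
  have e1 : ∫ x, ∑ i, v i * x i ∂μ = ∑ i, v i * ∫ x, x i ∂μ := by
    rw [integral_finsetSum _ (fun i _ => (h1 i).const_mul _)]
    simp_rw [integral_const_mul]
  have e2 : ∫ x, (∑ i, v i * x i) ^ 2 ∂μ = ∑ i, ∑ j, (v i * v j) * ∫ x, x i * x j ∂μ := by
    have : ∀ x : Fin d → ℝ, (∑ i, v i * x i) ^ 2 = ∑ i, ∑ j, (v i * v j) * (x i * x j) := by
      intro x
      rw [sq, Finset.sum_mul_sum]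
      exact Finset.sum_congr rfl fun i _ => Finset.sum_congr rfl fun j _ => by ring
    simp_rw [this]
    rw [integral_finsetSum _ (fun i _ => integrable_finsetSum _ fun j _ => (h2 i j).const_mul _)]
    refine Finset.sum_congr rfl fun i _ => ?_
    rw [integral_finsetSum _ (fun j _ => (h2 i j).const_mul _)]
    simp_rw [integral_const_mul]
  rw [e1, e2, sq, Finset.sum_mul_sum, ← Finset.sum_sub_distrib]
  refine Finset.sum_congr rfl fun i _ => ?_
  rw [← Finset.sum_sub_distrib]
  have : ∀ j, (v i * v j) * (∫ x, x i * x j ∂μ) - (v i * ∫ x, x i ∂μ) * (v j * ∫ x, x j ∂μ)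
      = if i = j then v i * v j else 0 := by
    intro j
    have := hc i j
    calc _ = (v i * v j) * ((∫ x, x i * x j ∂μ) - (∫ x, x i ∂μ) * (∫ x, x j ∂μ)) := by ring
      _ = _ := by rw [this]; split_ifs <;> simp
  simp_rw [this]
  simp [sq]

lemma proj_bdd {d : ℕ} (μ : Measure (Fin d → ℝ)) [IsProbabilityMeasure μ] (hl : IsLogConcave μ)
    (hc : HasIdCovariance μ) (v : Fin d → ℝ) (r : ℝ) (hr : 0 < r) (hv : ∑ i, v i ^ 2 = r ^ 2) :
    ∃ g : ℝ → ℝ≥0∞, Measurable g ∧ Measure.map (fun x => ∑ i, v i * x i) μ = volume.withDensity g ∧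
      ∀ s, g s ≤ ENNReal.ofReal (1 / r) := by
  have hj : ∃ j, v j ≠ 0 := by
    by_contra hcon
    push Not at hcon
    simp [hcon] at hv
    nlinarith
  obtain ⟨j, hj⟩ := hj
  have hvar := cov_sq μ hc v
  have hprob : IsProbabilityMeasure μ := inferInstance
  obtain ⟨f, f0, hf, hfl⟩ := hl
  obtain ⟨φ, hφm, hφ, hφe⟩ := regularize f f0 hfl
  rw [hφe] at hf
  cases d with
  | zero => exact j.elim0
  | succ k =>
    obtain ⟨g, hgm, hgl, hge⟩ := proj_density φ hφm hφ v j hj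
    rw [← hf] at hge
    have hLm : Measurable (fun x : Fin (k+1) → ℝ => ∑ i, v i * x i) := by fun_prop
    refine ⟨g, hgm, hge, ?_⟩
    have hI : ∫⁻ s, g s = 1 := by
      have : (Measure.map (fun x => ∑ i, v i * x i) μ) Set.univ = 1 := by
        rw [Measure.map_apply hLm MeasurableSet.univ]; simp
      rw [hge, withDensity_apply _ MeasurableSet.univ] at this
      simpa using this
    have hfin := lcf_fin g hgm hgl hI
    have hR : RLC (fun s => (g s).toReal) := by
      intro x y t ht0 ht1
      have := ENNReal.toReal_mono (hfin _) (hgl x y t ht0 ht1)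
      rw [ENNReal.toReal_mul, ← ENNReal.toReal_rpow, ← ENNReal.toReal_rpow] at this
      simpa using this
    have hinteg : ∀ F : ℝ → ℝ, Measurable F → Integrable (fun x : Fin (k+1) → ℝ => F (∑ i, v i * x i)) μ →
        Integrable (fun s => F s * (g s).toReal) ∧
        ∫ s, F s * (g s).toReal = ∫ x, F (∑ i, v i * x i) ∂μ := by
      intro F hF hi
      have h1 : Integrable F (Measure.map (fun x => ∑ i, v i * x i) μ) := by
        rw [integrable_map_measure hF.aestronglyMeasurable hLm.aemeasurable]
        exact hi
      constructor
      · rw [hge, integrable_withDensity_iff hgm (Filter.Eventually.of_forall fun s => (hfin s).lt_top)] at h1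
        exact h1
      · rw [← integral_map (f := F) hLm.aemeasurable hF.aestronglyMeasurable, hge,
          integral_withDensity_eq_integral_toReal_smul hgm (Filter.Eventually.of_forall fun s => (hfin s).lt_top)]
        simp [mul_comm]
    have t0 := hinteg (fun _ => 1) measurable_const (integrable_const _)
    have t1 := hinteg (fun s => s) measurable_id (hvar.1.integrable (by norm_num))
    have t2 := hinteg (fun s => s ^ 2) (by fun_prop) hvar.1.integrable_sq
    simp only [one_mul, integral_const, probReal_univ, smul_eq_mul, mul_one] at t0
    intro s
    have hb := dens_bound (fun s => (g s).toReal) (fun _ => ENNReal.toReal_nonneg) hR t0.1 t1.1 t2.1 t0.2 s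
    rw [t1.2, t2.2, hvar.2, hv, ← mul_pow] at hb
    have h3 : (g s).toReal * r ≤ 1 := by
      have := (sq_le_one_iff₀ (by positivity)).mp hb
      exact this
    rw [← ENNReal.ofReal_toReal (hfin s)]
    apply ENNReal.ofReal_le_ofReal
    rw [le_div_iff₀ hr]; exact h3

lemma exp_abs_lint (l : ℝ) (hl : 0 < l) :
    ∫⁻ s, ENNReal.ofReal (Real.exp (-(l * |s|))) ≤ ENNReal.ofReal (2 / l) := by
  have h1 : ∫⁻ s in Set.Ioi (0:ℝ), ENNReal.ofReal (Real.exp (-(l * |s|))) = ENNReal.ofReal (1 / l) := by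
    have := exp_int 0 l hl
    simp only [pow_zero, one_mul, Nat.factorial_zero, Nat.cast_one, zero_add, pow_one] at this
    rw [← this.2, ofReal_integral_eq_lintegral_ofReal this.1 (Filter.Eventually.of_forall fun _ => (Real.exp_pos _).le)]
    refine setLIntegral_congr_fun measurableSet_Ioi fun s hs => ?_
    have : 0 < s := hs
    simp only [abs_of_pos this]
  have h2 : ∫⁻ s in Set.Iio (0:ℝ), ENNReal.ofReal (Real.exp (-(l * |s|)))
      = ∫⁻ s in Set.Ioi (0:ℝ), ENNReal.ofReal (Real.exp (-(l * |s|))) := by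
    rw [← lintegral_indicator measurableSet_Iio, ← lintegral_indicator measurableSet_Ioi,
      ← lintegral_neg_eq_self]
    congr 1
    ext s
    by_cases hs : 0 < s
    · rw [Set.indicator_of_mem (by simpa using hs), Set.indicator_of_mem (by simpa using hs), abs_neg]
    · rw [Set.indicator_of_notMem (by simpa using hs), Set.indicator_of_notMem (by simpa using hs)]
  rw [← lintegral_add_compl _ (measurableSet_Ioi (a := (0:ℝ))), Set.compl_Ioi,
    setLIntegral_congr (Iio_ae_eq_Iic (a := (0:ℝ))).symm, h2, h1, ← ENNReal.ofReal_add (by positivity) (by positivity)]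
  apply ENNReal.ofReal_le_ofReal
  apply le_of_eq; ring

lemma proj_exp {d : ℕ} (μ : Measure (Fin d → ℝ)) [IsProbabilityMeasure μ] (hlc : IsLogConcave μ)
    (hc : HasIdCovariance μ) (v : Fin d → ℝ) (r : ℝ) (hr : 0 < r) (hv : ∑ i, v i ^ 2 = r ^ 2)
    (l : ℝ) (hl : 0 < l) :
    ∫⁻ x, ENNReal.ofReal (1 + Real.exp (-(l * |∑ i, v i * x i|))) ∂μ ≤ ENNReal.ofReal (1 + 2 / (r * l)) := by
  obtain ⟨g, hgm, hge, hgb⟩ := proj_bdd μ hlc hc v r hr hv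
  have hLm : Measurable (fun x : Fin d → ℝ => ∑ i, v i * x i) := by fun_prop
  have hem : Measurable (fun s : ℝ => ENNReal.ofReal (Real.exp (-(l * |s|)))) := by fun_prop
  have : ∫⁻ x, ENNReal.ofReal (Real.exp (-(l * |∑ i, v i * x i|))) ∂μ ≤ ENNReal.ofReal (2 / (r * l)) := by
    rw [← lintegral_map (f := fun s : ℝ => ENNReal.ofReal (Real.exp (-(l * |s|)))) hem hLm, hge,
      lintegral_withDensity_eq_lintegral_mul _ hgm hem]
    calc _ ≤ ∫⁻ s, ENNReal.ofReal (1 / r) * ENNReal.ofReal (Real.exp (-(l * |s|))) := by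
          apply lintegral_mono
          intro s
          exact mul_le_mul_left (hgb s) _
      _ ≤ _ := by
          rw [lintegral_const_mul _ hem]
          refine (mul_le_mul_right (exp_abs_lint l hl) _).trans ?_
          rw [← ENNReal.ofReal_mul (by positivity)]
          apply ENNReal.ofReal_le_ofReal
          apply le_of_eq; field_simp
  have e : ∀ x : Fin d → ℝ, ENNReal.ofReal (1 + Real.exp (-(l * |∑ i, v i * x i|)))
      = 1 + ENNReal.ofReal (Real.exp (-(l * |∑ i, v i * x i|))) := by
    intro x
    rw [ENNReal.ofReal_add zero_le_one (Real.exp_pos _).le, ENNReal.ofReal_one]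
  simp_rw [e]
  rw [lintegral_add_left measurable_const, lintegral_const, measure_univ, mul_one,
    ENNReal.ofReal_add zero_le_one (by positivity), ENNReal.ofReal_one]
  gcongr

lemma count_le {n : ℕ} (a : Fin n → ℝ) (ha : ∀ i, 0 ≤ a i) (G l : ℝ) (hl : 0 ≤ l)
    (p : Fin n → ℝ) (p1 : ∀ i, 1 ≤ p i) (hp : ∀ i, a i ≤ G → 1 + Real.exp (-(l * a i)) ≤ p i) :
    ({x : Fin n → ℝ | (∀ i, x i = 0 ∨ x i = 1) ∧ ∑ i, x i * a i ≤ G}.ncard : ℝ)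
      ≤ Real.exp (l * G) * ∏ i, p i := by
  classical
  set I : Finset (Fin n) := Finset.univ.filter (fun i => a i ≤ G) with hI
  set F : Finset (Finset (Fin n)) := I.powerset.filter (fun S => ∑ i ∈ S, a i ≤ G) with hF
  have h1 : {x : Fin n → ℝ | (∀ i, x i = 0 ∨ x i = 1) ∧ ∑ i, x i * a i ≤ G}.ncard ≤ F.card := by
    rw [← Set.ncard_coe_finset]
    refine Set.ncard_le_ncard_of_injOn (fun x => Finset.univ.filter (fun i => x i = 1)) ?_ ?_ F.finite_toSet
    · rintro x ⟨hx, hs⟩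
      have hsum : ∑ i ∈ Finset.univ.filter (fun i => x i = 1), a i = ∑ i, x i * a i := by
        rw [Finset.sum_filter]
        refine Finset.sum_congr rfl fun i _ => ?_
        rcases hx i with h | h <;> simp [h]
      have hmem : Finset.univ.filter (fun i => x i = 1) ∈ F := by
        rw [hF, Finset.mem_filter, Finset.mem_powerset]
        refine ⟨?_, by rw [hsum]; exact hs⟩
        intro i hi
        rw [hI, Finset.mem_filter]
        refine ⟨Finset.mem_univ _, ?_⟩
        refine le_trans ?_ (hsum.le.trans hs)
        exact Finset.single_le_sum (f := a) (fun j _ => ha j) hi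
      exact hmem
    · rintro x ⟨hx, _⟩ y ⟨hy, _⟩ hxy
      ext i
      have : (x i = 1) ↔ (y i = 1) := by
        have := Finset.ext_iff.mp hxy i
        simpa using this
      rcases hx i with h | h <;> rcases hy i with h' | h' <;> simp_all
  have h2 : (F.card : ℝ) ≤ ∑ S ∈ I.powerset, Real.exp (l * G) * ∏ i ∈ S, Real.exp (-(l * a i)) := by
    rw [Finset.card_eq_sum_ones, Nat.cast_sum]
    calc _ ≤ ∑ S ∈ F, Real.exp (l * G) * ∏ i ∈ S, Real.exp (-(l * a i)) := by
          refine Finset.sum_le_sum fun S hS => ?_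
          rw [← Real.exp_sum, ← Real.exp_add, Nat.cast_one]
          apply Real.one_le_exp
          rw [Finset.sum_neg_distrib, ← Finset.mul_sum]
          have := (Finset.mem_filter.mp hS).2
          nlinarith
      _ ≤ _ := by
          refine Finset.sum_le_sum_of_subset_of_nonneg (Finset.filter_subset _ _) fun S _ _ => ?_
          positivity
  rw [← Finset.mul_sum, ← Finset.prod_one_add] at h2
  refine (Nat.cast_le.mpr h1).trans (h2.trans ?_)
  refine mul_le_mul_of_nonneg_left ?_ (Real.exp_pos _).le
  rw [hI, Finset.prod_filter]
  refine Finset.prod_le_prod (fun i _ => by split_ifs <;> positivity) fun i _ => ?_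
  split_ifs with h
  · exact hp i h
  · exact p1 i

lemma max_det {d : ℕ} {K : Type*} [Fintype K] (b : K → Fin d → ℝ) (A : K → Prop)
    (e : Fin d → K) (he : ∀ l, A (e l)) (heb : ∀ l, b (e l) = Pi.single l 1) :
    ∃ κ : Fin d → K, (∀ l, A (κ l)) ∧ (Matrix.of fun l => b (κ l)).det ≠ 0 ∧
      ∀ k, A k → ∃ c : Fin d → ℝ, (∀ l, |c l| ≤ 1) ∧ ∀ w : Fin d → ℝ,
        ∑ j, w j * b k j = ∑ l, c l * ∑ j, w j * b (κ l) j := by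
  classical
  obtain ⟨κ, hκ, hmax⟩ := Finset.exists_max_image
    (Finset.univ.filter (fun κ : Fin d → K => ∀ l, A (κ l)))
    (fun κ => |(Matrix.of fun l => b (κ l)).det|) ⟨e, by simpa using he⟩
  simp only [Finset.mem_filter, Finset.mem_univ, true_and] at hκ hmax
  have hdet : 0 < |(Matrix.of fun l => b (κ l)).det| := by
    refine lt_of_lt_of_le ?_ (hmax e he)
    have : (Matrix.of fun l => b (e l)) = (1 : Matrix (Fin d) (Fin d) ℝ) := by
      ext i j
      simp [heb, Matrix.one_apply, Pi.single_apply, eq_comm]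
    rw [this]; simp
  set B := Matrix.of fun l => b (κ l) with hB
  have hd0 : B.det ≠ 0 := abs_pos.mp hdet
  refine ⟨κ, hκ, hd0, fun k hk => ?_⟩
  refine ⟨fun l => B.det⁻¹ * (B.updateRow l (b k)).det, fun l => ?_, fun w => ?_⟩
  · have : B.updateRow l (b k) = Matrix.of fun l' => b (Function.update κ l k l') := by
      ext i j
      by_cases h : i = l
      · subst h; simp
      · simp [h, hB]
    have h2 := hmax (Function.update κ l k) (fun l' => by
      by_cases h : l' = l
      · subst h; simpa using hk
      · simpa [h] using hκ l')
    rw [abs_mul, abs_inv, this, inv_mul_le_iff₀ hdet, mul_one]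
    exact h2
  · have hc := Matrix.mulVec_cramer B.transpose (b k)
    have hc' : ∀ j, B.det * b k j = ∑ l, (B.updateRow l (b k)).det * b (κ l) j := by
      intro j
      have := congrFun hc j
      simp only [Matrix.mulVec, dotProduct, Matrix.transpose_apply, Matrix.cramer_transpose_apply,
        Matrix.det_transpose, Pi.smul_apply, smul_eq_mul] at this
      rw [← this]
      exact Finset.sum_congr rfl fun l _ => by simp [hB, mul_comm]
    have hc2 : ∀ j, b k j = ∑ l, B.det⁻¹ * (B.updateRow l (b k)).det * b (κ l) j := by
      intro j
      simp_rw [mul_assoc]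
      rw [← Finset.mul_sum, ← hc' j]; field_simp
    simp_rw [Finset.mul_sum]
    rw [Finset.sum_comm]
    refine Finset.sum_congr rfl fun j _ => ?_
    nth_rewrite 1 [hc2 j]
    rw [Finset.mul_sum]
    refine Finset.sum_congr rfl fun l _ => by ring

/-- the family of vectors: scaled columns and the standard basis -/
noncomputable def bvec {n d : ℕ} (g : ℝ) (W : Fin n → Fin d → ℝ) : Fin n ⊕ Fin d → Fin d → ℝ :=
  Sum.elim (fun i j => W i j / g) (fun l => Pi.single l 1)

/-- matrix of selected vectors -/
noncomputable def bmat {n d : ℕ} (g : ℝ) (κ : Fin d → Fin n ⊕ Fin d) (W : Fin n → Fin d → ℝ) :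
    Matrix (Fin d) (Fin d) ℝ := Matrix.of fun l => bvec g W (κ l)

/-- net vector -/
noncomputable def uap {n d : ℕ} (g : ℝ) (m : ℕ) (κ : Fin d → Fin n ⊕ Fin d) (z : Fin d → Fin (2 * m + 1))
    (W : Fin n → Fin d → ℝ) : Fin d → ℝ :=
  fun j => (bmat g κ W).det⁻¹ * ∑ l, (bmat g κ W).adjugate j l * ((((z l : ℕ) : ℝ) - m) / m)

/-- selected columns -/
noncomputable def Jset {n d : ℕ} (κ : Fin d → Fin n ⊕ Fin d) : Finset (Fin n) :=
  by classical exact Finset.univ.filter (fun i => ∃ l, κ l = Sum.inl i)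

lemma Jset_card {n d : ℕ} (κ : Fin d → Fin n ⊕ Fin d) : (Jset κ).card ≤ d := by
  classical
  have : (Jset κ).image Sum.inl ⊆ Finset.univ.image κ := by
    intro k hk
    simp only [Finset.mem_image, Jset, Finset.mem_filter, Finset.mem_univ, true_and] at hk ⊢
    obtain ⟨i, ⟨l, hl⟩, rfl⟩ := hk
    exact ⟨l, hl⟩
  have h := Finset.card_le_card this
  rw [Finset.card_image_of_injective _ Sum.inl_injective] at h
  refine h.trans (Finset.card_image_le.trans (by simp))

lemma bmat_update {n d : ℕ} (g : ℝ) (κ : Fin d → Fin n ⊕ Fin d) (W : Fin n → Fin d → ℝ)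
    (i : Fin n) (hi : i ∉ Jset κ) (w : Fin d → ℝ) : bmat g κ (Function.update W i w) = bmat g κ W := by
  classical
  ext l j
  simp only [bmat, Matrix.of_apply]
  rcases hk : κ l with i' | j'
  · have : i' ≠ i := by
      rintro rfl
      exact hi (by simp only [Jset, Finset.mem_filter, Finset.mem_univ, true_and]; exact ⟨l, hk⟩)
    simp [bvec, this]
  · simp [bvec]

lemma uap_update {n d : ℕ} (g : ℝ) (m : ℕ) (κ : Fin d → Fin n ⊕ Fin d) (z : Fin d → Fin (2 * m + 1))
    (W : Fin n → Fin d → ℝ) (i : Fin n) (hi : i ∉ Jset κ) (w : Fin d → ℝ) :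
    uap g m κ z (Function.update W i w) = uap g m κ z W := by
  unfold uap
  rw [bmat_update g κ W i hi w]

lemma uap_meas {n d : ℕ} (g : ℝ) (m : ℕ) (κ : Fin d → Fin n ⊕ Fin d) (z : Fin d → Fin (2 * m + 1)) :
    Measurable (uap (n := n) g m κ z) := by
  have hc : Continuous (bmat (n := n) g κ) := by
    refine continuous_matrix fun l j => ?_
    simp only [bmat, Matrix.of_apply]
    rcases κ l with i' | j'
    · simp only [bvec, Sum.elim_inl]; fun_prop
    · simp only [bvec, Sum.elim_inr]; fun_prop
  refine measurable_pi_lambda _ fun j => ?_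
  refine Measurable.mul (hc.matrix_det.measurable.inv) ?_
  refine Finset.measurable_sum _ fun l _ => ?_
  exact ((hc.matrix_adjugate.matrix_elem j l).measurable).mul_const _

lemma uap_spec {n d : ℕ} (g : ℝ) (m : ℕ) (κ : Fin d → Fin n ⊕ Fin d) (z : Fin d → Fin (2 * m + 1))
    (W : Fin n → Fin d → ℝ) (h : (bmat g κ W).det ≠ 0) (l : Fin d) :
    ∑ j, uap g m κ z W j * bvec g W (κ l) j = (((z l : ℕ) : ℝ) - m) / m := by
  set y : Fin d → ℝ := fun l => (((z l : ℕ) : ℝ) - m) / m with hy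
  have hu : uap g m κ z W = (bmat g κ W).det⁻¹ • ((bmat g κ W).adjugate.mulVec y) := by
    ext j
    simp [uap, Matrix.mulVec, dotProduct, hy]
  have : (bmat g κ W).mulVec (uap g m κ z W) = y := by
    rw [hu, Matrix.mulVec_smul, Matrix.mulVec_mulVec, Matrix.mul_adjugate, Matrix.smul_mulVec,
      Matrix.one_mulVec, smul_smul, inv_mul_cancel₀ h, one_smul]
  have h2 := congrFun this l
  rw [show (((z l : ℕ) : ℝ) - m) / m = y l from rfl, ← h2]
  simp only [Matrix.mulVec, dotProduct]
  exact Finset.sum_congr rfl fun j _ => by simp [bmat, mul_comm]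

lemma approx {n d : ℕ} (g : ℝ) (m : ℕ) (hm : 0 < m) (W : Fin n → Fin d → ℝ) (u : Fin d → ℝ)
    (hu : ∑ j, u j ^ 2 = 1) :
    ∃ κ : Fin d → Fin n ⊕ Fin d, ∃ z : Fin d → Fin (2 * m + 1),
      (∀ k, |∑ j, u j * bvec g W k j| ≤ 1 →
        |∑ j, (u j - uap g m κ z W j) * bvec g W k j| ≤ d / m) ∧
      1 - (d:ℝ) ^ 2 / m ≤ ∑ j, u j * uap g m κ z W j := by
  have hmr : (0:ℝ) < m := by exact_mod_cast hm
  have hu1 : ∀ j, |u j| ≤ 1 := by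
    intro j
    rw [← sq_le_one_iff_abs_le_one, ← hu]
    exact Finset.single_le_sum (f := fun j => u j ^ 2) (fun j _ => sq_nonneg _) (Finset.mem_univ j)
  have hstd : ∀ (w : Fin d → ℝ) l, ∑ j, w j * bvec g W (Sum.inr l) j = w l := by
    intro w l
    simp [bvec, Pi.single_apply]
  obtain ⟨κ, hκ, hdet, hrep⟩ := max_det (bvec g W) (fun k => |∑ j, u j * bvec g W k j| ≤ 1)
    Sum.inr (fun l => by rw [hstd]; exact hu1 l) (fun l => rfl)
  set t : Fin d → ℝ := fun l => ∑ j, u j * bvec g W (κ l) j with ht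
  have ht1 : ∀ l, |t l| ≤ 1 := hκ
  have hz : ∀ l, ∃ z : Fin (2 * m + 1), |t l - (((z : ℕ) : ℝ) - m) / m| ≤ 1 / m := by
    intro l
    have h1 := abs_le.mp (ht1 l)
    have hf0 : (0:ℤ) ≤ ⌊(m:ℝ) * t l⌋ + m := by
      have : (-(m:ℤ)) ≤ ⌊(m:ℝ) * t l⌋ := by
        rw [Int.le_floor]; push_cast; nlinarith
      linarith
    have hf1 : ⌊(m:ℝ) * t l⌋ + m < ((2 * m + 1 : ℕ) : ℤ) := by
      have : ⌊(m:ℝ) * t l⌋ ≤ m := by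
        have h3 : ((⌊(m:ℝ) * t l⌋ : ℤ) : ℝ) ≤ (m : ℤ) := (Int.floor_le _).trans (by push_cast; nlinarith)
        exact_mod_cast h3
      push_cast; linarith
    obtain ⟨N, hN⟩ := Int.eq_ofNat_of_zero_le hf0
    refine ⟨⟨N, by rw [hN] at hf1; exact_mod_cast hf1⟩, ?_⟩
    have hNr : (N:ℝ) = ⌊(m:ℝ) * t l⌋ + m := by exact_mod_cast hN.symm
    simp only [hNr]
    have e : t l - ((⌊(m:ℝ) * t l⌋ : ℝ) + m - m) / m = ((m:ℝ) * t l - ⌊(m:ℝ) * t l⌋) / m := by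
      field_simp; ring
    rw [e, abs_div, abs_of_pos hmr]
    gcongr
    rw [abs_le]
    constructor <;> linarith [Int.floor_le ((m:ℝ) * t l), Int.lt_floor_add_one ((m:ℝ) * t l)]
  choose z hz using hz
  have hA : ∀ k, |∑ j, u j * bvec g W k j| ≤ 1 →
        |∑ j, (u j - uap g m κ z W j) * bvec g W k j| ≤ d / m := by
    intro k hk
    obtain ⟨c, hc1, hc⟩ := hrep k hk
    rw [hc (fun j => u j - uap g m κ z W j)]
    calc _ ≤ ∑ l, |c l * ∑ j, (u j - uap g m κ z W j) * bvec g W (κ l) j| := Finset.abs_sum_le_sum_abs _ _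
      _ ≤ ∑ l : Fin d, 1 / (m:ℝ) := by
          refine Finset.sum_le_sum fun l _ => ?_
          rw [abs_mul]
          have e : ∑ j, (u j - uap g m κ z W j) * bvec g W (κ l) j = t l - (((z l : ℕ) : ℝ) - m) / m := by
            rw [← uap_spec g m κ z W hdet l, ht, ← Finset.sum_sub_distrib]
            exact Finset.sum_congr rfl fun j _ => by ring
          rw [e]
          calc _ ≤ 1 * (1 / (m:ℝ)) := mul_le_mul (hc1 l) (hz l) (abs_nonneg _) zero_le_one
            _ = _ := one_mul _
      _ = _ := by simp [div_eq_mul_inv]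
  refine ⟨κ, z, hA, ?_⟩
  have h3 : ∀ j, u j * (u j - uap g m κ z W j) ≤ d / m := by
    intro j
    have := hA (Sum.inr j) (by rw [hstd]; exact hu1 j)
    rw [hstd (fun j => u j - uap g m κ z W j)] at this
    calc _ ≤ |u j * (u j - uap g m κ z W j)| := le_abs_self _
      _ ≤ 1 * (d / m) := by
        rw [abs_mul]
        exact mul_le_mul (hu1 j) this (abs_nonneg _) zero_le_one
      _ = _ := one_mul _
  have h4 : ∑ j, u j * (u j - uap g m κ z W j) ≤ ∑ j : Fin d, (d:ℝ) / m := Finset.sum_le_sum fun j _ => h3 j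
  have h5 : ∑ j, u j * (u j - uap g m κ z W j) = 1 - ∑ j, u j * uap g m κ z W j := by
    rw [← hu, ← Finset.sum_sub_distrib]
    exact Finset.sum_congr rfl fun j _ => by ring
  rw [h5] at h4
  simp only [Finset.sum_const, Finset.card_univ, Fintype.card_fin, nsmul_eq_mul] at h4
  have : (d:ℝ) * (d / m) = d ^ 2 / m := by ring
  linarith

/-- product of the non-selected factors -/
noncomputable def Pfun {n d : ℕ} (g l : ℝ) (m : ℕ) (κ : Fin d → Fin n ⊕ Fin d) (z : Fin d → Fin (2 * m + 1))
    (W : Fin n → Fin d → ℝ) : ℝ :=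
  ∏ i ∈ (Jset κ)ᶜ, (1 + Real.exp (-(l * |∑ j, uap g m κ z W j * W i j|)))

lemma determ {n d : ℕ} (G g l : ℝ) (hGg : G ≤ g) (hg : 0 < g) (hl : 0 < l) (m : ℕ) (hm : 0 < m)
    (hdm : (d:ℝ) ^ 2 / m ≤ 1)
    (W : Fin n → Fin d → ℝ) (u : Fin d → ℝ) (hu : ∑ j, u j ^ 2 = 1) :
    ∃ κ : Fin d → Fin n ⊕ Fin d, ∃ z : Fin d → Fin (2 * m + 1),
      (1 - (d:ℝ) ^ 2 / m) ^ 2 ≤ ∑ j, uap g m κ z W j ^ 2 ∧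
      ({x : Fin n → ℝ | (∀ i, x i = 0 ∨ x i = 1) ∧ ∑ i, x i * |∑ j, u j * W i j| ≤ G}.ncard : ℝ)
      ≤ Real.exp (l * G) * (Real.exp (l * (g * d / m)) ^ n * (2 ^ d * Pfun g l m κ z W)) := by
  classical
  have hmr : (0:ℝ) < m := by exact_mod_cast hm
  obtain ⟨κ, z, hA, hn⟩ := approx g m hm W u hu
  refine ⟨κ, z, ?_, ?_⟩
  · have hcs := Finset.sum_mul_sq_le_sq_mul_sq Finset.univ u (uap g m κ z W)
    rw [hu, one_mul] at hcs
    refine le_trans ?_ hcs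
    have : 0 ≤ 1 - (d:ℝ) ^ 2 / m := by linarith
    gcongr
  · have he1 : 1 ≤ Real.exp (l * (g * d / m)) := Real.one_le_exp (by positivity)
    set p : Fin n → ℝ := fun i => Real.exp (l * (g * d / m)) *
      (if i ∈ Jset κ then 2 else (1 + Real.exp (-(l * |∑ j, uap g m κ z W j * W i j|)))) with hp
    have key := count_le (fun i => |∑ j, u j * W i j|) (fun i => abs_nonneg _) G l hl.le p ?_ ?_
    · refine key.trans ?_
      refine mul_le_mul_of_nonneg_left ?_ (Real.exp_pos _).le
      rw [hp, Finset.prod_mul_distrib, Finset.prod_const, Finset.card_univ, Fintype.card_fin]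
      refine mul_le_mul_of_nonneg_left ?_ (by positivity)
      rw [← Finset.prod_mul_prod_compl (Jset κ)]
      have hP0 : 0 ≤ Pfun g l m κ z W := Finset.prod_nonneg fun i _ => by positivity
      refine mul_le_mul ?_ (le_of_eq ?_) (Finset.prod_nonneg fun i _ => ?_) (by positivity)
      · rw [Finset.prod_congr rfl (g := fun _ => (2:ℝ)) (fun i hi => by simp [hi]), Finset.prod_const]
        exact pow_le_pow_right₀ (by norm_num) (Jset_card κ)
      · unfold Pfun
        exact Finset.prod_congr rfl fun i hi => by simp [Finset.mem_compl.mp hi]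
      · split_ifs <;> positivity
    · intro i
      have : (1:ℝ) ≤ (if i ∈ Jset κ then 2 else (1 + Real.exp (-(l * |∑ j, uap g m κ z W j * W i j|)))) := by
        split_ifs
        · norm_num
        · linarith [Real.exp_pos (-(l * |∑ j, uap g m κ z W j * W i j|))]
      exact one_le_mul_of_one_le_of_one_le he1 this
    · intro i hi
      have hb : ∀ w : Fin d → ℝ, ∑ j, w j * bvec g W (Sum.inl i) j = (∑ j, w j * W i j) / g := by
        intro w
        rw [Finset.sum_div]
        exact Finset.sum_congr rfl fun j _ => by simp [bvec, mul_div_assoc]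
      have h1 := hA (Sum.inl i) (by
        rw [hb, abs_div, abs_of_pos hg, div_le_one hg]; exact hi.trans hGg)
      rw [hb (fun j => u j - uap g m κ z W j), abs_div, abs_of_pos hg, div_le_iff₀ hg] at h1
      have h2 : ∑ j, (u j - uap g m κ z W j) * W i j = (∑ j, u j * W i j) - ∑ j, uap g m κ z W j * W i j := by
        rw [← Finset.sum_sub_distrib]
        exact Finset.sum_congr rfl fun j _ => by ring
      rw [h2] at h1
      set a := ∑ j, u j * W i j
      set b := ∑ j, uap g m κ z W j * W i j
      have h3 : |b| - |a| ≤ g * d / m := by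
        have := abs_sub_abs_le_abs_sub b a
        rw [abs_sub_comm] at this
        have e : (d:ℝ) / m * g = g * d / m := by ring
        linarith
      simp only [hp]
      split_ifs
      · have : Real.exp (-(l * |a|)) ≤ 1 := Real.exp_le_one_iff.mpr (by have := abs_nonneg a; nlinarith)
        nlinarith
      · have : Real.exp (-(l * |a|)) ≤ Real.exp (l * (g * d / m)) * Real.exp (-(l * |b|)) := by
          rw [← Real.exp_add]
          apply Real.exp_le_exp.mpr
          nlinarith
        rw [mul_add, mul_one]
        linarith

lemma tonelli_bound {n d : ℕ} (μ : Fin n → Measure (Fin d → ℝ)) [∀ i, IsProbabilityMeasure (μ i)]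
    (hlc : ∀ i, IsLogConcave (μ i)) (hcov : ∀ i, HasIdCovariance (μ i)) (q l : ℝ) (hq : 0 < q) (hl : 0 < l)
    (U : (Fin n → Fin d → ℝ) → Fin d → ℝ) (hU : Measurable U) (J : Finset (Fin n))
    (hJ : ∀ i, i ∉ J → ∀ W w, U (Function.update W i w) = U W) (S : Finset (Fin n)) :
    Disjoint S J →
    ∫⁻ W, (if q ^ 2 ≤ ∑ j, U W j ^ 2 then (1 : ℝ≥0∞) else 0) *
      ∏ i ∈ S, ENNReal.ofReal (1 + Real.exp (-(l * |∑ j, U W j * W i j|))) ∂(Measure.pi μ)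
      ≤ ENNReal.ofReal (1 + 2 / (q * l)) ^ S.card := by
  classical
  have hUj : ∀ j, Measurable (fun W => U W j) := fun j => (measurable_pi_apply j).comp hU
  have hm : ∀ S : Finset (Fin n), Measurable (fun W : Fin n → Fin d → ℝ =>
      (if q ^ 2 ≤ ∑ j, U W j ^ 2 then (1 : ℝ≥0∞) else 0) *
      ∏ i ∈ S, ENNReal.ofReal (1 + Real.exp (-(l * |∑ j, U W j * W i j|)))) := by
    intro S
    refine Measurable.mul ?_ ?_
    · refine Measurable.ite ?_ measurable_const measurable_const
      exact measurableSet_le measurable_const (Finset.measurable_sum _ fun j _ => (hUj j).pow_const 2)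
    · refine Finset.measurable_prod _ fun i _ => ?_
      have h1 : Measurable (fun W : Fin n → Fin d → ℝ => ∑ j, U W j * W i j) :=
        Finset.measurable_sum _ fun j _ => (hUj j).mul ((measurable_pi_apply j).comp (measurable_pi_apply i))
      have h2 : Measurable (fun s : ℝ => ENNReal.ofReal (1 + Real.exp (-(l * |s|)))) := by fun_prop
      exact h2.comp h1
  induction S using Finset.induction_on with
  | empty =>
    intro _
    simp only [Finset.prod_empty, mul_one, Finset.card_empty, pow_zero]
    calc _ ≤ ∫⁻ W, 1 ∂(Measure.pi μ) := by
          apply lintegral_mono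
          intro W
          dsimp only
          split_ifs <;> simp
      _ = 1 := by simp
  | insert i S hi ih =>
    intro hd
    rw [Finset.disjoint_insert_left] at hd
    have ih := ih hd.2
    rw [Finset.card_insert_of_notMem hi, pow_succ' (ENNReal.ofReal (1 + 2 / (q * l)))]
    refine le_trans ?_ (mul_le_mul_right ih _)
    rw [← lintegral_const_mul _ (hm S)]
    refine lintegral_le_of_lmarginal_le {i} (hm _) ((hm S).const_mul _) ?_
    rw [lmarginal_singleton, lmarginal_singleton]
    intro W
    have hne : ∀ k ∈ S, ∀ w : Fin d → ℝ, Function.update W i w k = W k := by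
      intro k hk w
      rw [Function.update_of_ne]
      rintro rfl
      exact hi hk
    have hprod : ∀ w : Fin d → ℝ, ∏ k ∈ S, ENNReal.ofReal (1 + Real.exp (-(l * |∑ j, U W j * Function.update W i w k j|)))
        = ∏ k ∈ S, ENNReal.ofReal (1 + Real.exp (-(l * |∑ j, U W j * W k j|))) := by
      intro w
      exact Finset.prod_congr rfl fun k hk => by rw [hne k hk w]
    simp only [hJ i hd.1, Finset.prod_insert hi, Function.update_self, hprod]
    rw [lintegral_const, measure_univ, mul_one]
    by_cases hc : q ^ 2 ≤ ∑ j, U W j ^ 2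
    · simp only [hc, if_true, one_mul]
      rw [lintegral_mul_const]
      · refine mul_le_mul_left ?_ _
        set r := Real.sqrt (∑ j, U W j ^ 2) with hr
        have hrq : q ≤ r := Real.le_sqrt_of_sq_le hc
        have hr2 : ∑ j, U W j ^ 2 = r ^ 2 := (Real.sq_sqrt (Finset.sum_nonneg fun j _ => sq_nonneg _)).symm
        refine (proj_exp (μ i) (hlc i) (hcov i) (U W) r (hq.trans_le hrq) hr2 l hl).trans ?_
        apply ENNReal.ofReal_le_ofReal
        gcongr
      · fun_prop
    · simp [hc]

lemma event_bound {n d : ℕ} (μ : Fin n → Measure (Fin d → ℝ)) [∀ i, IsProbabilityMeasure (μ i)]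
    (hlc : ∀ i, IsLogConcave (μ i)) (hcov : ∀ i, HasIdCovariance (μ i)) (q l g T : ℝ) (hq : 0 < q) (hl : 0 < l)
    (hT : 0 < T) (m : ℕ) (κ : Fin d → Fin n ⊕ Fin d) (z : Fin d → Fin (2 * m + 1)) :
    (Measure.pi μ) {W | q ^ 2 ≤ ∑ j, uap g m κ z W j ^ 2 ∧ T < Pfun g l m κ z W}
      ≤ ENNReal.ofReal ((1 + 2 / (q * l)) ^ n / T) := by
  classical
  have hb := tonelli_bound μ hlc hcov q l hq hl (uap g m κ z) (uap_meas g m κ z) (Jset κ)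
    (fun i hi W w => uap_update g m κ z W i hi w) (Jset κ)ᶜ disjoint_compl_left
  have hc1 : 1 ≤ 1 + 2 / (q * l) := by
    have : 0 < 2 / (q * l) := by positivity
    linarith
  have hb2 : ENNReal.ofReal (1 + 2 / (q * l)) ^ (Jset κ)ᶜ.card ≤ ENNReal.ofReal ((1 + 2 / (q * l)) ^ n) := by
    rw [← ENNReal.ofReal_pow (by linarith)]
    apply ENNReal.ofReal_le_ofReal
    apply pow_le_pow_right₀ hc1
    exact (Finset.card_le_univ _).trans (by simp)
  have hm : Measurable (fun W : Fin n → Fin d → ℝ =>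
      (if q ^ 2 ≤ ∑ j, uap g m κ z W j ^ 2 then (1 : ℝ≥0∞) else 0) *
      ∏ i ∈ (Jset κ)ᶜ, ENNReal.ofReal (1 + Real.exp (-(l * |∑ j, uap g m κ z W j * W i j|)))) := by
    have hUj : ∀ j, Measurable (fun W : Fin n → Fin d → ℝ => uap g m κ z W j) :=
      fun j => (measurable_pi_apply j).comp (uap_meas g m κ z)
    refine Measurable.mul ?_ ?_
    · refine Measurable.ite ?_ measurable_const measurable_const
      exact measurableSet_le measurable_const (Finset.measurable_sum _ fun j _ => (hUj j).pow_const 2)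
    · refine Finset.measurable_prod _ fun i _ => ?_
      have h1 : Measurable (fun W : Fin n → Fin d → ℝ => ∑ j, uap g m κ z W j * W i j) :=
        Finset.measurable_sum _ fun j _ => (hUj j).mul ((measurable_pi_apply j).comp (measurable_pi_apply i))
      have h2 : Measurable (fun s : ℝ => ENNReal.ofReal (1 + Real.exp (-(l * |s|)))) := by fun_prop
      exact h2.comp h1
  have hmk := meas_ge_le_lintegral_div (μ := Measure.pi μ) hm.aemeasurable (ε := ENNReal.ofReal T)
    (by simpa using hT) ENNReal.ofReal_ne_top
  rw [ENNReal.ofReal_div_of_pos hT]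
  refine le_trans (measure_mono ?_) (hmk.trans (ENNReal.div_le_div_right (hb.trans hb2) _))
  rintro W ⟨h1, h2⟩
  have : ENNReal.ofReal T ≤ (if q ^ 2 ≤ ∑ j, uap g m κ z W j ^ 2 then (1 : ℝ≥0∞) else 0) *
      ∏ i ∈ (Jset κ)ᶜ, ENNReal.ofReal (1 + Real.exp (-(l * |∑ j, uap g m κ z W j * W i j|))) := by
    rw [if_pos h1, one_mul, ← ENNReal.ofReal_prod_of_nonneg (fun i _ => by positivity)]
    exact ENNReal.ofReal_le_ofReal h2.le
  exact this

lemma num_N (d n : ℕ) (hd : 1 ≤ d) (hn : 100 * d ≤ n) :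
    (2:ℝ) ^ d * ((n + d) ^ d * (2 * n ^ 3 + 1) ^ d) ≤ (357 * (n:ℝ) ^ 6) ^ (d + 1) := by
  have hd' : (1:ℝ) ≤ d := by exact_mod_cast hd
  have hn' : 100 * (d:ℝ) ≤ n := by exact_mod_cast hn
  have hn1 : (100:ℝ) ≤ n := by linarith
  rw [← mul_pow, ← mul_pow]
  have hn6 : (1:ℝ) ≤ (n:ℝ) ^ 2 := by nlinarith
  have h4 : (n:ℝ) ^ 4 ≤ (n:ℝ) ^ 6 := pow_le_pow_right₀ (by linarith) (by norm_num)
  have h41 : (1:ℝ) ≤ (n:ℝ) ^ 4 := one_le_pow₀ (by linarith)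
  have h31 : (1:ℝ) ≤ (n:ℝ) ^ 3 := one_le_pow₀ (by linarith)
  have hA : 2 * ((n + d) * (2 * (n:ℝ) ^ 3 + 1)) ≤ 357 * (n:ℝ) ^ 6 := by
    calc 2 * ((n + d) * (2 * (n:ℝ) ^ 3 + 1)) ≤ 2 * ((n + n) * (2 * (n:ℝ) ^ 3 + n ^ 3)) := by
          gcongr; linarith
      _ = 12 * (n:ℝ) ^ 4 := by ring
      _ ≤ _ := by nlinarith
  have hB : (1:ℝ) ≤ 357 * (n:ℝ) ^ 6 := by linarith
  have hA0 : 0 ≤ 2 * ((n + d) * (2 * (n:ℝ) ^ 3 + 1)) := by positivity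
  generalize 357 * (n:ℝ) ^ 6 = X at *
  exact (pow_le_pow_left₀ hA0 hA d).trans (pow_le_pow_right₀ hB (Nat.le_succ d))

lemma numerics (d n : ℕ) (hd : 1 ≤ d) (hn : 100 * d ≤ n) (G : ℝ) (hG : 0 ≤ G) (hGn : G ≤ n) (δ : ℝ) (hδ : 0 < δ)
    (g l q : ℝ) (hg : g = G + 1 / n) (hl : l = Real.sqrt (2 * n / g)) (hq : q = 1 - (d:ℝ) ^ 2 / ((n ^ 3 : ℕ) : ℝ)) :
    Real.exp (l * G) * (Real.exp (l * (g * d / ((n ^ 3 : ℕ) : ℝ))) ^ n * (2 ^ d *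
      (((((n + d) ^ d * (2 * n ^ 3 + 1) ^ d : ℕ)) : ℝ) * (1 + 2 / (q * l)) ^ n / δ)))
    ≤ 60 * (357 * (n : ℝ) ^ 6) ^ (d + 1) * Real.exp (2 * Real.sqrt (2 * n * G)) / δ := by
  have hd' : (1:ℝ) ≤ d := by exact_mod_cast hd
  have hn' : 100 * (d:ℝ) ≤ n := by exact_mod_cast hn
  have hn1 : (100:ℝ) ≤ n := by linarith
  have hn0 : (0:ℝ) < n := by linarith
  have hg0 : 0 < g := by rw [hg]; positivity
  have hl0 : 0 < l := by rw [hl]; positivity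
  set s := Real.sqrt (2 * n * g) with hs
  have hs0 : 0 < s := by rw [hs]; positivity
  have hls : l * g = s := by
    rw [hl, hs, show 2 * n * g = (2 * n / g) * g ^ 2 by field_simp, Real.sqrt_mul (by positivity),
      Real.sqrt_sq hg0.le]
  have hs2 : s ^ 2 = 2 * n * g := Real.sq_sqrt (by positivity)
  have hl2 : 2 * n / l = s := by
    rw [div_eq_iff hl0.ne']
    have : l = s / g := by rw [← hls]; field_simp
    rw [this, show s * (s / g) = s ^ 2 / g by ring, hs2]; field_simp
  have hng : 2 * n * g = 2 * n * G + 2 := by rw [hg]; field_simp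
  have hs3 : s ≤ Real.sqrt (2 * n * G) + 1.5 := by
    rw [hs, hng]
    apply Real.sqrt_le_iff.mpr
    constructor
    · positivity
    · have := Real.sq_sqrt (show 0 ≤ 2 * n * G by positivity)
      nlinarith [Real.sqrt_nonneg (2 * n * G)]
  have hs4 : s ≤ 2 * n := by
    rw [hs, hng]
    apply Real.sqrt_le_iff.mpr
    constructor
    · positivity
    · nlinarith
  push_cast at hq ⊢
  have hdq : (d:ℝ) ^ 2 / n ^ 3 ≤ 1 / (10000 * n) := by
    rw [div_le_div_iff₀ (by positivity) (by positivity)]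
    have : (100 * (d:ℝ)) ^ 2 ≤ n ^ 2 := by gcongr
    nlinarith
  have hsm : 1 / (10000 * (n:ℝ)) ≤ 1 / 100 := by
    apply one_div_le_one_div_of_le (by norm_num) (by linarith)
  have hq0 : 1 / 2 ≤ q := by rw [hq]; linarith
  have hqp : 0 < q := by linarith
  have hqi : 1 / q ≤ 1 + 2 * (1 / (10000 * n)) := by
    rw [div_le_iff₀ hqp]
    have h1 : 1 - 1 / (10000 * (n:ℝ)) ≤ q := by rw [hq]; linarith
    have h2 : 0 < 1 / (10000 * (n:ℝ)) := by positivity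
    generalize 1 / (10000 * (n:ℝ)) = x at *
    nlinarith
  have hC : (1 + 2 / (q * l)) ^ n ≤ Real.exp (s + 1 / 100) := by
    calc _ ≤ Real.exp (2 / (q * l)) ^ n := by
          gcongr
          linarith [Real.add_one_le_exp (2 / (q * l))]
      _ = Real.exp (s * (1 / q)) := by
          rw [← Real.exp_nat_mul, ← hl2]; congr 1; field_simp
      _ ≤ _ := by
          apply Real.exp_le_exp.mpr
          calc s * (1 / q) ≤ s * (1 + 2 * (1 / (10000 * n))) := by gcongr
            _ = s + s * (2 * (1 / (10000 * n))) := by ring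
            _ ≤ s + (2 * n) * (2 * (1 / (10000 * n))) := by gcongr
            _ ≤ _ := by
              have : (2 * (n:ℝ)) * (2 * (1 / (10000 * n))) = 4 / 10000 := by field_simp; norm_num
              rw [this]; norm_num
  have hE : Real.exp (l * (g * d / n ^ 3)) ^ n ≤ Real.exp (1 / 10) := by
    rw [← Real.exp_nat_mul]
    apply Real.exp_le_exp.mpr
    have : (n:ℝ) * (l * (g * d / n ^ 3)) = s * d / n ^ 2 := by rw [← hls]; field_simp
    rw [this, div_le_iff₀ (by positivity)]
    nlinarith
  have hL : Real.exp (l * G) ≤ Real.exp s := by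
    apply Real.exp_le_exp.mpr
    rw [← hls]
    gcongr
    rw [hg]; linarith [show 0 < 1 / (n:ℝ) by positivity]
  have he4 : Real.exp 4 ≤ 60 := by
    have h1 := Real.exp_one_lt_d9
    have : Real.exp 4 = Real.exp 1 ^ 4 := by rw [← Real.exp_nat_mul]; norm_num
    rw [this]
    calc _ ≤ (2.7182818286 : ℝ) ^ 4 := by gcongr
      _ ≤ _ := by norm_num
  have hN := num_N d n hd hn
  have hX : Real.exp s * (Real.exp (1 / 10) * Real.exp (s + 1 / 100)) ≤ 60 * Real.exp (2 * Real.sqrt (2 * n * G)) := by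
    calc _ ≤ Real.exp (4 + 2 * Real.sqrt (2 * n * G)) := by
          rw [← Real.exp_add, ← Real.exp_add]
          apply Real.exp_le_exp.mpr
          linarith
      _ = Real.exp 4 * Real.exp (2 * Real.sqrt (2 * n * G)) := Real.exp_add _ _
      _ ≤ _ := by gcongr
  calc _ = (Real.exp (l * G) * (Real.exp (l * (g * d / n ^ 3)) ^ n * (1 + 2 / (q * l)) ^ n)) *
        ((2:ℝ) ^ d * ((n + d) ^ d * (2 * n ^ 3 + 1) ^ d)) / δ := by ring
    _ ≤ (Real.exp s * (Real.exp (1 / 10) * Real.exp (s + 1 / 100))) * (357 * (n:ℝ) ^ 6) ^ (d + 1) / δ := by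
        gcongr
    _ ≤ (60 * Real.exp (2 * Real.sqrt (2 * n * G))) * (357 * (n:ℝ) ^ 6) ^ (d + 1) / δ := by gcongr
    _ = _ := by ring

/-- for `n ≥ 100d`, `G ≥ 0`, and a random matrix `W ∈ ℝ^{d×n}` with
independent logconcave identity-covariance columns, with probability at least
`1 − δ − e^{−n/5}` every unit vector `u` satisfies
`|{x ∈ {0,1}ⁿ : Σᵢ xᵢ·|uᵀWᵢ| ≤ G}| ≤ 60·(357n⁶)^{d+1}·e^{2√(2nG)}/δ`. -/
theorem stmt_15 (d n : ℕ) (hn : 100 * d ≤ n) (G : ℝ) (hG : 0 ≤ G)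
    (μ : Fin n → Measure (Fin d → ℝ))
    [∀ i, IsProbabilityMeasure (μ i)]
    (hlc : ∀ i, IsLogConcave (μ i)) (hcov : ∀ i, HasIdCovariance (μ i))
    (δ : ℝ) (hδ : δ ∈ Set.Ioo (0 : ℝ) 1) :
    (Measure.pi μ)
      {W : Fin n → Fin d → ℝ | ∀ u : Fin d → ℝ, (∑ j, u j ^ 2) = 1 →
        ({x : Fin n → ℝ | (∀ i, x i = 0 ∨ x i = 1) ∧
            ∑ i, x i * |∑ j, u j * W i j| ≤ G}.ncard : ℝ)
          ≤ 60 * (357 * (n : ℝ) ^ 6) ^ (d + 1) * Real.exp (2 * Real.sqrt (2 * n * G)) / δ}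
      ≥ ENNReal.ofReal (1 - δ - Real.exp (-(n : ℝ) / 5)) := by
  obtain ⟨hδ0, hδ1⟩ := hδ
  set R := 60 * (357 * (n : ℝ) ^ 6) ^ (d + 1) * Real.exp (2 * Real.sqrt (2 * n * G)) / δ with hR
  have htriv : (∀ W : Fin n → Fin d → ℝ, ∀ u : Fin d → ℝ, (∑ j, u j ^ 2) = 1 →
        ({x : Fin n → ℝ | (∀ i, x i = 0 ∨ x i = 1) ∧
            ∑ i, x i * |∑ j, u j * W i j| ≤ G}.ncard : ℝ) ≤ R) →
      (Measure.pi μ)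
      {W : Fin n → Fin d → ℝ | ∀ u : Fin d → ℝ, (∑ j, u j ^ 2) = 1 →
        ({x : Fin n → ℝ | (∀ i, x i = 0 ∨ x i = 1) ∧
            ∑ i, x i * |∑ j, u j * W i j| ≤ G}.ncard : ℝ) ≤ R}
      ≥ ENNReal.ofReal (1 - δ - Real.exp (-(n : ℝ) / 5)) := by
    intro h
    have : {W : Fin n → Fin d → ℝ | ∀ u : Fin d → ℝ, (∑ j, u j ^ 2) = 1 →
        ({x : Fin n → ℝ | (∀ i, x i = 0 ∨ x i = 1) ∧
            ∑ i, x i * |∑ j, u j * W i j| ≤ G}.ncard : ℝ) ≤ R} = Set.univ := Set.eq_univ_of_forall h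
    rw [this, measure_univ]
    rw [ge_iff_le, ENNReal.ofReal_le_one]
    linarith [Real.exp_pos (-(n : ℝ) / 5)]
  rcases Nat.eq_zero_or_pos d with hd | hd
  · subst hd
    apply htriv
    intro W u hu
    simp at hu
  have hn100 : 100 ≤ n := by omega
  have hn1 : (100:ℝ) ≤ n := by exact_mod_cast hn100
  have hn0 : (0:ℝ) < n := by linarith
  rcases lt_or_ge (n:ℝ) G with hGn | hGn
  · apply htriv
    intro W u hu
    have h1 := count_le (fun i => |∑ j, u j * W i j|) (fun i => abs_nonneg _) G 0 le_rfl (fun _ => 2)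
      (fun _ => by norm_num) (fun i _ => by norm_num)
    refine h1.trans ?_
    simp only [zero_mul, Real.exp_zero, one_mul, Finset.prod_const, Finset.card_univ, Fintype.card_fin]
    have h2 : (2:ℝ) ^ n ≤ Real.exp (2 * Real.sqrt (2 * n * G)) := by
      calc (2:ℝ) ^ n ≤ Real.exp 1 ^ n := by
            gcongr
            linarith [Real.add_one_le_exp 1]
        _ = Real.exp n := by rw [← Real.exp_nat_mul, mul_one]
        _ ≤ _ := by
          apply Real.exp_le_exp.mpr
          have : (n:ℝ) ≤ Real.sqrt (2 * n * G) := by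
            apply Real.le_sqrt_of_sq_le
            nlinarith
          linarith
    refine h2.trans ?_
    rw [hR, le_div_iff₀ hδ0]
    have h3 : (1:ℝ) ≤ (357 * (n : ℝ) ^ 6) ^ (d + 1) := by
      apply one_le_pow₀
      have : (1:ℝ) ≤ (n:ℝ) ^ 6 := one_le_pow₀ (by linarith)
      linarith
    have h4 := Real.exp_pos (2 * Real.sqrt (2 * n * G))
    calc _ ≤ Real.exp (2 * Real.sqrt (2 * n * G)) * 1 := by gcongr
      _ = 1 * Real.exp (2 * Real.sqrt (2 * n * G)) := by ring
      _ ≤ _ := by gcongr; linarith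
  · set g := G + 1 / (n:ℝ) with hg
    set l := Real.sqrt (2 * n / g) with hl
    set q := 1 - (d:ℝ) ^ 2 / ((n ^ 3 : ℕ) : ℝ) with hq
    have hg0 : 0 < g := by rw [hg]; positivity
    have hl0 : 0 < l := by rw [hl]; positivity
    have hdm : (d:ℝ) ^ 2 / ((n ^ 3 : ℕ) : ℝ) < 1 := by
      push_cast
      rw [div_lt_one (by positivity)]
      have hdn : (d:ℝ) ≤ n := by
        have : d ≤ n := by omega
        exact_mod_cast this
      calc (d:ℝ) ^ 2 ≤ (n:ℝ) ^ 2 := by gcongr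
        _ < (n:ℝ) ^ 3 := by
          have : (0:ℝ) < n ^ 2 := by positivity
          nlinarith
    have hq0 : 0 < q := by rw [hq]; linarith
    have hnum := numerics d n hd hn G hG hGn δ hδ0 g l q hg hl hq
    set N : ℕ := (n + d) ^ d * (2 * n ^ 3 + 1) ^ d with hN
    have hN0 : (0:ℝ) < N := by
      have : 0 < N := by rw [hN]; positivity
      exact_mod_cast this
    set T := (N:ℝ) * (1 + 2 / (q * l)) ^ n / δ with hT
    have hT0 : 0 < T := by rw [hT]; positivity
    set E : (Fin d → Fin n ⊕ Fin d) × (Fin d → Fin (2 * n ^ 3 + 1)) → Set (Fin n → Fin d → ℝ) :=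
      fun a => {W | q ^ 2 ≤ ∑ j, uap g (n ^ 3) a.1 a.2 W j ^ 2 ∧ T < Pfun g l (n ^ 3) a.1 a.2 W} with hE
    have hU : (Measure.pi μ) (⋃ a, E a) ≤ ENNReal.ofReal δ := by
      refine (measure_iUnion_fintype_le _ _).trans ?_
      calc _ ≤ ∑ a : (Fin d → Fin n ⊕ Fin d) × (Fin d → Fin (2 * n ^ 3 + 1)),
            ENNReal.ofReal ((1 + 2 / (q * l)) ^ n / T) :=
            Finset.sum_le_sum fun a _ => event_bound μ hlc hcov q l g T hq0 hl0 hT0 (n ^ 3) a.1 a.2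
        _ = (N : ℝ≥0∞) * ENNReal.ofReal ((1 + 2 / (q * l)) ^ n / T) := by
            rw [Finset.sum_const, nsmul_eq_mul]
            congr 2
            simp [hN]
        _ = ENNReal.ofReal ((N:ℝ) * ((1 + 2 / (q * l)) ^ n / T)) := by
            rw [ENNReal.ofReal_mul hN0.le, ENNReal.ofReal_natCast]
        _ ≤ _ := by
            apply ENNReal.ofReal_le_ofReal
            apply le_of_eq
            have : (0:ℝ) < (1 + 2 / (q * l)) ^ n := by positivity
            rw [hT]
            generalize (1 + 2 / (q * l)) ^ n = C at *
            field_simp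
    set S := {W : Fin n → Fin d → ℝ | ∀ u : Fin d → ℝ, (∑ j, u j ^ 2) = 1 →
        ({x : Fin n → ℝ | (∀ i, x i = 0 ∨ x i = 1) ∧
            ∑ i, x i * |∑ j, u j * W i j| ≤ G}.ncard : ℝ) ≤ R} with hS
    have hcover : Set.univ ⊆ S ∪ ⋃ a, E a := by
      intro W _
      by_cases hW : W ∈ ⋃ a, E a
      · exact Or.inr hW
      · left
        have hmem : ∀ u : Fin d → ℝ, (∑ j, u j ^ 2) = 1 →
          ({x : Fin n → ℝ | (∀ i, x i = 0 ∨ x i = 1) ∧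
            ∑ i, x i * |∑ j, u j * W i j| ≤ G}.ncard : ℝ) ≤ R := by
          intro u hu
          obtain ⟨κ, z, h1, h2⟩ := determ G g l (by rw [hg]; linarith [show 0 < 1 / (n:ℝ) by positivity])
            hg0 hl0 (n ^ 3) (by positivity) hdm.le W u hu
          have h3 : Pfun g l (n ^ 3) κ z W ≤ T := by
            by_contra hcon
            push Not at hcon
            apply hW
            rw [Set.mem_iUnion]
            exact ⟨(κ, z), h1, hcon⟩
          refine h2.trans (le_trans ?_ hnum)
          gcongr
        exact hmem
    have h1 : (1:ℝ≥0∞) ≤ (Measure.pi μ) S + ENNReal.ofReal δ := by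
      calc (1:ℝ≥0∞) = (Measure.pi μ) Set.univ := measure_univ.symm
        _ ≤ _ := (measure_mono hcover).trans ((measure_union_le _ _).trans (by gcongr))
    rw [ge_iff_le]
    calc ENNReal.ofReal (1 - δ - Real.exp (-(n : ℝ) / 5)) ≤ ENNReal.ofReal (1 - δ) := by
          apply ENNReal.ofReal_le_ofReal
          linarith [Real.exp_pos (-(n : ℝ) / 5)]
      _ = 1 - ENNReal.ofReal δ := by rw [ENNReal.ofReal_sub _ hδ0.le, ENNReal.ofReal_one]
      _ ≤ _ := tsub_le_iff_right.mpr h1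
end
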